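/- arXiv:1410.4384 — 2 statements merged into one kernel-verified Lean document; each statement's English description precedes it below -/
import Mathlib

section
/- Let F ∈ S^♯♭(σ0,σ1), assume 0 ∉ Z(F) and τ ∉ Z(F), and let τ ∈ [σ1, 2σ0] be a real number with τ ∉ {σ1 − conj(s_i) : i = 2M+δ(σ1)+1, …, N} and such that λ_j τ + μ_j is not a pole of Γ for any j. Let m ≥ 0 be the order of the pole of F at τ (m = 0 if F is analytic at τ) and let F′(s)/F(s) = ∑_{ℓ=−1}^{∞} b_ℓ (s−τ)^ℓ be the Laurent expansion of F′/F at τ (so b_{−1} = −m). Then for every positive integer n, λ_F(n,τ) = ∑_{i=1,…,N, s_i ≠ τ} m_i·(1 − (s_i/(s_i−τ))^n) + ∑_{i=2M+δ(σ1)+1}^{N} m_i·(1 − ((σ1−conj(s_i))/(σ1−τ−conj(s_i)))^n) + n·τ·log Q_F + ∑_{k=1}^{n} binom(n,k)·τ^k·b_{k−1} + ∑_{k=1}^{n} binom(n,k)·(τ^k/(k−1)!)·∑_{j=1}^{r} λ_j^k·Ψ^{(k−1)}(λ_j τ + μ_j), where Ψ = Γ′/Γ is the digamma function and Ψ^{(m)}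 its m-th derivative. -/
open Complex Filter MeasureTheory Finset

noncomputable section

/-- The order of vanishing of `f` at `ρ`. -/
noncomputable def zeroOrder (f : ℂ → ℂ) (ρ : ℂ) : ℕ :=
  sInf {k : ℕ | iteratedDeriv k f ρ ≠ 0}

/-- The class `S^♯♭(σ₀,σ₁)` of `L`-functions. -/
structure SSF (σ0 σ1 : ℝ) : Type where
  hσ1pos : 0 < σ1
  hσ : σ1 ≤ σ0
  /-- The `L`-function itself (as a function, analytic away from the poles). -/
  F : ℂ → ℂ
  /-- Dirichlet series coefficients. -/
  a : ℕ → ℂ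
  hDir : ∀ s : ℂ, σ0 < s.re →
    HasSum (fun n : ℕ => a (n + 1) * ((n + 1 : ℕ) : ℂ) ^ (-s)) (F s)
  hDirAbs : ∀ s : ℂ, σ0 < s.re →
    Summable (fun n : ℕ => ‖a (n + 1) * ((n + 1 : ℕ) : ℂ) ^ (-s)‖)
  /-- The number of poles. -/
  N : ℕ
  /-- The poles `s₁, …, s_N`. -/
  pole : Fin N → ℂ
  /-- Their orders `m₁, …, m_N`. -/
  m : Fin N → ℕ
  hm : ∀ i, 0 < m i
  /-- Entire continuation of `∏ (s - sᵢ)^{mᵢ} · F s`, of finite order. -/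
  G : ℂ → ℂ
  hGdiff : Differentiable ℂ G
  hGord : ∃ c B : ℝ, ∀ s : ℂ, ‖G s‖ ≤ c * Real.exp (‖s‖ ^ B)
  hGF : ∀ s : ℂ, (∀ i, s ≠ pole i) → G s = (∏ i, (s - pole i) ^ m i) * F s
  Q : ℝ
  hQ : 0 < Q
  r : ℕ
  lam : Fin r → ℝ
  hlam : ∀ j, 0 < lam j
  mu : Fin r → ℂ
  ω : ℂ
  hω : ‖ω‖ = 1
  M : ℕ
  /-- `δ(σ₁) ∈ {0,1}`. -/
  dlt : ℕ
  hdlt : dlt ≤ 1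
  hMN : 2 * M + dlt ≤ N
  hpair : ∀ (j : ℕ) (h1 : 2 * j < N) (h2 : 2 * j + 1 < N), j < M →
    pole ⟨2 * j, h1⟩ + (starRingEnd ℂ) (pole ⟨2 * j + 1, h2⟩) = (σ1 : ℂ)
  hdelta : dlt = 1 ↔ ∃ i, pole i = (σ1 / 2 : ℂ)
  hdeltaPos : dlt = 1 → ∀ h2 : 2 * M < N, pole ⟨2 * M, h2⟩ = (σ1 / 2 : ℂ)
  /-- The completed function `ξ_F` (the analytic continuation of the completed product). -/
  xi : ℂ → ℂ
  hxiDiff : Differentiable ℂ xi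
  hxiEq : ∀ s : ℂ, (∀ i, s ≠ pole i) →
    (∀ (j : Fin r) (k : ℕ), (lam j : ℂ) * s + mu j ≠ -(k : ℂ)) →
    xi s = F s * (Q : ℂ) ^ s * (∏ j, Complex.Gamma ((lam j : ℂ) * s + mu j)) *
      (∏ i, (s - pole i) ^ m i) *
      ∏ i : Fin N, (if 2 * M + dlt ≤ (i : ℕ) then ((σ1 : ℂ) - s - (starRingEnd ℂ) (pole i)) ^ m i else 1)
  hFE : ∀ s : ℂ, xi s = ω * (starRingEnd ℂ) (xi ((σ1 : ℂ) - (starRingEnd ℂ) s))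
  /-- The coefficients of the Dirichlet series of `-F'/F`. -/
  c : ℕ → ℂ
  hEuler : ∀ s : ℂ, σ0 < s.re →
    HasSum (fun n : ℕ => c (n + 2) * ((n + 2 : ℕ) : ℂ) ^ (-s)) (-(deriv F s / F s))
  hEulerAbs : ∀ s : ℂ, σ0 < s.re →
    Summable (fun n : ℕ => ‖c (n + 2) * ((n + 2 : ℕ) : ℂ) ^ (-s)‖)

namespace SSF

variable {σ0 σ1 : ℝ}

/-- Truncated sum over the nontrivial zeros (zeros of `ξ_F`) with `|Im ρ| ≤ T`,
counted with multiplicity. -/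
noncomputable def zsum (S : SSF σ0 σ1) (w : ℂ → ℂ) (T : ℝ) : ℂ :=
  ∑' ρ : {ρ : ℂ // S.xi ρ = 0 ∧ |ρ.im| ≤ T}, (zeroOrder S.xi ρ : ℂ) * w ρ

end SSF

theorem analyticOrderAt_ne_top_of_entire {f : ℂ → ℂ} (hf : Differentiable ℂ f) {a : ℂ}
    (ha : f a ≠ 0) (ρ : ℂ) : analyticOrderAt f ρ ≠ ⊤ := by
  intro h
  have h1 : f =ᶠ[nhds ρ] 0 := analyticOrderAt_eq_top.mp h
  have h2 : AnalyticOnNhd ℂ f Set.univ := fun z _ => hf.analyticAt z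
  have := h2.eqOn_zero_of_preconnected_of_eventuallyEq_zero isPreconnected_univ (Set.mem_univ ρ) h1
  exact ha (this (Set.mem_univ a))

theorem analyticOrderAt_eq_zeroOrder {f : ℂ → ℂ} (hf : Differentiable ℂ f) {a : ℂ}
    (ha : f a ≠ 0) (ρ : ℂ) : analyticOrderAt f ρ = zeroOrder f ρ := by
  have h := analyticOrderAt_ne_top_of_entire hf ha ρ
  obtain ⟨k, hk⟩ := ENat.ne_top_iff_exists.mp h
  rw [← hk]
  have h3 := (analyticOrderAt_eq_nat_iff_iteratedDeriv_eq_zero (hf.analyticAt ρ)).mp hk.symm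
  congr 1
  apply le_antisymm
  · refine le_csInf ⟨k, h3.2⟩ ?_
    intro b hb
    by_contra hlt
    exact hb (h3.1 b (not_le.mp hlt))
  · exact Nat.sInf_le h3.2

theorem zeroOrder_pos {f : ℂ → ℂ} (hf : Differentiable ℂ f) {a : ℂ}
    (ha : f a ≠ 0) {ρ : ℂ} (hρ : f ρ = 0) : 0 < zeroOrder f ρ := by
  have h1 := analyticOrderAt_eq_zeroOrder hf ha ρ
  have h2 : analyticOrderAt f ρ ≠ 0 := analyticOrderAt_ne_zero.mpr ⟨hf.analyticAt ρ, hρ⟩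
  rw [h1] at h2
  exact Nat.pos_of_ne_zero (by exact_mod_cast h2)

/-- Dividing an entire function by the full power of `z - ρ`. -/
theorem exists_entire_factor {f : ℂ → ℂ} (hf : Differentiable ℂ f) {a : ℂ}
    (ha : f a ≠ 0) (ρ : ℂ) : ∃ e : ℂ → ℂ, Differentiable ℂ e ∧ e ρ ≠ 0 ∧
      ∀ z, f z = (z - ρ) ^ zeroOrder f ρ * e z := by
  obtain ⟨g, hg, hgρ, hfg⟩ :=
    (hf.analyticAt ρ).analyticOrderAt_eq_natCast.mp (analyticOrderAt_eq_zeroOrder hf ha ρ)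
  classical
  set n := zeroOrder f ρ
  let e : ℂ → ℂ := Function.update (fun z => f z / (z - ρ) ^ n) ρ (g ρ)
  have heg : e =ᶠ[nhds ρ] g := by
    filter_upwards [hfg] with z hz
    by_cases h : z = ρ
    · subst h; simp [e]
    · have : z - ρ ≠ 0 := sub_ne_zero.mpr h
      simp only [e, Function.update_of_ne h, hz, smul_eq_mul]
      field_simp
  refine ⟨e, ?_, ?_, ?_⟩
  · intro z
    by_cases h : z = ρ
    · subst h
      exact (hg.differentiableAt).congr_of_eventuallyEq heg
    · have h2 : e =ᶠ[nhds z] fun z => f z / (z - ρ) ^ n := by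
        filter_upwards [isOpen_ne.mem_nhds h] with w hw
        simp [e, Function.update_of_ne hw]
      refine DifferentiableAt.congr_of_eventuallyEq ?_ h2
      exact (hf z).div (by fun_prop) (pow_ne_zero _ (sub_ne_zero.mpr h))
  · simpa [e] using hgρ
  · intro z
    by_cases h : z = ρ
    · subst h
      have := hfg.self_of_nhds
      simpa [e] using this
    · have : z - ρ ≠ 0 := sub_ne_zero.mpr h
      simp only [e, Function.update_of_ne h]
      field_simp

theorem exists_entire_factor_finset {f : ℂ → ℂ} (hf : Differentiable ℂ f) {a : ℂ}
    (ha : f a ≠ 0) (Z : Finset ℂ) : ∃ e : ℂ → ℂ, Differentiable ℂ e ∧ (∀ ρ ∈ Z, e ρ ≠ 0) ∧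
      ∀ z, f z = (∏ ρ ∈ Z, (z - ρ) ^ zeroOrder f ρ) * e z := by
  classical
  induction Z using Finset.induction_on with
  | empty => exact ⟨f, hf, by simp, by simp⟩
  | insert ρ Z hρ ih =>
    obtain ⟨e, he, hez, hfe⟩ := ih
    have hea : e a ≠ 0 := by
      intro h
      exact ha (by rw [hfe a, h, mul_zero])
    obtain ⟨e', he', heρ, hee⟩ := exists_entire_factor he hea ρ
    have hord : zeroOrder e ρ = zeroOrder f ρ := by
      have h1 := analyticOrderAt_eq_zeroOrder hf ha ρ
      have h2 := analyticOrderAt_eq_zeroOrder he hea ρ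
      have h3 : f = (fun z => ∏ ρ ∈ Z, (z - ρ) ^ zeroOrder f ρ) * e := by
        ext z; exact hfe z
      have hd : Differentiable ℂ (fun z => ∏ ρ ∈ Z, (z - ρ) ^ zeroOrder f ρ) := by fun_prop
      have h4 := analyticOrderAt_mul (hd.analyticAt ρ) (he.analyticAt ρ)
      rw [← h3, (hd.analyticAt ρ).analyticOrderAt_eq_zero.mpr ?_, zero_add, h1, h2] at h4
      · exact_mod_cast h4.symm
      · refine Finset.prod_ne_zero_iff.mpr fun w hw => pow_ne_zero _ (sub_ne_zero.mpr ?_)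
        rintro rfl; exact hρ hw
    refine ⟨e', he', ?_, ?_⟩
    · intro w hw
      rcases Finset.mem_insert.mp hw with rfl | hw
      · exact heρ
      · intro h
        exact hez w hw (by rw [hee w, h, mul_zero])
    · intro z
      rw [Finset.prod_insert hρ, hfe z, hee z, hord]
      ring

theorem finite_zeros_inter_of_isBounded {f : ℂ → ℂ} (hf : Differentiable ℂ f) {a : ℂ}
    (ha : f a ≠ 0) {B : Set ℂ} (hB : Bornology.IsBounded B) : {z | f z = 0 ∧ z ∈ B}.Finite := by
  have hc : IsCompact (closure B) := hB.isCompact_closure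
  have h2 : AnalyticOnNhd ℂ f Set.univ := fun z _ => hf.analyticAt z
  have h3 := h2.preimage_zero_mem_codiscrete ha
  have h4 : (closure B ∩ (f ⁻¹' {0})).Finite := by
    have := hc.finite_sdiff_of_mem_codiscreteWithin (s := (f ⁻¹' {0})ᶜ) 
      (Filter.codiscreteWithin_mono (Set.subset_univ _) h3)
    simpa [Set.sdiff_eq] using this
  exact h4.subset fun z hz => ⟨subset_closure hz.2, hz.1⟩

theorem logDeriv_eq_sum_add {f e : ℂ → ℂ} (he : Differentiable ℂ e) (Z : Finset ℂ) (n : ℂ → ℕ)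
    (hfe : ∀ z, f z = (∏ ρ ∈ Z, (z - ρ) ^ n ρ) * e z) {z : ℂ} (hz : z ∉ Z) (hez : e z ≠ 0) :
    logDeriv f z = ∑ ρ ∈ Z, (n ρ : ℂ) / (z - ρ) + logDeriv e z := by
  have h1 : f = fun z => (∏ ρ ∈ Z, (z - ρ) ^ n ρ) * e z := funext hfe
  have hne : ∀ ρ ∈ Z, z - ρ ≠ 0 := fun ρ hρ => sub_ne_zero.mpr (by rintro rfl; exact hz hρ)
  rw [h1, logDeriv_mul (f := fun z => ∏ ρ ∈ Z, (z - ρ) ^ n ρ) z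
    (Finset.prod_ne_zero_iff.mpr fun ρ hρ => pow_ne_zero _ (hne ρ hρ)) hez (by fun_prop) (he z)]
  congr 1
  have h2 := logDeriv_prod (s := Z) (f := fun ρ z => (z - ρ) ^ n ρ) (x := z)
    (fun ρ hρ => pow_ne_zero _ (hne ρ hρ)) (fun ρ hρ => by fun_prop)
  refine Eq.trans ?_ (h2.trans ?_)
  · rfl
  · refine Finset.sum_congr rfl fun ρ hρ => ?_
    rw [logDeriv_fun_pow (by fun_prop)]
    simp [logDeriv_apply, div_eq_mul_inv]

/-- A nonvanishing holomorphic function of controlled growth has bounded logarithmic derivative. -/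
theorem norm_logDeriv_le_of_norm_le {e : ℂ → ℂ} (he : Differentiable ℂ e) {z₀ : ℂ} {r M : ℝ}
    (hr : 0 < r) (hM : 0 < M) (hne : ∀ z, ‖z - z₀‖ < r → e z ≠ 0)
    (hb : ∀ z, ‖z - z₀‖ < r → ‖e z‖ ≤ Real.exp M * ‖e z₀‖) {z : ℂ} (hz : ‖z - z₀‖ ≤ r / 2) :
    ‖logDeriv e z‖ ≤ 24 * M / r := by
  have hE0 : e z₀ ≠ 0 := hne z₀ (by simpa using hr)
  have hd : DifferentiableOn ℂ (fun w => logDeriv e (z₀ + w)) (Metric.ball 0 r) := by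
    intro w hw
    have hw' : ‖z₀ + w - z₀‖ < r := by simpa using hw
    have h1 : DifferentiableAt ℂ (logDeriv e) (z₀ + w) := by
      unfold logDeriv
      exact ((he.analyticAt _).deriv.differentiableAt).div (he _) (hne _ hw')
    have h2 : DifferentiableAt ℂ (fun w : ℂ => z₀ + w) w := by fun_prop
    exact (h1.comp w h2).differentiableWithinAt
  obtain ⟨q, hq0, hq⟩ := (hd.isExactOn_ball).with_val_at 0 0
  have hexp : ∀ w ∈ Metric.ball (0:ℂ) r, e (z₀ + w) = e z₀ * Complex.exp (q w) := by
    have hconst : ∀ w ∈ Metric.ball (0:ℂ) r,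
        HasDerivAt (fun w => e (z₀ + w) * Complex.exp (-q w)) 0 w := by
      intro w hw
      have hw' : ‖z₀ + w - z₀‖ < r := by simpa using hw
      have h1 : HasDerivAt (fun w => e (z₀ + w)) (deriv e (z₀ + w)) w :=
        HasDerivAt.comp_const_add z₀ w (he _).hasDerivAt
      have h2 := (hq w hw).neg.cexp
      convert! h1.mul h2 using 1
      simp only [logDeriv_apply]
      field_simp [hne _ hw']
      ring
    intro w hw
    have h3 : (fun w => e (z₀ + w) * Complex.exp (-q w)) w
        = (fun w => e (z₀ + w) * Complex.exp (-q w)) 0 := by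
      refine IsOpen.is_const_of_deriv_eq_zero (s := Metric.ball (0:ℂ) r)
        (f := fun w => e (z₀ + w) * Complex.exp (-q w)) Metric.isOpen_ball
        (convex_ball (0:ℂ) r).isPreconnected ?_ ?_ hw (Metric.mem_ball_self hr)
      · exact fun w hw => (hconst w hw).differentiableAt.differentiableWithinAt
      · exact fun w hw => (hconst w hw).deriv
    simp only [hq0, neg_zero, Complex.exp_zero, mul_one, add_zero] at h3
    rw [← h3, mul_assoc, ← Complex.exp_add]
    simp
  have hre : Set.MapsTo q (Metric.ball 0 r) {z | z.re ≤ M} := by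
    intro w hw
    have hw' : ‖z₀ + w - z₀‖ < r := by simpa using hw
    have h1 := hb _ hw'
    rw [hexp w hw, norm_mul, Complex.norm_exp, mul_comm] at h1
    have h2 := le_of_mul_le_mul_right h1 (norm_pos_iff.mpr hE0)
    exact Real.exp_le_exp.mp h2
  have hqd : DifferentiableOn ℂ q (Metric.ball 0 r) :=
    fun w hw => (hq w hw).differentiableAt.differentiableWithinAt
  have hqb : ∀ w, ‖w‖ ≤ 3 * r / 4 → ‖q w‖ ≤ 6 * M := by
    intro w hw
    have hw1 : w ∈ Metric.ball (0:ℂ) r := by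
      simp only [Metric.mem_ball, dist_zero_right]; linarith
    refine (Complex.borelCaratheodory_zero hM hqd hre hr hw1 hq0).trans ?_
    rw [div_le_iff₀ (by linarith)]
    nlinarith [norm_nonneg w]
  have hz1 : z - z₀ ∈ Metric.ball (0:ℂ) r := by
    simp only [Metric.mem_ball, dist_zero_right]; linarith
  have h5 : deriv q (z - z₀) = logDeriv e z := by
    rw [(hq _ hz1).deriv]; simp
  rw [← h5]
  have h6 : ∀ w ∈ Metric.closedBall (z - z₀) (r / 4), ‖w‖ ≤ 3 * r / 4 := by
    intro w hw
    have : ‖w - (z - z₀)‖ ≤ r / 4 := by simpa [dist_eq_norm] using hw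
    have h7 : ‖w‖ ≤ ‖w - (z - z₀)‖ + ‖z - z₀‖ := by
      simpa using norm_add_le (w - (z - z₀)) (z - z₀)
    linarith
  have h8 : DiffContOnCl ℂ q (Metric.ball (z - z₀) (r / 4)) := by
    refine DifferentiableOn.diffContOnCl_ball (U := Metric.ball 0 r) hqd ?_
    intro w hw
    have := h6 w hw
    simp only [Metric.mem_ball, dist_zero_right]; linarith
  refine (Complex.norm_deriv_le_of_forall_mem_sphere_norm_le (by linarith : 0 < r / 4) h8
    fun w hw => hqb w (h6 w (Metric.sphere_subset_closedBall hw))).trans (le_of_eq ?_)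
  field_simp
  ring

/-- Landau's lemma: local bound for the number of zeros and local partial fraction expansion. -/
theorem local_zero_count_and_logDeriv_bound {f : ℂ → ℂ} (hf : Differentiable ℂ f) {z₀ : ℂ}
    (h0 : f z₀ ≠ 0) {r M : ℝ} (hr : 0 < r) (hM : 0 < M)
    (hb : ∀ z, ‖z - z₀‖ ≤ 3 * r → ‖f z‖ ≤ Real.exp M * ‖f z₀‖) (Z : Finset ℂ)
    (hZ : ∀ z, z ∈ Z ↔ f z = 0 ∧ ‖z - z₀‖ ≤ r) :
    ((∑ ρ ∈ Z, zeroOrder f ρ : ℕ) : ℝ) * Real.log 2 ≤ M ∧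
    ∀ z, ‖z - z₀‖ ≤ r / 2 → f z ≠ 0 →
      ‖logDeriv f z - ∑ ρ ∈ Z, (zeroOrder f ρ : ℂ) / (z - ρ)‖ ≤ 24 * M / r := by
  obtain ⟨e, he, heZ, hfe⟩ := exists_entire_factor_finset hf h0 Z
  set n := zeroOrder f
  set N := ∑ ρ ∈ Z, n ρ
  have hz0Z : z₀ ∉ Z := fun h => h0 ((hZ z₀).mp h).1
  have hP : ∀ z, ‖z - z₀‖ = 3 * r →
      2 ^ N * ‖∏ ρ ∈ Z, (z₀ - ρ) ^ n ρ‖ ≤ ‖∏ ρ ∈ Z, (z - ρ) ^ n ρ‖ := by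
    intro z hz
    rw [norm_prod, norm_prod, ← Finset.prod_pow_eq_pow_sum, ← Finset.prod_mul_distrib]
    refine Finset.prod_le_prod (fun _ _ => by positivity) fun ρ hρ => ?_
    rw [norm_pow, norm_pow, ← mul_pow]
    refine pow_le_pow_left₀ (by positivity) ?_ _
    have h1 := ((hZ ρ).mp hρ).2
    have h2 : ‖z - z₀‖ ≤ ‖z - ρ‖ + ‖ρ - z₀‖ := by simpa using norm_add_le (z - ρ) (ρ - z₀)
    rw [norm_sub_rev z₀ ρ]
    linarith
  have hP0 : 0 < ‖∏ ρ ∈ Z, (z₀ - ρ) ^ n ρ‖ := by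
    rw [norm_pos_iff, Finset.prod_ne_zero_iff]
    intro ρ hρ
    exact pow_ne_zero _ (sub_ne_zero.mpr (by rintro rfl; exact hz0Z hρ))
  have hebd : ∀ z, ‖z - z₀‖ ≤ 3 * r → ‖e z‖ ≤ Real.exp M * ‖e z₀‖ / 2 ^ N := by
    intro z hz
    refine Complex.norm_le_of_forall_mem_frontier_norm_le (U := Metric.ball z₀ (3 * r))
      Metric.isBounded_ball he.diffContOnCl ?_ ?_
    · intro w hw
      rw [frontier_ball _ (by positivity)] at hw
      have hw' : ‖w - z₀‖ = 3 * r := by simpa [dist_eq_norm] using hw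
      have h1 := hb w hw'.le
      rw [hfe w, hfe z₀, norm_mul, norm_mul] at h1
      have h2 := hP w hw'
      rw [le_div_iff₀ (by positivity)]
      have h3 : 2 ^ N * ‖∏ ρ ∈ Z, (z₀ - ρ) ^ n ρ‖ * ‖e w‖ ≤
          Real.exp M * (‖∏ ρ ∈ Z, (z₀ - ρ) ^ n ρ‖ * ‖e z₀‖) :=
        (mul_le_mul_of_nonneg_right h2 (norm_nonneg _)).trans h1
      refine le_of_mul_le_mul_left ?_ hP0
      linarith
    · rw [closure_ball _ (by positivity)]
      simpa [dist_eq_norm] using hz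
  have hez0 : e z₀ ≠ 0 := fun h => h0 (by rw [hfe, h, mul_zero])
  have hez0' : 0 < ‖e z₀‖ := norm_pos_iff.mpr hez0
  constructor
  · have h1 := hebd z₀ (by simp; positivity)
    rw [le_div_iff₀ (by positivity), mul_comm] at h1
    have h2 := le_of_mul_le_mul_right h1 hez0'
    have h3 := Real.log_le_log (by positivity) h2
    rwa [Real.log_exp, Real.log_pow] at h3
  · intro z hz hfz
    have hzZ : z ∉ Z := fun h => hfz ((hZ z).mp h).1
    have hez : e z ≠ 0 := fun h => hfz (by rw [hfe, h, mul_zero])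
    rw [logDeriv_eq_sum_add he Z n hfe hzZ hez, add_sub_cancel_left]
    refine norm_logDeriv_le_of_norm_le he hr hM ?_ ?_ hz
    · intro w hw h
      have hw0 : f w = 0 := by rw [hfe, h, mul_zero]
      exact heZ w ((hZ w).mpr ⟨hw0, hw.le⟩) h
    · intro w hw
      refine (hebd w (by linarith)).trans (div_le_self (by positivity) ?_)
      exact one_le_pow₀ (by norm_num)

/-- Average over a circle of the Cauchy kernel against a simple pole, both inside the circle. -/
theorem circleAverage_cauchy_kernel_div_sub {c w ρ : ℂ} {R : ℝ} (hR : 0 < R)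
    (hw : w ∈ Metric.ball c R) (hρ : ρ ∈ Metric.ball c R) (hne : w ≠ ρ) (a : ℂ) :
    Real.circleAverage (fun z => (z - c) / (z - w) * (a / (z - ρ))) c R = 0 := by
  have hcont : ∀ v ∈ Metric.ball c R, CircleIntegrable (fun z => (z - c) / (z - v)) c R := by
    intro v hv
    refine ContinuousOn.circleIntegrable hR.le (ContinuousOn.div (by fun_prop) (by fun_prop) ?_)
    intro z hz h
    have : z = v := sub_eq_zero.mp h
    subst this
    simp only [Metric.mem_sphere, Metric.mem_ball] at hz hv
    linarith
  have havg : ∀ v ∈ Metric.ball c R,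
      Real.circleAverage (fun z => (z - c) / (z - v)) c R = 1 := by
    intro v hv
    have h := DiffContOnCl.circleAverage_smul_div (f := fun _ => (1:ℂ)) (c := c) (R := R) (w := v)
      diffContOnCl_const (by rwa [abs_of_pos hR])
    simpa using h
  have heq : Real.circleAverage (fun z => (z - c) / (z - w) * (a / (z - ρ))) c R =
      Real.circleAverage
        (fun z => (a / (w - ρ)) • ((z - c) / (z - w) - (z - c) / (z - ρ))) c R := by
    refine Real.circleAverage_congr_sphere fun z hz => ?_
    rw [abs_of_pos hR] at hz
    have h1 : z - w ≠ 0 := by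
      intro h
      rw [sub_eq_zero.mp h] at hz
      simp only [Metric.mem_sphere, Metric.mem_ball] at hz hw; linarith
    have h2 : z - ρ ≠ 0 := by
      intro h
      rw [sub_eq_zero.mp h] at hz
      simp only [Metric.mem_sphere, Metric.mem_ball] at hz hρ; linarith
    have h3 : w - ρ ≠ 0 := sub_ne_zero.mpr hne
    simp only [smul_eq_mul]
    field_simp
    ring
  rw [heq, Real.circleAverage_fun_smul, Real.circleAverage_fun_sub (hcont w hw) (hcont ρ hρ),
    havg w hw, havg ρ hρ, sub_self, smul_zero]

/-- The regular part of `f'/f` in a disc as a circle average. -/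
theorem logDeriv_sub_sum_eq_circleAverage {f : ℂ → ℂ} (hf : Differentiable ℂ f) {c : ℂ} {R : ℝ}
    (hR : 0 < R) (hs : ∀ z ∈ Metric.sphere c R, f z ≠ 0) (Z : Finset ℂ)
    (hZ : ∀ z, z ∈ Z ↔ f z = 0 ∧ ‖z - c‖ < R) {w : ℂ} (hw : w ∈ Metric.ball c R)
    (hfw : f w ≠ 0) :
    logDeriv f w - ∑ ρ ∈ Z, (zeroOrder f ρ : ℂ) / (w - ρ) =
      Real.circleAverage (fun z => (z - c) / (z - w) * logDeriv f z) c R := by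
  obtain ⟨e, he, heZ, hfe⟩ := exists_entire_factor_finset hf hfw Z
  have hene : ∀ z ∈ Metric.closedBall c R, e z ≠ 0 := by
    intro z hz h
    have hfz : f z = 0 := by rw [hfe, h, mul_zero]
    rcases (Metric.mem_closedBall.mp hz).lt_or_eq with h1 | h1
    · exact heZ z ((hZ z).mpr ⟨hfz, by simpa [dist_eq_norm] using h1⟩) h
    · exact hs z h1 hfz
  have hZne : ∀ z, f z ≠ 0 → z ∉ Z := fun z hz h => hz ((hZ z).mp h).1
  have hdiff : ∀ z ∈ Metric.closedBall c R, DifferentiableAt ℂ (logDeriv e) z := by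
    intro z hz
    unfold logDeriv
    exact ((he.analyticAt _).deriv.differentiableAt).div (he _) (hene _ hz)
  have hdc : DiffContOnCl ℂ (logDeriv e) (Metric.ball c |R|) := by
    rw [abs_of_pos hR]
    refine ⟨fun z hz =>
      (hdiff z (Metric.ball_subset_closedBall hz)).differentiableWithinAt, ?_⟩
    rw [closure_ball _ hR.ne']
    exact fun z hz => (hdiff z hz).continuousAt.continuousWithinAt
  have h1 := DiffContOnCl.circleAverage_smul_div hdc (w := w) (by rwa [abs_of_pos hR])
  rw [logDeriv_eq_sum_add he Z _ hfe (hZne w hfw)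
    (hene w (Metric.ball_subset_closedBall hw)), add_sub_cancel_left, ← h1]
  have hker : ContinuousOn (fun z => (z - c) / (z - w)) (Metric.sphere c R) := by
    refine ContinuousOn.div (by fun_prop) (by fun_prop) ?_
    intro z hz h
    rw [sub_eq_zero.mp h] at hz
    simp only [Metric.mem_sphere, Metric.mem_ball] at hz hw; linarith
  have hpole : ∀ ρ ∈ Z, ContinuousOn (fun z => (zeroOrder f ρ : ℂ) / (z - ρ))
      (Metric.sphere c R) := by
    intro ρ hρ
    refine ContinuousOn.div (by fun_prop) (by fun_prop) ?_
    intro z hz h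
    rw [sub_eq_zero.mp h] at hz
    exact hs ρ hz ((hZ ρ).mp hρ).1
  have hE : ContinuousOn (logDeriv e) (Metric.sphere c R) := fun z hz =>
    (hdiff z (Metric.sphere_subset_closedBall hz)).continuousAt.continuousWithinAt
  have h2 : Real.circleAverage (fun z => (z - c) / (z - w) * logDeriv f z) c R =
      Real.circleAverage (fun z => (∑ ρ ∈ Z, (z - c) / (z - w) * ((zeroOrder f ρ : ℂ) / (z - ρ))) +
        (z - c) / (z - w) * logDeriv e z) c R := by
    refine Real.circleAverage_congr_sphere fun z hz => ?_
    rw [abs_of_pos hR] at hz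
    rw [logDeriv_eq_sum_add he Z _ hfe (hZne z (hs z hz))
      (hene z (Metric.sphere_subset_closedBall hz)), mul_add, Finset.mul_sum]
  rw [h2, Real.circleAverage_fun_add, Real.circleAverage_fun_sum]
  · rw [Finset.sum_eq_zero, zero_add]
    · rfl
    · intro ρ hρ
      refine circleAverage_cauchy_kernel_div_sub hR hw ?_ ?_ _
      · simpa [dist_eq_norm] using ((hZ ρ).mp hρ).2
      · rintro rfl
        exact hfw ((hZ w).mp hρ).1
  · exact fun ρ hρ => (hker.mul (hpole ρ hρ)).circleIntegrable hR.le
  · refine ContinuousOn.circleIntegrable hR.le ?_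
    exact continuousOn_finsetSum _ fun ρ hρ => hker.mul (hpole ρ hρ)
  · exact (hker.mul hE).circleIntegrable hR.le

/-- Growth of `‖f‖` along a segment in terms of the logarithmic derivative. -/
theorem norm_le_exp_mul_of_re_logDeriv_le {f : ℂ → ℂ} (hf : Differentiable ℂ f) {p v : ℂ} {K : ℝ}
    (hne : ∀ t ∈ Set.Icc (0:ℝ) 1, f (p + t * v) ≠ 0)
    (hK : ∀ t ∈ Set.Icc (0:ℝ) 1, (v * logDeriv f (p + t * v)).re ≤ K) :
    ‖f (p + v)‖ ≤ Real.exp K * ‖f p‖ := by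
  have hder : ∀ t ∈ Set.Icc (0:ℝ) 1, HasDerivAt (fun t : ℝ => Real.log (‖f (p + t * v)‖ ^ 2))
      (2 * (v * logDeriv f (p + t * v)).re) t := by
    intro t ht
    have h1 : HasDerivAt (fun t : ℝ => f (p + t * v)) (deriv f (p + t * v) * v) t := by
      have h2 : HasDerivAt (fun t : ℝ => p + (t:ℂ) * v) v t := by
        have := (Complex.ofRealCLM.hasDerivAt (x := t)).mul_const v
        simpa using this.const_add p
      exact HasDerivAt.comp t (hf _).hasDerivAt h2
    have h3 := h1.norm_sq.log (by have := norm_pos_iff.mpr (hne t ht); positivity)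
    convert! h3 using 1
    have hz := hne t ht
    set z := f (p + t * v)
    set D := deriv f (p + t * v)
    have h4 : v * logDeriv f (p + t * v) = (D * v * (starRingEnd ℂ) z) / ((‖z‖ ^ 2 : ℝ) : ℂ) := by
      have h5 : logDeriv f (p + t * v) = D / z := rfl
      rw [h5, ← Complex.normSq_eq_norm_sq, ← Complex.mul_conj]
      have : (starRingEnd ℂ) z ≠ 0 := by simpa using hz
      clear_value D z
      field_simp
    rw [h4, Complex.div_ofReal_re, Complex.inner]
    ring_nf
  have h01 := Convex.image_sub_le_mul_sub_of_deriv_le (convex_Icc (0:ℝ) 1)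
    (f := fun t : ℝ => Real.log (‖f (p + t * v)‖ ^ 2)) (C := 2 * K)
    (fun t ht => (hder t ht).continuousAt.continuousWithinAt)
    (fun t ht => (hder t (interior_subset ht)).differentiableAt.differentiableWithinAt)
    (fun t ht => by
      rw [(hder t (interior_subset ht)).deriv]
      have := hK t (interior_subset ht)
      linarith) 0 (by simp) 1 (by simp) zero_le_one
  have hp0 := hne 0 (by simp)
  have hp1 := hne 1 (by simp)
  simp only [ofReal_zero, zero_mul, add_zero, ofReal_one, one_mul, Real.log_pow] at h01 hp0 hp1
  push_cast at h01
  have h2 : Real.log ‖f (p + v)‖ ≤ K + Real.log ‖f p‖ := by linarith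
  have h3 := Real.exp_le_exp.mpr h2
  rwa [Real.exp_add, Real.exp_log (norm_pos_iff.mpr hp0),
    Real.exp_log (norm_pos_iff.mpr hp1)] at h3

/-- The size `1 + log (1 + |T|)` of the local zero density. -/
def logSize (T : ℝ) : ℝ := 1 + Real.log (1 + |T|)

theorem one_le_logSize (T : ℝ) : 1 ≤ logSize T := by
  have : 0 ≤ Real.log (1 + |T|) := Real.log_nonneg (by linarith [abs_nonneg T])
  unfold logSize; linarith

theorem one_add_log_le_mul_logSize {B x : ℝ} (T : ℝ) (hB : 0 ≤ B) (hx : 0 ≤ x)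
    (h : x ≤ B + |T|) : 1 + Real.log (1 + x) ≤ (1 + Real.log (1 + B)) * logSize T := by
  have hT := abs_nonneg T
  have h1 : Real.log (1 + x) ≤ Real.log (1 + B) + Real.log (1 + |T|) := by
    rw [← Real.log_mul (by positivity) (by positivity)]
    refine Real.log_le_log (by linarith) ?_
    nlinarith
  have h2 : 0 ≤ Real.log (1 + B) := Real.log_nonneg (by linarith)
  have h3 : 0 ≤ Real.log (1 + |T|) := Real.log_nonneg (by linarith)
  unfold logSize
  nlinarith

/-- Analytic properties of a completed `L`-function that determine its Li-type coefficients: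
it is entire with a functional equation `s ↦ σ - conj s`, it has no zeros in `Re s ≥ A`, and
there its logarithmic derivative grows logarithmically, with bounded imaginary part that behaves
like `d · arg`. -/
structure IsCompletedL (f : ℂ → ℂ) (σ A d C : ℝ) : Prop where
  diff : Differentiable ℂ f
  hσ : 0 < σ
  hA : σ / 2 + 1 ≤ A
  hC : 0 < C
  fe : ∃ ω : ℂ, ‖ω‖ = 1 ∧ ∀ s, f s = ω * (starRingEnd ℂ) (f (σ - (starRingEnd ℂ) s))
  ne_zero : ∀ s : ℂ, A ≤ s.re → f s ≠ 0
  norm_le : ∀ s : ℂ, A ≤ s.re → ‖logDeriv f s‖ ≤ C * (1 + Real.log (1 + ‖s‖))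
  im_le : ∀ s : ℂ, A ≤ s.re → |(logDeriv f s).im| ≤ C
  im_tendsto : ∀ θ : ℝ, |θ| < Real.pi / 2 →
    Tendsto (fun R : ℝ => (logDeriv f (circleMap (σ / 2) R θ)).im) atTop (nhds (d * θ))
  strip : ∀ a b : ℝ, a < b → ∃ c' < Real.pi / (b - a), ∃ B : ℝ,
    f =O[comap (_root_.abs ∘ im) atTop ⊓ Filter.principal (re ⁻¹' Set.Ioo a b)]
      fun z => Real.exp (B * Real.exp (c' * |z.im|))

namespace IsCompletedL

variable {f : ℂ → ℂ} {σ A d C : ℝ}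

theorem norm_reflect (h : IsCompletedL f σ A d C) (s : ℂ) :
    ‖f (σ - (starRingEnd ℂ) s)‖ = ‖f s‖ := by
  obtain ⟨ω, hω, hfe⟩ := h.fe
  rw [hfe s, norm_mul, hω, one_mul, RCLike.norm_conj]

theorem reflect_eq_zero_iff (h : IsCompletedL f σ A d C) (s : ℂ) :
    f (σ - (starRingEnd ℂ) s) = 0 ↔ f s = 0 := by
  rw [← norm_eq_zero, h.norm_reflect, norm_eq_zero]

theorem logDeriv_reflect (h : IsCompletedL f σ A d C) (s : ℂ) :
    logDeriv f (σ - (starRingEnd ℂ) s) = - (starRingEnd ℂ) (logDeriv f s) := by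
  obtain ⟨ω, hω, hfe⟩ := h.fe
  have hω0 : ω ≠ 0 := by rintro rfl; simp at hω
  have h2 : HasDerivAt f (ω * (-(starRingEnd ℂ) (deriv f (σ - (starRingEnd ℂ) s)))) s := by
    have h3 : HasDerivAt (fun z => f (σ - z)) (-deriv f (σ - (starRingEnd ℂ) s))
        ((starRingEnd ℂ) s) := by
      have := ((h.diff (σ - (starRingEnd ℂ) s)).hasDerivAt).comp_const_sub (σ:ℂ) ((starRingEnd ℂ) s)
      exact this
    have h4 := h3.conj_conj
    simp only [conj_conj] at h4
    have h5 := h4.const_mul ω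
    rw [map_neg] at h5
    exact h5.congr_of_eventuallyEq (Eventually.of_forall fun z => by simpa using hfe z)
  rw [logDeriv_apply, logDeriv_apply, h2.deriv, hfe s]
  simp only [map_div₀, map_mul, map_neg, conj_conj]
  have : (starRingEnd ℂ) ω ≠ 0 := by simpa using hω0
  rw [mul_div_mul_left _ _ this]
  ring

theorem zero_re (h : IsCompletedL f σ A d C) {ρ : ℂ} (hρ : f ρ = 0) :
    |ρ.re - σ / 2| < A - σ / 2 := by
  have h1 : ρ.re < A := by
    by_contra hc
    exact h.ne_zero ρ (not_lt.mp hc) hρ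
  have h2 : σ - ρ.re < A := by
    by_contra hc
    refine h.ne_zero (σ - (starRingEnd ℂ) ρ) ?_ ((h.reflect_eq_zero_iff ρ).mpr hρ)
    simpa using not_lt.mp hc
  rw [abs_lt]; constructor <;> linarith

theorem vertical (h : IsCompletedL f σ A d C) {a : ℝ} (ha : A ≤ a) (t T : ℝ) :
    ‖f (a + t * I)‖ ≤ Real.exp (C * |t - T|) * ‖f (a + T * I)‖ := by
  have h1 := norm_le_exp_mul_of_re_logDeriv_le h.diff (p := a + T * I) (v := (t - T : ℝ) * I)
    (K := C * |t - T|) ?_ ?_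
  · convert! h1 using 3
    push_cast; ring
  · intro u _
    exact h.ne_zero _ (by simpa using ha)
  · intro u _
    set H := logDeriv f (a + T * I + u * ((t - T : ℝ) * I))
    have h2 : |H.im| ≤ C := h.im_le _ (by simpa using ha)
    have h3 : (((t - T : ℝ) * I) * H).re = -((t - T) * H.im) := by
      simp
    rw [h3]
    calc -((t - T) * H.im) ≤ |(t - T) * H.im| := neg_le_abs _
      _ = |H.im| * |t - T| := by rw [abs_mul, mul_comm]
      _ ≤ _ := by gcongr

theorem A_pos (h : IsCompletedL f σ A d C) : 0 < A := by have := h.hA; have := h.hσ; linarith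

theorem horizontal (h : IsCompletedL f σ A d C) {b : ℝ} (hb : A ≤ b) (T : ℝ) :
    ‖f (b + T * I)‖ ≤
      Real.exp ((b - A) * (C * ((1 + Real.log (1 + b)) * logSize T))) * ‖f (A + T * I)‖ := by
  have hA := h.A_pos
  have hC := h.hC
  have h1 := norm_le_exp_mul_of_re_logDeriv_le h.diff (p := A + T * I) (v := (b - A : ℝ))
    (K := (b - A) * (C * ((1 + Real.log (1 + b)) * logSize T))) ?_ ?_
  · convert! h1 using 3
    push_cast; ring
  · intro u hu
    refine h.ne_zero _ ?_
    simp
    nlinarith [hu.1]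
  · intro u hu
    have hre : (A + T * I + u * ((b - A : ℝ) : ℂ)).re = A + u * (b - A) := by simp
    have him : (A + T * I + u * ((b - A : ℝ) : ℂ)).im = T := by simp
    set s := A + T * I + u * ((b - A : ℝ) : ℂ) with hs
    have hge : A ≤ s.re := by rw [hre]; nlinarith [hu.1]
    have hle : s.re ≤ b := by rw [hre]; nlinarith [hu.2]
    have h2 := h.norm_le s hge
    have h3 : ‖s‖ ≤ b + |T| := by
      refine (Complex.norm_le_abs_re_add_abs_im s).trans ?_
      rw [him, abs_of_nonneg (by linarith)]; linarith
    have h4 := one_add_log_le_mul_logSize T (by linarith : 0 ≤ b) (norm_nonneg s) h3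
    rw [Complex.re_ofReal_mul]
    refine mul_le_mul_of_nonneg_left ?_ (by linarith)
    exact ((Complex.re_le_norm _).trans h2).trans (by gcongr)

/-- Exponential-logarithmic growth of `f` near `A + iT` relative to its value there. -/
theorem growth (h : IsCompletedL f σ A d C) {R : ℝ} (hR : 0 < R) :
    ∃ K > 0, ∀ (T : ℝ) (z : ℂ), ‖z - (A + T * I)‖ ≤ R →
      ‖f z‖ ≤ Real.exp (K * logSize T) * ‖f (A + T * I)‖ := by
  have hA := h.A_pos
  have hA' := h.hA
  have hσ := h.hσ
  have hC := h.hC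
  set b := A + R with hb
  set D := (b - σ + A) ^ 2 with hD
  set L := R * (C * (1 + Real.log (1 + b))) with hL
  have hlog : 0 ≤ Real.log (1 + b) := Real.log_nonneg (by linarith)
  have hL0 : 0 < L := by positivity
  refine ⟨D + C ^ 2 + R ^ 2 + L, by positivity, ?_⟩
  intro T z hz
  set z0 : ℂ := A + T * I with hz0
  have hz0re : z0.re = A := by simp [hz0]
  have hz0im : z0.im = T := by simp [hz0]
  have hsq : ∀ w : ℂ, ((w - z0) ^ 2).re = (w.re - A) ^ 2 - (w.im - T) ^ 2 := by
    intro w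
    rw [sq, Complex.mul_re, Complex.sub_re, Complex.sub_im, hz0re, hz0im]; ring
  set Bd := Real.exp (D + C ^ 2 + L * logSize T) * ‖f z0‖ with hBd
  have hvert : ∀ t : ℝ, ‖f (b + t * I)‖ ≤ Real.exp (C * |t - T| + L * logSize T) * ‖f z0‖ := by
    intro t
    have h1 := h.vertical (a := b) (by linarith) t T
    have h2 := h.horizontal (b := b) (by linarith) T
    rw [Real.exp_add, mul_assoc]
    refine h1.trans (mul_le_mul_of_nonneg_left ?_ (Real.exp_pos _).le)
    convert! h2 using 3
    rw [hL, hb]; ring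
  have hedge : ∀ (w : ℂ) (t : ℝ), ‖f w‖ = ‖f (b + t * I)‖ → (w.re - A) ^ 2 ≤ D → w.im = t →
      ‖f w * Complex.exp ((w - z0) ^ 2)‖ ≤ Bd := by
    intro w t h1 h2 h3
    rw [norm_mul, Complex.norm_exp, hsq, h1, h3]
    calc _ ≤ Real.exp (C * |t - T| + L * logSize T) * ‖f z0‖ *
          Real.exp ((w.re - A) ^ 2 - (t - T) ^ 2) := by gcongr; exact hvert t
      _ = Real.exp (C * |t - T| + L * logSize T + ((w.re - A) ^ 2 - (t - T) ^ 2)) * ‖f z0‖ := by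
          rw [Real.exp_add _ ((w.re - A) ^ 2 - (t - T) ^ 2)]; ring
      _ ≤ Bd := by
          refine mul_le_mul_of_nonneg_right (Real.exp_le_exp.mpr ?_) (norm_nonneg _)
          have := sq_abs (t - T)
          nlinarith [sq_nonneg (|t - T| - C), sq_nonneg C, sq_nonneg (|t - T|)]
  have hzre := Complex.abs_re_le_norm (z - z0)
  have hzim := Complex.abs_im_le_norm (z - z0)
  rw [Complex.sub_re, hz0re] at hzre
  rw [Complex.sub_im, hz0im] at hzim
  have hzre' := abs_le.mp (hzre.trans hz)
  have hmain : ‖f z * Complex.exp ((z - z0) ^ 2)‖ ≤ Bd := by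
    refine PhragmenLindelof.vertical_strip (a := σ - b) (b := b)
      (f := fun w => f w * Complex.exp ((w - z0) ^ 2)) (C := Bd) ?_ ?_ ?_ ?_ (z := z) ?_ ?_
    · exact (h.diff.mul (by fun_prop)).diffContOnCl
    · obtain ⟨c', hc', B, hB⟩ := h.strip (σ - b) b (by linarith)
      refine ⟨c', hc', B, ?_⟩
      have h1 : (fun w => Complex.exp ((w - z0) ^ 2))
          =O[comap (_root_.abs ∘ im) atTop ⊓ Filter.principal (re ⁻¹' Set.Ioo (σ - b) b)]
          fun _ => (1:ℝ) := by
        refine Asymptotics.IsBigO.of_bound (Real.exp D) ?_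
        refine Filter.mem_inf_of_right ?_
        intro w hw
        obtain ⟨hw1, hw2⟩ := hw
        simp only [Set.mem_ofPred_eq, Complex.norm_exp, hsq, norm_one, mul_one]
        refine Real.exp_le_exp.mpr ?_
        have : (w.re - A) ^ 2 ≤ D := by
          rw [hD]
          refine sq_le_sq' ?_ ?_ <;> linarith
        nlinarith [sq_nonneg (w.im - T)]
      have h2 := hB.mul h1
      simpa using h2
    · intro w hw
      refine hedge w w.im ?_ ?_ rfl
      · rw [← h.norm_reflect w]
        congr 2
        apply Complex.ext <;> simp [hw]
      · rw [hw, hD]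
        exact le_of_eq (by ring)
    · intro w hw
      refine hedge w w.im ?_ ?_ rfl
      · congr 2
        apply Complex.ext <;> simp [hw]
      · rw [hw, hD]
        refine sq_le_sq' ?_ ?_ <;> linarith
    · linarith
    · linarith
  rw [norm_mul, Complex.norm_exp, hsq] at hmain
  have hE : Real.exp (-R ^ 2) ≤ Real.exp ((z.re - A) ^ 2 - (z.im - T) ^ 2) := by
    refine Real.exp_le_exp.mpr ?_
    have := sq_le_sq' (abs_le.mp (hzim.trans hz)).1 (abs_le.mp (hzim.trans hz)).2
    nlinarith [sq_nonneg (z.re - A)]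
  have h3 : ‖f z‖ * Real.exp (-R ^ 2) ≤ Bd :=
    (mul_le_mul_of_nonneg_left hE (norm_nonneg _)).trans hmain
  have h4 : ‖f z‖ ≤ Bd * Real.exp (R ^ 2) := by
    have := mul_le_mul_of_nonneg_right h3 (Real.exp_pos (R ^ 2)).le
    rwa [mul_assoc, ← Real.exp_add, neg_add_cancel, Real.exp_zero, mul_one] at this
  refine h4.trans ?_
  rw [hBd, mul_right_comm, ← Real.exp_add]
  refine mul_le_mul_of_nonneg_right (Real.exp_le_exp.mpr ?_) (norm_nonneg _)
  have hl := one_le_logSize T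
  nlinarith [sq_nonneg C, sq_nonneg R, sq_nonneg (b - σ + A)]

/-- Zeros near `A + iT`: their number, and the local formula for `f'/f`. -/
theorem exists_local (h : IsCompletedL f σ A d C) {r : ℝ} (hr : 0 < r) :
    ∃ K > 0, ∀ T : ℝ, ∃ Z : Finset ℂ, (∀ z, z ∈ Z ↔ f z = 0 ∧ ‖z - (A + T * I)‖ ≤ r) ∧
      ((∑ ρ ∈ Z, zeroOrder f ρ : ℕ) : ℝ) ≤ K * logSize T ∧
      ∀ z, ‖z - (A + T * I)‖ ≤ r / 2 → f z ≠ 0 →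
        ‖logDeriv f z - ∑ ρ ∈ Z, (zeroOrder f ρ : ℂ) / (z - ρ)‖ ≤ K * logSize T := by
  obtain ⟨K, hK, hgr⟩ := h.growth (R := 3 * r) (by linarith)
  have hl2 := Real.log_pos one_lt_two
  refine ⟨K / Real.log 2 + 24 * K / r, by positivity, fun T => ?_⟩
  have h0 : f (A + T * I) ≠ 0 := h.ne_zero _ (by simp)
  have hfin := finite_zeros_inter_of_isBounded h.diff h0
    (Metric.isBounded_closedBall (x := (A + T * I : ℂ)) (r := r))
  have hl := one_le_logSize T
  have hZ : ∀ z, z ∈ hfin.toFinset ↔ f z = 0 ∧ ‖z - (A + T * I)‖ ≤ r := by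
    intro z
    simp [dist_eq_norm]
  obtain ⟨h1, h2⟩ := local_zero_count_and_logDeriv_bound h.diff h0 hr
    (M := K * logSize T) (by positivity) (hgr T) hfin.toFinset hZ
  refine ⟨hfin.toFinset, hZ, ?_, ?_⟩
  · rw [← le_div_iff₀ hl2] at h1
    refine h1.trans ?_
    have : 0 ≤ 24 * K / r * logSize T := by positivity
    rw [add_mul, mul_div_right_comm]; linarith
  · intro z hz hfz
    refine (h2 z hz hfz).trans ?_
    have : 0 ≤ K / Real.log 2 * logSize T := by positivity
    have h3 : 24 * (K * logSize T) / r = 24 * K / r * logSize T := by ring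
    rw [add_mul, h3]; linarith

end IsCompletedL

/-- A unit interval contains a point well separated from a given finite set. -/
theorem exists_mem_Icc_separated (P : Finset ℝ) (a : ℝ) :
    ∃ R ∈ Set.Icc a (a + 1), ∀ x ∈ P, 1 / (2 * ((P.card : ℝ) + 1)) ≤ |R - x| := by
  by_contra! hcon
  set N : ℝ := (P.card : ℝ) + 1 with hN
  have hNpos : 0 < N := by positivity
  let p : ℕ → ℝ := fun i => a + (2 * i + 1) / (2 * N)
  have hp : ∀ i ∈ Finset.range (P.card + 1), ∃ x ∈ P, |p i - x| < 1 / (2 * N) := by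
    intro i hi
    refine hcon (p i) ⟨?_, ?_⟩
    · have : 0 ≤ (2 * (i:ℝ) + 1) / (2 * N) := by positivity
      simp only [p]; linarith
    · have hi' : (i : ℝ) + 1 ≤ N := by
        have := Finset.mem_range.mp hi
        rw [hN]; exact_mod_cast this
      have : (2 * (i:ℝ) + 1) / (2 * N) ≤ 1 := by
        rw [div_le_one (by positivity)]; linarith
      simp only [p]; linarith
  choose! x hxP hx using hp
  obtain ⟨i, hi, j, hj, hij, hxij⟩ := Finset.exists_ne_map_eq_of_card_lt_of_maps_to
    (s := Finset.range (P.card + 1)) (t := P) (by simp) (f := x) (fun i hi => hxP i hi)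
  have h1 := hx i hi
  have h2 := hx j hj
  rw [← hxij] at h2
  have h3 : |p i - p j| < 1 / N := by
    calc |p i - p j| = |(p i - x i) - (p j - x i)| := by ring_nf
      _ ≤ |p i - x i| + |p j - x i| := abs_sub _ _
      _ < 1 / (2 * N) + 1 / (2 * N) := by linarith
      _ = 1 / N := by field_simp; norm_num
  have h4 : p i - p j = ((i : ℝ) - j) / N := by
    simp only [p]; field_simp; ring
  rw [h4, abs_div, abs_of_pos hNpos, div_lt_div_iff_of_pos_right hNpos] at h3
  have h5 : |(i : ℤ) - j| < 1 := by exact_mod_cast h3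
  exact hij (by rw [Int.abs_lt_one_iff] at h5; omega)

namespace IsCompletedL

variable {f : ℂ → ℂ} {σ A d C : ℝ}

/-- Zeros at height `±T`, their number, and the local formula for `f'/f` there. -/
theorem exists_zeros_at_height (h : IsCompletedL f σ A d C) :
    ∃ K > 0, ∀ T : ℝ, ∃ Z : Finset ℂ, (∀ ρ ∈ Z, f ρ = 0) ∧
      (∀ ρ, f ρ = 0 → T ≤ |ρ.im| → |ρ.im| ≤ T + (A - σ / 2) + 1 → ρ ∈ Z) ∧
      ((∑ ρ ∈ Z, zeroOrder f ρ : ℕ) : ℝ) ≤ K * logSize T ∧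
      ∀ z : ℂ, |z.re - σ / 2| ≤ A - σ / 2 → T ≤ |z.im| → |z.im| ≤ T + (A - σ / 2) + 1 →
        f z ≠ 0 → ∃ Z' ⊆ Z,
          ‖logDeriv f z - ∑ ρ ∈ Z', (zeroOrder f ρ : ℂ) / (z - ρ)‖ ≤ K * logSize T := by
  classical
  set W := A - σ / 2 with hW
  have hW1 : 1 ≤ W := by have := h.hA; linarith
  obtain ⟨K, hK, hloc⟩ := h.exists_local (r := 6 * W + 4) (by linarith)
  refine ⟨2 * K, by positivity, fun T => ?_⟩
  obtain ⟨Z1, hZ1, hc1, hl1⟩ := hloc T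
  obtain ⟨Z2, hZ2, hc2, hl2⟩ := hloc (-T)
  have hls : logSize (-T) = logSize T := by simp [logSize]
  rw [hls] at hc2 hl2
  have hKl : 0 ≤ K * logSize T := mul_nonneg hK.le (zero_le_one.trans (one_le_logSize T))
  have hdist : ∀ (z : ℂ) (S : ℝ), |z.re - σ / 2| ≤ W → |z.im - S| ≤ W + 1 →
      ‖z - (A + S * I)‖ ≤ 3 * W + 1 := by
    intro z S h1 h2
    refine (Complex.norm_le_abs_re_add_abs_im _).trans ?_
    have h3 : |z.re - A| ≤ 2 * W := by
      rw [abs_le] at h1 ⊢; constructor <;> linarith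
    simp only [sub_re, add_re, ofReal_re, mul_re, I_re, mul_zero, ofReal_im, I_im, mul_one,
      sub_self, add_zero, sub_im, add_im, mul_im, zero_add]
    linarith
  have hcase : ∀ z : ℂ, T ≤ |z.im| → |z.im| ≤ T + W + 1 →
      |z.im - T| ≤ W + 1 ∨ |z.im - (-T)| ≤ W + 1 := by
    intro z h1 h2
    rcases le_total 0 z.im with h3 | h3
    · left
      rw [abs_of_nonneg h3] at h1 h2
      rw [abs_le]; constructor <;> linarith
    · right
      rw [abs_of_nonpos h3] at h1 h2
      rw [abs_le]; constructor <;> linarith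
  refine ⟨Z1 ∪ Z2, ?_, ?_, ?_, ?_⟩
  · intro ρ hρ
    rcases Finset.mem_union.mp hρ with hρ | hρ
    · exact ((hZ1 ρ).mp hρ).1
    · exact ((hZ2 ρ).mp hρ).1
  · intro ρ hρ h1 h2
    have hre := (h.zero_re hρ).le
    rcases hcase ρ h1 h2 with h3 | h3
    · exact Finset.mem_union_left _ ((hZ1 ρ).mpr ⟨hρ, (hdist ρ T hre h3).trans (by linarith)⟩)
    · exact Finset.mem_union_right _ ((hZ2 ρ).mpr ⟨hρ, (hdist ρ (-T) hre h3).trans (by linarith)⟩)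
  · have h1 : ∑ ρ ∈ Z1 ∪ Z2, zeroOrder f ρ ≤ ∑ ρ ∈ Z1, zeroOrder f ρ + ∑ ρ ∈ Z2, zeroOrder f ρ := by
      rw [← Finset.sum_union_inter]; exact Nat.le_add_right _ _
    have h2 : ((∑ ρ ∈ Z1 ∪ Z2, zeroOrder f ρ : ℕ) : ℝ) ≤
        ((∑ ρ ∈ Z1, zeroOrder f ρ : ℕ) : ℝ) + ((∑ ρ ∈ Z2, zeroOrder f ρ : ℕ) : ℝ) := by
      exact_mod_cast h1
    linarith
  · intro z hre h1 h2 hz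
    rcases hcase z h1 h2 with h3 | h3
    · exact ⟨Z1, Finset.subset_union_left,
        (hl1 z ((hdist z T hre h3).trans (by linarith)) hz).trans (by linarith)⟩
    · exact ⟨Z2, Finset.subset_union_right,
        (hl2 z ((hdist z (-T) hre h3).trans (by linarith)) hz).trans (by linarith)⟩

theorem norm_logDeriv_le_of_dist (h : IsCompletedL f σ A d C) {s : ℂ}
    (hs : A - σ / 2 ≤ |s.re - σ / 2|) :
    f s ≠ 0 ∧ ‖logDeriv f s‖ ≤ C * (1 + Real.log (1 + (σ + ‖s‖))) := by
  have hσ := h.hσ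
  have hC := h.hC
  rcases le_abs.mp hs with h1 | h1
  · refine ⟨h.ne_zero s (by linarith), (h.norm_le s (by linarith)).trans ?_⟩
    have := norm_nonneg s
    gcongr
    linarith
  · have h2 : A ≤ ((σ : ℂ) - (starRingEnd ℂ) s).re := by simp; linarith
    refine ⟨fun hz => h.ne_zero _ h2 ((h.reflect_eq_zero_iff s).mpr hz), ?_⟩
    have h3 := h.logDeriv_reflect s
    have h4 : ‖logDeriv f s‖ = ‖logDeriv f (σ - (starRingEnd ℂ) s)‖ := by
      rw [h3, norm_neg, RCLike.norm_conj]
    rw [h4]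
    refine (h.norm_le _ h2).trans ?_
    have : ‖(σ : ℂ) - (starRingEnd ℂ) s‖ ≤ σ + ‖s‖ := by
      refine (norm_sub_le _ _).trans ?_
      rw [RCLike.norm_conj, Complex.norm_real, Real.norm_of_nonneg hσ.le]
    gcongr

set_option maxHeartbeats 800000 in
/-- Circles around `σ/2` avoiding the zeros, on which `f'/f` is small. -/
theorem exists_good_radius (h : IsCompletedL f σ A d C) :
    ∃ K > 0, ∀ T ≥ (1:ℝ), ∃ R ∈ Set.Icc (T + (A - σ / 2)) (T + (A - σ / 2) + 1),
      ∀ z : ℂ, ‖z - σ / 2‖ = R → f z ≠ 0 ∧ ‖logDeriv f z‖ ≤ K * logSize T ^ 2 := by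
  classical
  set W := A - σ / 2 with hW
  have hW1 : 1 ≤ W := by have := h.hA; linarith
  have hσ := h.hσ
  have hC := h.hC
  obtain ⟨K, hK, hH⟩ := h.exists_zeros_at_height
  set B := 2 * σ + W + 1 with hB
  set L := 1 + Real.log (1 + B) with hL
  have hL1 : 1 ≤ L := by
    have : 0 ≤ Real.log (1 + B) := Real.log_nonneg (by linarith)
    linarith
  refine ⟨C * L + K + 2 * K * (K + 1), by positivity, fun T hT => ?_⟩
  obtain ⟨Z, hZ0, hZ, hcount, hloc⟩ := hH T
  have hl := one_le_logSize T
  obtain ⟨R, hR, hsep⟩ := exists_mem_Icc_separated (Z.image fun ρ : ℂ => ‖ρ - σ / 2‖) (T + W)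
  refine ⟨R, hR, fun z hz => ?_⟩
  have hR0 : 0 < R := by linarith [hR.1]
  have hzn : ‖z‖ ≤ R + σ := by
    calc ‖z‖ = ‖(z - σ / 2) + σ / 2‖ := by ring_nf
      _ ≤ ‖z - σ / 2‖ + ‖(σ / 2 : ℂ)‖ := norm_add_le _ _
      _ ≤ R + σ := by
        rw [hz, norm_div, Complex.norm_real, Real.norm_of_nonneg hσ.le]
        simp; linarith
  rcases le_or_gt W |z.re - σ / 2| with h1 | h1
  · obtain ⟨h2, h3⟩ := h.norm_logDeriv_le_of_dist h1
    refine ⟨h2, h3.trans ?_⟩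
    have h4 := one_add_log_le_mul_logSize (B := B) (x := σ + ‖z‖) T (by linarith)
      (by positivity) (by rw [abs_of_nonneg (by linarith : (0:ℝ) ≤ T)]; linarith [hR.2])
    calc C * (1 + Real.log (1 + (σ + ‖z‖))) ≤ C * (L * logSize T) := by gcongr
      _ = C * L * logSize T := by ring
      _ ≤ (C * L + K + 2 * K * (K + 1)) * logSize T ^ 2 := by
        have h5 : logSize T ≤ logSize T ^ 2 := by nlinarith
        have h6 : 0 ≤ K + 2 * K * (K + 1) := by positivity
        have h7 : 0 ≤ C * L := by positivity
        nlinarith [sq_nonneg (logSize T)]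
  · have him1 : |z.im| ≤ R := by
      have := Complex.abs_im_le_norm (z - σ / 2)
      rw [hz] at this
      convert! this using 2
      simp
    have him2 : R - W ≤ |z.im| := by
      have := Complex.norm_le_abs_re_add_abs_im (z - σ / 2)
      rw [hz] at this
      have e1 : (z - σ / 2 : ℂ).re = z.re - σ / 2 := by simp
      have e2 : (z - σ / 2 : ℂ).im = z.im := by simp
      rw [e1, e2] at this
      linarith
    have hT1 : T ≤ |z.im| := by linarith [hR.1]
    have hT2 : |z.im| ≤ T + W + 1 := by linarith [hR.2]
    set η := 1 / (2 * (((Z.image fun ρ : ℂ => ‖ρ - σ / 2‖).card : ℝ) + 1)) with hη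
    have hη0 : 0 < η := by positivity
    have hdist : ∀ ρ ∈ Z, η ≤ ‖z - ρ‖ := by
      intro ρ hρ
      refine (hsep _ (Finset.mem_image_of_mem _ hρ)).trans ?_
      rw [← hz]
      refine (abs_norm_sub_norm_le _ _).trans ?_
      simp
    have hfz : f z ≠ 0 := by
      intro hzero
      have := hdist z (hZ z hzero hT1 hT2)
      simp at this
      linarith
    refine ⟨hfz, ?_⟩
    obtain ⟨Z', hZ', hle⟩ := hloc z h1.le hT1 hT2 hfz
    have hcard : ((Z.image fun ρ : ℂ => ‖ρ - σ / 2‖).card : ℝ) ≤ K * logSize T := by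
      refine le_trans ?_ hcount
      have e1 : (Z.image fun ρ : ℂ => ‖ρ - σ / 2‖).card ≤ Z.card := Finset.card_image_le
      have e2 : Z.card ≤ ∑ ρ ∈ Z, zeroOrder f ρ := by
        rw [Finset.card_eq_sum_ones]
        exact Finset.sum_le_sum fun ρ hρ =>
          zeroOrder_pos h.diff (h.ne_zero A (by simp)) (hZ0 ρ hρ)
      exact_mod_cast e1.trans e2
    have hsum : ‖∑ ρ ∈ Z', (zeroOrder f ρ : ℂ) / (z - ρ)‖ ≤ K * logSize T * (1 / η) := by
      calc ‖∑ ρ ∈ Z', (zeroOrder f ρ : ℂ) / (z - ρ)‖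
          ≤ ∑ ρ ∈ Z', ‖(zeroOrder f ρ : ℂ) / (z - ρ)‖ := norm_sum_le _ _
        _ ≤ ∑ ρ ∈ Z', (zeroOrder f ρ : ℝ) * (1 / η) := by
            refine Finset.sum_le_sum fun ρ hρ => ?_
            rw [norm_div, Complex.norm_natCast, div_eq_mul_one_div]
            gcongr
            exact hdist ρ (hZ' hρ)
        _ = (∑ ρ ∈ Z', (zeroOrder f ρ : ℝ)) * (1 / η) := by rw [Finset.sum_mul]
        _ ≤ K * logSize T * (1 / η) := by
            gcongr
            refine le_trans ?_ hcount
            push_cast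
            exact Finset.sum_le_sum_of_subset_of_nonneg hZ' fun _ _ _ => by positivity
    have hη' : 1 / η ≤ 2 * (K + 1) * logSize T := by
      rw [hη, one_div_one_div]
      nlinarith
    calc ‖logDeriv f z‖ ≤ ‖logDeriv f z - ∑ ρ ∈ Z', (zeroOrder f ρ : ℂ) / (z - ρ)‖ +
          ‖∑ ρ ∈ Z', (zeroOrder f ρ : ℂ) / (z - ρ)‖ := by
            simpa using norm_add_le (logDeriv f z - ∑ ρ ∈ Z', (zeroOrder f ρ : ℂ) / (z - ρ))
              (∑ ρ ∈ Z', (zeroOrder f ρ : ℂ) / (z - ρ))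
      _ ≤ K * logSize T + K * logSize T * (2 * (K + 1) * logSize T) := by
          refine add_le_add hle (hsum.trans ?_)
          gcongr
      _ ≤ (C * L + K + 2 * K * (K + 1)) * logSize T ^ 2 := by
        have h5 : logSize T ≤ logSize T ^ 2 := by nlinarith
        have h7 : 0 ≤ C * L := by positivity
        nlinarith [sq_nonneg (logSize T), mul_nonneg h7 (sq_nonneg (logSize T)),
          mul_le_mul_of_nonneg_left h5 hK.le]

end IsCompletedL

namespace IsCompletedL

variable {f : ℂ → ℂ} {σ A d C : ℝ}

theorem continuousOn_logDeriv_sphere (h : IsCompletedL f σ A d C) {c : ℂ} {R : ℝ}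
    (hne : ∀ z : ℂ, ‖z - c‖ = R → f z ≠ 0) :
    ContinuousOn (logDeriv f) (Metric.sphere c R) := by
  intro z hz
  have hz' : f z ≠ 0 := hne z (by simpa [dist_eq_norm] using hz)
  unfold logDeriv
  have h1 : DifferentiableAt ℂ (deriv f) z := (h.diff.analyticAt z).deriv.differentiableAt
  exact (h1.continuousAt.div (h.diff z).continuousAt hz').continuousWithinAt

theorem continuous_logDeriv_circleMap (h : IsCompletedL f σ A d C) {c : ℂ} {R : ℝ} (hR : 0 ≤ R)
    (hne : ∀ z : ℂ, ‖z - c‖ = R → f z ≠ 0) :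
    Continuous fun θ : ℝ => logDeriv f (circleMap c R θ) :=
  (h.continuousOn_logDeriv_sphere hne).comp_continuous (continuous_circleMap c R)
    fun θ => circleMap_mem_sphere c hR θ

theorem circleAverage_logDeriv (h : IsCompletedL f σ A d C) {R : ℝ} (hR : 0 ≤ R)
    (hne : ∀ z : ℂ, ‖z - σ / 2‖ = R → f z ≠ 0) :
    Real.circleAverage (logDeriv f) (σ / 2) R =
      (2 * Real.pi)⁻¹ • ∫ θ in (-(Real.pi / 2))..(Real.pi / 2),
        (2 * I) * ((logDeriv f (circleMap (σ / 2) R θ)).im : ℂ) := by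
  have hcont := h.continuous_logDeriv_circleMap hR hne
  set G : ℝ → ℂ := fun θ => logDeriv f (circleMap (σ / 2) R θ) with hG
  have hper : Function.Periodic G (2 * Real.pi) := (periodic_circleMap _ _).comp _
  have h1 := hper.intervalIntegral_add_eq 0 (-(Real.pi / 2))
  have hrefl : ∀ θ, G (Real.pi - θ) = - (starRingEnd ℂ) (G θ) := by
    intro θ
    simp only [hG]
    rw [← h.logDeriv_reflect]
    congr 1
    simp only [circleMap, map_add, map_mul, map_div₀, conj_ofReal, ← Complex.exp_conj, conj_I]
    push_cast
    rw [sub_mul, Complex.exp_sub, Complex.exp_pi_mul_I, mul_neg, Complex.exp_neg]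
    have h2 : (starRingEnd ℂ) 2 = 2 := Complex.conj_ofNat 2
    rw [h2]
    field_simp
    ring
  have h2 : ∫ θ in (Real.pi / 2)..(-(Real.pi / 2) + 2 * Real.pi), G θ =
      ∫ θ in (-(Real.pi / 2))..(Real.pi / 2), G (Real.pi - θ) := by
    rw [intervalIntegral.integral_comp_sub_left (fun θ => G θ) Real.pi]
    congr 1 <;> ring
  rw [Real.circleAverage]
  congr 1
  rw [zero_add] at h1
  change ∫ θ in 0..2 * Real.pi, G θ = _
  rw [h1, ← intervalIntegral.integral_add_adjacent_intervals (b := Real.pi / 2)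
    (hcont.intervalIntegrable _ _) (hcont.intervalIntegrable _ _), h2,
    ← intervalIntegral.integral_add (hcont.intervalIntegrable _ _)
      ((by fun_prop : Continuous fun θ => G (Real.pi - θ)).intervalIntegrable _ _)]
  refine intervalIntegral.integral_congr fun θ _ => ?_
  simp only [hrefl]
  rw [← sub_eq_add_neg, Complex.sub_conj]
  push_cast; ring

/-- The average of `f'/f` over suitable circles tends to zero. -/
theorem tendsto_circleAverage_logDeriv (h : IsCompletedL f σ A d C) {Rf : ℝ → ℝ} {K : ℝ}
    (hR : ∀ T ≥ (1:ℝ), Rf T ∈ Set.Icc (T + (A - σ / 2)) (T + (A - σ / 2) + 1))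
    (hgood : ∀ T ≥ (1:ℝ), ∀ z : ℂ, ‖z - σ / 2‖ = Rf T →
      f z ≠ 0 ∧ ‖logDeriv f z‖ ≤ K * logSize T ^ 2)
    (hlim : Tendsto (fun T => K * logSize T ^ 2 / T) atTop (nhds 0)) :
    Tendsto (fun T => Real.circleAverage (logDeriv f) (σ / 2) (Rf T)) atTop (nhds 0) := by
  set W := A - σ / 2 with hW
  have hW1 : 1 ≤ W := by have := h.hA; linarith
  have hpi := Real.pi_pos
  set g : ℝ → ℝ → ℝ := fun T θ => (logDeriv f (circleMap (σ / 2) (Rf T) θ)).im with hg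
  have hRpos : ∀ T ≥ (1:ℝ), 0 < Rf T := fun T hT => by linarith [(hR T hT).1]
  have hgc : ∀ T ≥ (1:ℝ), Continuous (g T) := fun T hT => Complex.continuous_im.comp
    (h.continuous_logDeriv_circleMap (hRpos T hT).le fun z hz => (hgood T hT z hz).1)
  have hRtop : Tendsto Rf atTop atTop := by
    refine tendsto_atTop_mono' atTop ?_ tendsto_id
    filter_upwards [eventually_ge_atTop 1] with T hT
    simp only [id]; linarith [(hR T hT).1]
  set δ : ℝ → ℝ := fun T => Real.pi * W / (2 * Rf T) with hδ
  have hδ0 : ∀ T ≥ (1:ℝ), 0 < δ T := fun T hT => by have := hRpos T hT; positivity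
  have hδ1 : ∀ T ≥ (1:ℝ), δ T ≤ Real.pi / 2 := fun T hT => by
    have := hRpos T hT
    simp only [hδ]
    rw [div_le_div_iff₀ (by positivity) (by norm_num)]
    have := (hR T hT).1
    nlinarith
  have hδlim : Tendsto δ atTop (nhds 0) := by
    simp only [hδ]
    exact Tendsto.const_div_atTop (hRtop.const_mul_atTop (by norm_num)) _
  have hre : ∀ T ≥ (1:ℝ), ∀ θ, |θ| ≤ Real.pi / 2 - δ T → |g T θ| ≤ C := by
    intro T hT θ hθ
    refine h.im_le _ ?_
    have hR0 := hRpos T hT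
    have h1 : Real.cos θ = Real.sin (Real.pi / 2 - |θ|) := by
      rw [Real.sin_pi_div_two_sub, Real.cos_abs]
    have h2 := Real.mul_le_sin (x := Real.pi / 2 - |θ|)
      (by linarith [hδ0 T hT]) (by linarith [abs_nonneg θ])
    have h3 : 2 / Real.pi * δ T = W / Rf T := by
      simp only [hδ]; field_simp
    have h4 : W / Rf T ≤ Real.cos θ := by
      rw [h1, ← h3]
      refine le_trans ?_ h2
      gcongr
      linarith
    rw [div_le_iff₀ hR0] at h4
    have h5 : (circleMap (σ / 2) (Rf T) θ).re = σ / 2 + Real.cos θ * Rf T := by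
      simp [circleMap, Complex.exp_re, mul_comm]
    rw [h5]; linarith
  have habs : ∀ T ≥ (1:ℝ), ∀ θ, |g T θ| ≤ K * logSize T ^ 2 := by
    intro T hT θ
    refine (Complex.abs_im_le_norm _).trans ((hgood T hT _ ?_).2)
    simp [circleMap, abs_of_pos (hRpos T hT)]
  set k : ℝ → ℝ → ℝ := fun T => Set.indicator {θ | |θ| ≤ Real.pi / 2 - δ T} (g T) with hk
  have hmeas : ∀ T, MeasurableSet {θ : ℝ | |θ| ≤ Real.pi / 2 - δ T} := fun T =>
    (isClosed_le continuous_abs continuous_const).measurableSet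
  have hkabs : ∀ T ≥ (1:ℝ), ∀ θ, |k T θ| ≤ C := by
    intro T hT θ
    simp only [hk, Set.indicator_apply]
    split_ifs with hθ
    · exact hre T hT θ hθ
    · simpa using h.hC.le
  have hkint : ∀ T ≥ (1:ℝ), ∀ a b : ℝ, IntervalIntegrable (k T) volume a b := by
    intro T hT a b
    refine ⟨?_, ?_⟩ <;>
    · exact IntegrableOn.indicator (((hgc T hT).locallyIntegrable).integrableOn_isCompact
        isCompact_Icc |>.mono_set Set.Ioc_subset_Icc_self) (hmeas T)
  have hmid : Tendsto (fun T => ∫ θ in (-(Real.pi / 2))..(Real.pi / 2), k T θ) atTop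
      (nhds (∫ θ in (-(Real.pi / 2))..(Real.pi / 2), d * θ)) := by
    refine intervalIntegral.tendsto_integral_filter_of_dominated_convergence (fun _ => C) ?_ ?_
      (by simp) ?_
    · filter_upwards [eventually_ge_atTop 1] with T hT
      exact ((hgc T hT).measurable.indicator (hmeas T)).aestronglyMeasurable
    · filter_upwards [eventually_ge_atTop 1] with T hT
      exact Eventually.of_forall fun θ _ => hkabs T hT θ
    · have hne : ∀ᵐ θ : ℝ, θ ≠ Real.pi / 2 := by
        simp [ae_iff]
      filter_upwards [hne] with θ hθ hmem
      rw [Set.uIoc_of_le (by linarith)] at hmem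
      have hθ' : |θ| < Real.pi / 2 := abs_lt.mpr ⟨hmem.1, lt_of_le_of_ne hmem.2 hθ⟩
      refine ((h.im_tendsto θ hθ').comp hRtop).congr' ?_
      have h1 : ∀ᶠ T in atTop, δ T < Real.pi / 2 - |θ| :=
        hδlim.eventually_lt_const (by linarith)
      filter_upwards [h1] with T hT
      have : |θ| ≤ Real.pi / 2 - δ T := by linarith
      simp [hk, hg, this]
  have hzero : ∫ θ in (-(Real.pi / 2))..(Real.pi / 2), d * θ = 0 := by
    rw [intervalIntegral.integral_const_mul, integral_id]; ring
  rw [hzero] at hmid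
  have hdiff : ∀ T ≥ (1:ℝ), |(∫ θ in (-(Real.pi / 2))..(Real.pi / 2), g T θ) -
      ∫ θ in (-(Real.pi / 2))..(Real.pi / 2), k T θ| ≤ 2 * (K * logSize T ^ 2 * δ T) := by
    intro T hT
    have hgi : ∀ a b : ℝ, IntervalIntegrable (g T) volume a b :=
      fun a b => (hgc T hT).intervalIntegrable a b
    have hi : ∀ a b : ℝ, IntervalIntegrable (fun θ => g T θ - k T θ) volume a b :=
      fun a b => (hgi a b).sub (hkint T hT a b)
    have hb : ∀ θ, ‖g T θ - k T θ‖ ≤ K * logSize T ^ 2 := by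
      intro θ
      simp only [hk, Set.indicator_apply]
      split_ifs
      · simpa using (abs_nonneg _).trans (habs T hT θ)
      · simpa using habs T hT θ
    rw [← intervalIntegral.integral_sub (hgi _ _) (hkint T hT _ _),
      ← intervalIntegral.integral_add_adjacent_intervals (b := -(Real.pi / 2) + δ T)
        (hi _ _) (hi _ _),
      ← intervalIntegral.integral_add_adjacent_intervals (a := -(Real.pi / 2) + δ T)
        (b := Real.pi / 2 - δ T) (hi _ _) (hi _ _)]
    have e1 := intervalIntegral.norm_integral_le_of_norm_le_const
      (a := -(Real.pi / 2)) (b := -(Real.pi / 2) + δ T) fun θ _ => hb θ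
    have e2 := intervalIntegral.norm_integral_le_of_norm_le_const
      (a := Real.pi / 2 - δ T) (b := Real.pi / 2) fun θ _ => hb θ
    have e3 : ∫ θ in (-(Real.pi / 2) + δ T)..(Real.pi / 2 - δ T), (g T θ - k T θ) = 0 := by
      rw [intervalIntegral.integral_congr (g := fun _ => (0:ℝ)), intervalIntegral.integral_zero]
      intro θ hθ
      rw [Set.uIcc_of_le (by linarith [hδ1 T hT])] at hθ
      have : |θ| ≤ Real.pi / 2 - δ T := abs_le.mpr ⟨by linarith [hθ.1], hθ.2⟩
      simp [hk, this]
    rw [e3, zero_add]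
    have e4 : |-(Real.pi / 2) + δ T - -(Real.pi / 2)| = δ T := by
      rw [add_sub_cancel_left, abs_of_pos (hδ0 T hT)]
    have e5 : |Real.pi / 2 - (Real.pi / 2 - δ T)| = δ T := by
      rw [sub_sub_cancel, abs_of_pos (hδ0 T hT)]
    rw [e4] at e1
    rw [e5] at e2
    refine (abs_add_le _ _).trans ?_
    simp only [Real.norm_eq_abs] at e1 e2
    linarith
  have hK0 : ∀ T ≥ (1:ℝ), 0 ≤ K * logSize T ^ 2 :=
    fun T hT => (abs_nonneg _).trans (habs T hT 0)
  have hout : Tendsto (fun T => 2 * (K * logSize T ^ 2 * δ T)) atTop (nhds 0) := by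
    have h1 : Tendsto (fun T => (Real.pi * W) * (K * logSize T ^ 2 / T)) atTop (nhds 0) := by
      simpa using hlim.const_mul (Real.pi * W)
    refine squeeze_zero' ?_ ?_ h1
    · filter_upwards [eventually_ge_atTop 1] with T hT
      have := hK0 T hT; have := hδ0 T hT
      positivity
    · filter_upwards [eventually_ge_atTop 1] with T hT
      have h2 := hK0 T hT
      have h3 : δ T ≤ Real.pi * W / (2 * T) := by
        simp only [hδ]
        gcongr
        linarith [(hR T hT).1]
      calc 2 * (K * logSize T ^ 2 * δ T) ≤ 2 * (K * logSize T ^ 2 * (Real.pi * W / (2 * T))) := by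
            gcongr
        _ = _ := by field_simp
  have hgint : Tendsto (fun T => ∫ θ in (-(Real.pi / 2))..(Real.pi / 2), g T θ) atTop
      (nhds 0) := by
    have h1 : Tendsto (fun T => (∫ θ in (-(Real.pi / 2))..(Real.pi / 2), g T θ) -
        ∫ θ in (-(Real.pi / 2))..(Real.pi / 2), k T θ) atTop (nhds 0) := by
      refine squeeze_zero_norm' ?_ hout
      filter_upwards [eventually_ge_atTop 1] with T hT
      exact hdiff T hT
    simpa using h1.add hmid
  have hfin : Tendsto (fun T => (2 * Real.pi)⁻¹ • ((2 * I) *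
      ((∫ θ in (-(Real.pi / 2))..(Real.pi / 2), g T θ : ℝ) : ℂ))) atTop (nhds 0) := by
    have h1 := (Complex.continuous_ofReal.tendsto 0).comp hgint
    have h2 := (h1.const_mul (2 * I)).const_smul (2 * Real.pi)⁻¹
    simpa using h2
  refine hfin.congr' ?_
  filter_upwards [eventually_ge_atTop 1] with T hT
  rw [h.circleAverage_logDeriv (hRpos T hT).le fun z hz => (hgood T hT z hz).1,
    intervalIntegral.integral_const_mul, intervalIntegral.integral_ofReal]

end IsCompletedL

theorem iteratedDeriv_const_div_sub (k : ℕ) (a ρ w : ℂ) :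
    iteratedDeriv k (fun z => a / (z - ρ)) w = -(a * k.factorial / (ρ - w) ^ (k + 1)) := by
  have h1 : (fun z : ℂ => a / (z - ρ)) = fun z => a * (1 * z - ρ)⁻¹ := by
    ext z; rw [one_mul, div_eq_mul_inv]
  rw [h1, iteratedDeriv_const_mul_field, iteratedDeriv_eq_iterate, iter_deriv_inv_linear_sub]
  simp only [one_pow, mul_one, one_mul]
  have h2 : (-1 - (k:ℤ)) = -((k + 1 : ℕ) : ℤ) := by push_cast; ring
  rw [h2, zpow_neg, zpow_natCast, ← neg_sub ρ w, neg_pow (ρ - w), mul_inv, ← inv_pow]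
  have h3 : ((-1:ℂ) ^ k) * ((-1:ℂ)⁻¹ ^ (k + 1)) = -1 := by
    rw [inv_neg_one, ← pow_add, show k + (k + 1) = 2 * k + 1 by ring, pow_succ, pow_mul]
    norm_num
  calc a * ((-1) ^ k * (k.factorial : ℂ) * ((-1:ℂ)⁻¹ ^ (k + 1) * ((ρ - w) ^ (k + 1))⁻¹))
      = ((-1:ℂ) ^ k * (-1:ℂ)⁻¹ ^ (k + 1)) * (a * k.factorial * ((ρ - w) ^ (k + 1))⁻¹) := by ring
    _ = _ := by rw [h3, div_eq_mul_inv]; ring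

theorem sum_choose_mul_pow_div_pow {ρ τ : ℂ} (h : ρ ≠ τ) (n : ℕ) :
    ∑ k ∈ Finset.Icc 1 n, (n.choose k : ℂ) * τ ^ k / (ρ - τ) ^ k = (ρ / (ρ - τ)) ^ n - 1 := by
  have h1 : ρ - τ ≠ 0 := sub_ne_zero.mpr h
  have h2 : ρ / (ρ - τ) = τ / (ρ - τ) + 1 := by field_simp; ring
  have h3 : Finset.Ico 1 (n + 1) = Finset.Icc 1 n := by
    ext k; simp only [Finset.mem_Ico, Finset.mem_Icc]; omega
  rw [h2, add_pow, Finset.range_eq_Ico, Finset.sum_eq_sum_Ico_succ_bot (Nat.succ_pos n), zero_add,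
    h3]
  simp only [pow_zero, one_pow, mul_one, Nat.choose_zero_right, Nat.cast_one, add_sub_cancel_left]
  exact Finset.sum_congr rfl fun k _ => by rw [div_pow]; ring

/-- The functional sending a germ `H` at `τ` to
`∑_{k=1}^n binom(n,k) τ^k H^{(k-1)}(τ)/(k-1)!`. -/
def liFunctional (n : ℕ) (τ : ℂ) (H : ℂ → ℂ) : ℂ :=
  ∑ k ∈ Finset.Icc 1 n,
    (n.choose k : ℂ) * τ ^ k * (iteratedDeriv (k - 1) H τ / ((k - 1).factorial : ℂ))

theorem liFunctional_congr {n : ℕ} {τ : ℂ} {H G : ℂ → ℂ} (h : H =ᶠ[nhds τ] G) :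
    liFunctional n τ H = liFunctional n τ G := by
  unfold liFunctional
  exact Finset.sum_congr rfl fun k _ => by rw [h.iteratedDeriv_eq]

theorem liFunctional_add {n : ℕ} {τ : ℂ} {H G : ℂ → ℂ} (hH : AnalyticAt ℂ H τ)
    (hG : AnalyticAt ℂ G τ) :
    liFunctional n τ (fun z => H z + G z) = liFunctional n τ H + liFunctional n τ G := by
  unfold liFunctional
  rw [← Finset.sum_add_distrib]
  refine Finset.sum_congr rfl fun k _ => ?_
  rw [iteratedDeriv_fun_add hH.contDiffAt hG.contDiffAt]
  ring

theorem liFunctional_sub {n : ℕ} {τ : ℂ} {H G : ℂ → ℂ} (hH : AnalyticAt ℂ H τ)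
    (hG : AnalyticAt ℂ G τ) :
    liFunctional n τ (fun z => H z - G z) = liFunctional n τ H - liFunctional n τ G := by
  unfold liFunctional
  rw [← Finset.sum_sub_distrib]
  refine Finset.sum_congr rfl fun k _ => ?_
  rw [iteratedDeriv_fun_sub hH.contDiffAt hG.contDiffAt]
  ring

theorem liFunctional_sum {ι : Type*} {n : ℕ} {τ : ℂ} {H : ι → ℂ → ℂ} {s : Finset ι}
    (hH : ∀ i ∈ s, AnalyticAt ℂ (H i) τ) :
    liFunctional n τ (fun z => ∑ i ∈ s, H i z) = ∑ i ∈ s, liFunctional n τ (H i) := by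
  unfold liFunctional
  rw [Finset.sum_comm]
  refine Finset.sum_congr rfl fun k _ => ?_
  rw [iteratedDeriv_fun_sum fun i hi => (hH i hi).contDiffAt, ← Finset.mul_sum, Finset.sum_div]

theorem liFunctional_const_div_sub {n : ℕ} {τ ρ : ℂ} (h : ρ ≠ τ) (a : ℂ) :
    liFunctional n τ (fun z => a / (z - ρ)) = a * (1 - (ρ / (ρ - τ)) ^ n) := by
  unfold liFunctional
  have h1 : a * (1 - (ρ / (ρ - τ)) ^ n) = -a * ((ρ / (ρ - τ)) ^ n - 1) := by ring
  rw [h1, ← sum_choose_mul_pow_div_pow h, Finset.mul_sum]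
  refine Finset.sum_congr rfl fun k hk => ?_
  obtain ⟨hk1, _⟩ := Finset.mem_Icc.mp hk
  rw [iteratedDeriv_const_div_sub, Nat.sub_add_cancel hk1]
  have h2 : ((k - 1).factorial : ℂ) ≠ 0 := by exact_mod_cast Nat.factorial_ne_zero _
  field_simp

theorem analyticAt_const_div_sub {ρ τ : ℂ} (h : τ ≠ ρ) (a : ℂ) :
    AnalyticAt ℂ (fun z => a / (z - ρ)) τ :=
  analyticAt_const.div (analyticAt_id.sub analyticAt_const) (sub_ne_zero.mpr h)

theorem liFunctional_const {n : ℕ} (hn : 0 < n) {τ : ℂ} (a : ℂ) :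
    liFunctional n τ (fun _ => a) = n * τ * a := by
  unfold liFunctional
  rw [Finset.sum_eq_single_of_mem 1 (Finset.mem_Icc.mpr ⟨le_rfl, hn⟩)]
  · simp
  · intro k hk hk1
    have : k - 1 ≠ 0 := by
      have := (Finset.mem_Icc.mp hk).1
      omega
    simp [iteratedDeriv_const, this]

theorem norm_circleAverage_le {F : ℂ → ℂ} {c : ℂ} {R B : ℝ} (hR : 0 ≤ R)
    (hB : ∀ z, ‖z - c‖ = R → ‖F z‖ ≤ B) : ‖Real.circleAverage F c R‖ ≤ B := by
  rw [Real.circleAverage, norm_smul]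
  have h1 := intervalIntegral.norm_integral_le_of_norm_le_const (a := 0) (b := 2 * Real.pi)
    (f := fun θ => F (circleMap c R θ)) (C := B)
    fun θ _ => hB _ (by simp [circleMap, abs_of_nonneg hR])
  have hpi := Real.pi_pos
  rw [sub_zero, abs_of_pos (by positivity)] at h1
  rw [norm_inv, Real.norm_of_nonneg (by positivity), inv_mul_le_iff₀ (by positivity)]
  linarith

namespace IsCompletedL

variable {f : ℂ → ℂ} {σ A d C : ℝ}

theorem analyticAt_logDeriv (h : IsCompletedL f σ A d C) {z : ℂ} (hz : f z ≠ 0) :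
    AnalyticAt ℂ (logDeriv f) z :=
  (h.diff.analyticAt z).deriv.div (h.diff.analyticAt z) hz

/-- The derivatives of `f'/f` at `τ` as limits of sums over zeros in discs. -/
theorem tendsto_iteratedDeriv_sub_sum (h : IsCompletedL f σ A d C) {Rf : ℝ → ℝ} {K : ℝ}
    (hR : ∀ T ≥ (1:ℝ), Rf T ∈ Set.Icc (T + (A - σ / 2)) (T + (A - σ / 2) + 1))
    (hgood : ∀ T ≥ (1:ℝ), ∀ z : ℂ, ‖z - σ / 2‖ = Rf T →
      f z ≠ 0 ∧ ‖logDeriv f z‖ ≤ K * logSize T ^ 2)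
    (hlim : Tendsto (fun T => K * logSize T ^ 2 / T) atTop (nhds 0))
    (Zf : ℝ → Finset ℂ) (hZ : ∀ T z, z ∈ Zf T ↔ f z = 0 ∧ ‖z - σ / 2‖ < Rf T)
    {τ : ℂ} (hτ : f τ ≠ 0) (k : ℕ) :
    Tendsto (fun T => iteratedDeriv k
      (fun w => logDeriv f w - ∑ ρ ∈ Zf T, (zeroOrder f ρ : ℂ) / (w - ρ)) τ) atTop (nhds 0) := by
  have hW1 : 1 ≤ A - σ / 2 := by have := h.hA; linarith
  have hopen : IsOpen {z | f z ≠ 0} := isOpen_ne.preimage h.diff.continuous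
  obtain ⟨ε', hε', hball⟩ := Metric.isOpen_iff.mp hopen τ hτ
  set ε := ε' / 2 with hε
  have hε0 : 0 < ε := by positivity
  have hne : ∀ w ∈ Metric.closedBall τ ε, f w ≠ 0 := fun w hw =>
    hball (Metric.closedBall_subset_ball (by linarith) hw)
  set D := ‖τ - σ / 2‖ + ε with hD
  have hD0 : 0 < D := by positivity
  have hwD : ∀ w ∈ Metric.closedBall τ ε, ‖w - σ / 2‖ ≤ D := by
    intro w hw
    calc ‖w - σ / 2‖ = ‖(w - τ) + (τ - σ / 2)‖ := by ring_nf
      _ ≤ ‖w - τ‖ + ‖τ - σ / 2‖ := norm_add_le _ _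
      _ ≤ D := by
        have : ‖w - τ‖ ≤ ε := by simpa [dist_eq_norm] using hw
        rw [hD]; linarith
  set u : ℝ → ℝ := fun T => ‖Real.circleAverage (logDeriv f) (σ / 2) (Rf T)‖ +
    2 * D * (K * logSize T ^ 2 / T) with hu
  have hulim : Tendsto u atTop (nhds 0) := by
    have h1 := (h.tendsto_circleAverage_logDeriv hR hgood hlim).norm
    have h2 := h1.add (hlim.const_mul (2 * D))
    simpa using h2
  have hbound : ∀ T ≥ max 1 (2 * D), ‖iteratedDeriv k
      (fun w => logDeriv f w - ∑ ρ ∈ Zf T, (zeroOrder f ρ : ℂ) / (w - ρ)) τ‖ ≤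
        k.factorial * u T / ε ^ k := by
    intro T hT
    have hT1 : 1 ≤ T := (le_max_left _ _).trans hT
    have hT2 : 2 * D ≤ T := (le_max_right _ _).trans hT
    have hRT : T ≤ Rf T := by linarith [(hR T hT1).1]
    have hR0 : 0 < Rf T := by linarith
    refine norm_iteratedDeriv_le_of_forall_mem_sphere_norm_le k hε0 ?_ ?_
    · refine DifferentiableOn.diffContOnCl ?_
      rw [closure_ball _ hε0.ne']
      intro w hw
      refine DifferentiableAt.differentiableWithinAt ?_
      refine (h.analyticAt_logDeriv (hne w hw)).differentiableAt.sub ?_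
      refine DifferentiableAt.fun_sum fun ρ hρ => ?_
      refine (analyticAt_const_div_sub ?_ _).differentiableAt
      rintro rfl
      exact hne _ hw ((hZ T w).mp hρ).1
    · intro w hw
      have hw' := Metric.sphere_subset_closedBall hw
      have hwR : w ∈ Metric.ball ((σ:ℂ) / 2) (Rf T) := by
        rw [Metric.mem_ball, dist_eq_norm]
        linarith [hwD w hw']
      have hs : ∀ z ∈ Metric.sphere ((σ:ℂ) / 2) (Rf T), f z ≠ 0 := fun z hz =>
        (hgood T hT1 z (by simpa [dist_eq_norm] using hz)).1
      rw [logDeriv_sub_sum_eq_circleAverage h.diff hR0 hs (Zf T) (hZ T) hwR (hne w hw')]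
      have hcont := h.continuousOn_logDeriv_sphere (c := σ / 2) (R := Rf T)
        fun z hz => (hgood T hT1 z hz).1
      have hzw : ∀ z ∈ Metric.sphere ((σ:ℂ) / 2) (Rf T), z - w ≠ 0 := by
        intro z hz h0
        rw [sub_eq_zero.mp h0] at hz
        simp only [Metric.mem_sphere, Metric.mem_ball] at hz hwR; linarith
      have hker : ContinuousOn (fun z => (w - σ / 2) / (z - w))
          (Metric.sphere ((σ:ℂ) / 2) (Rf T)) :=
        ContinuousOn.div (by fun_prop) (by fun_prop) hzw
      have hsplit : Real.circleAverage (fun z => (z - σ / 2) / (z - w) * logDeriv f z)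
          (σ / 2) (Rf T) = Real.circleAverage (logDeriv f) (σ / 2) (Rf T) +
          Real.circleAverage (fun z => (w - σ / 2) / (z - w) * logDeriv f z) (σ / 2) (Rf T) := by
        rw [← Real.circleAverage_fun_add (hcont.circleIntegrable hR0.le)
          (ContinuousOn.circleIntegrable hR0.le (hker.fun_mul hcont))]
        refine Real.circleAverage_congr_sphere fun z hz => ?_
        rw [abs_of_pos hR0] at hz
        have := hzw z hz
        field_simp
        ring
      rw [hsplit]
      refine (norm_add_le _ _).trans (add_le_add le_rfl ?_)
      refine norm_circleAverage_le hR0.le fun z hz => ?_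
      rw [norm_mul, norm_div]
      have h1 : T / 2 ≤ ‖z - w‖ := by
        have : ‖z - σ / 2‖ ≤ ‖z - w‖ + ‖w - σ / 2‖ := by
          simpa using norm_add_le (z - w) (w - σ / 2)
        have := hwD w hw'
        linarith
      have h2 := (hgood T hT1 z hz).2
      have h3 : 0 ≤ K * logSize T ^ 2 := (norm_nonneg _).trans h2
      calc ‖w - σ / 2‖ / ‖z - w‖ * ‖logDeriv f z‖ ≤ D / (T / 2) * (K * logSize T ^ 2) := by
            gcongr
            exact hwD w hw'
        _ = 2 * D * (K * logSize T ^ 2 / T) := by field_simp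
  refine squeeze_zero_norm' ?_ (a := fun T => k.factorial * u T / ε ^ k) ?_
  · filter_upwards [eventually_ge_atTop (max 1 (2 * D))] with T hT using hbound T hT
  · have := (hulim.const_mul (k.factorial : ℝ)).div_const (ε ^ k)
    simpa using this

end IsCompletedL

theorem tendsto_logSize_pow_div (K : ℝ) (m : ℕ) :
    Tendsto (fun T => K * logSize T ^ m / T) atTop (nhds 0) := by
  have h1 : Tendsto (fun x : ℝ => Real.log x ^ m / x) atTop (nhds 0) :=
    (Real.isLittleO_pow_log_id_atTop (n := m)).tendsto_div_nhds_zero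
  have h2 : Tendsto (fun T : ℝ => Real.exp 1 * (1 + T)) atTop atTop :=
    (tendsto_atTop_add_const_left _ _ tendsto_id).const_mul_atTop (Real.exp_pos 1)
  have h3 := (h1.comp h2).norm.const_mul (|K| * (Real.exp 1 * 2))
  simp only [norm_zero, mul_zero] at h3
  refine squeeze_zero_norm' ?_ h3
  filter_upwards [eventually_ge_atTop 1] with T hT
  have hlog : Real.log (Real.exp 1 * (1 + T)) = logSize T := by
    rw [Real.log_mul (Real.exp_pos 1).ne' (by linarith), Real.log_exp, logSize,
      abs_of_nonneg (by linarith)]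
  have he := Real.exp_pos 1
  simp only [Function.comp, hlog, norm_div, norm_mul, Real.norm_eq_abs, abs_of_pos he]
  rw [abs_of_pos (by linarith : 0 < 1 + T), abs_of_pos (by linarith : 0 < T)]
  have h5 : |K| * (Real.exp 1 * 2) * (|logSize T ^ m| / (Real.exp 1 * (1 + T))) =
      |K| * |logSize T ^ m| * 2 / (1 + T) := by
    field_simp
  rw [h5, div_le_div_iff₀ (by linarith) (by linarith)]
  have : 0 ≤ |K| * |logSize T ^ m| := by positivity
  nlinarith

namespace IsCompletedL

variable {f : ℂ → ℂ} {σ A d C : ℝ}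

/-- The sum over zeros defining the Li coefficients, in terms of `f'/f` at `τ`. -/
theorem tendsto_tsum_zeros (h : IsCompletedL f σ A d C) {τ : ℝ} (hτ : f τ ≠ 0) (n : ℕ) :
    Tendsto (fun T : ℝ => ∑' ρ : {ρ : ℂ // f ρ = 0 ∧ |ρ.im| ≤ T},
        (zeroOrder f ρ : ℂ) * (1 - ((ρ : ℂ) / ((ρ : ℂ) - τ)) ^ n)) atTop
      (nhds (liFunctional n τ (logDeriv f))) := by
  classical
  obtain ⟨K, hK, hrad⟩ := h.exists_good_radius
  choose! Rf hR hgood using hrad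
  have hlim := tendsto_logSize_pow_div K 2
  have hW1 : 1 ≤ A - σ / 2 := by have := h.hA; linarith
  have hfin : ∀ T, {z | f z = 0 ∧ z ∈ Metric.ball ((σ:ℂ) / 2) (Rf T)}.Finite := fun T =>
    finite_zeros_inter_of_isBounded h.diff hτ Metric.isBounded_ball
  set Zf : ℝ → Finset ℂ := fun T => (hfin T).toFinset with hZf
  have hZ : ∀ T z, z ∈ Zf T ↔ f z = 0 ∧ ‖z - σ / 2‖ < Rf T := by
    intro T z
    simp [hZf, dist_eq_norm]
  set t : ℂ → ℂ := fun ρ => (zeroOrder f ρ : ℂ) * (1 - (ρ / (ρ - τ)) ^ n) with ht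
  have hneτ : ∀ ρ, f ρ = 0 → ρ ≠ τ := by
    rintro ρ hρ rfl
    exact hτ hρ
  have hS : Tendsto (fun T => ∑ ρ ∈ Zf T, t ρ) atTop (nhds (liFunctional n τ (logDeriv f))) := by
    have h1 : Tendsto (fun T => liFunctional n τ
        (fun w => logDeriv f w - ∑ ρ ∈ Zf T, (zeroOrder f ρ : ℂ) / (w - ρ))) atTop (nhds 0) := by
      unfold liFunctional
      have h2 : Tendsto (fun T => ∑ k ∈ Finset.Icc 1 n, (n.choose k : ℂ) * (τ:ℂ) ^ k *
          (iteratedDeriv (k - 1) (fun w => logDeriv f w -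
            ∑ ρ ∈ Zf T, (zeroOrder f ρ : ℂ) / (w - ρ)) τ / ((k - 1).factorial : ℂ))) atTop
          (nhds (∑ k ∈ Finset.Icc 1 n, (n.choose k : ℂ) * (τ:ℂ) ^ k *
            (0 / ((k - 1).factorial : ℂ)))) :=
        tendsto_finsetSum _ fun k _ =>
          ((h.tendsto_iteratedDeriv_sub_sum hR hgood hlim Zf hZ hτ (k - 1)).div_const _).const_mul _
      simpa using h2
    have h3 := h1.const_sub (liFunctional n τ (logDeriv f))
    rw [sub_zero] at h3
    refine h3.congr fun T => ?_
    have han : ∀ ρ ∈ Zf T, AnalyticAt ℂ (fun w => (zeroOrder f ρ : ℂ) / (w - ρ)) τ :=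
      fun ρ hρ => analyticAt_const_div_sub (hneτ ρ ((hZ T ρ).mp hρ).1).symm _
    rw [liFunctional_sub (h.analyticAt_logDeriv hτ) (Finset.analyticAt_fun_sum _ han),
      liFunctional_sum han, sub_sub_cancel]
    exact Finset.sum_congr rfl fun ρ hρ =>
      liFunctional_const_div_sub (hneτ ρ ((hZ T ρ).mp hρ).1) _
  obtain ⟨K', hK', hzeros⟩ := h.exists_zeros_at_height
  set M : ℝ := ∑ k ∈ Finset.Icc 1 n, (n.choose k : ℝ) * |τ| ^ k with hM
  have hM0 : 0 ≤ M := Finset.sum_nonneg fun k _ => by positivity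
  have hdiff : Tendsto (fun T => ∑ ρ ∈ (Zf T).filter (fun ρ => ¬ |ρ.im| ≤ T), t ρ) atTop
      (nhds 0) := by
    refine squeeze_zero_norm' ?_ (tendsto_logSize_pow_div (M * K') 1)
    filter_upwards [eventually_ge_atTop 1] with T hT
    obtain ⟨Z, hZ0, hZmem, hcount, -⟩ := hzeros T
    have hT0 : 0 < T := by linarith
    have hsub : (Zf T).filter (fun ρ => ¬ |ρ.im| ≤ T) ⊆ Z := by
      intro ρ hρ
      obtain ⟨h1, h2⟩ := Finset.mem_filter.mp hρ
      obtain ⟨h3, h4⟩ := (hZ T ρ).mp h1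
      refine hZmem ρ h3 (not_le.mp h2).le ?_
      have := Complex.abs_im_le_norm (ρ - σ / 2)
      have e : (ρ - σ / 2 : ℂ).im = ρ.im := by simp
      rw [e] at this
      linarith [(hR T hT).2]
    have hterm : ∀ ρ ∈ (Zf T).filter (fun ρ => ¬ |ρ.im| ≤ T),
        ‖t ρ‖ ≤ (zeroOrder f ρ : ℝ) * (M / T) := by
      intro ρ hρ
      obtain ⟨h1, h2⟩ := Finset.mem_filter.mp hρ
      have hne := hneτ ρ ((hZ T ρ).mp h1).1
      have hTρ : T ≤ ‖ρ - τ‖ := by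
        have := Complex.abs_im_le_norm (ρ - τ)
        have e : (ρ - τ : ℂ).im = ρ.im := by simp
        rw [e] at this
        exact (not_le.mp h2).le.trans this
      simp only [ht]
      rw [norm_mul, Complex.norm_natCast, norm_sub_rev, ← sum_choose_mul_pow_div_pow hne]
      refine mul_le_mul_of_nonneg_left ?_ (by positivity)
      rw [hM, Finset.sum_div]
      refine (norm_sum_le _ _).trans (Finset.sum_le_sum fun k hk => ?_)
      rw [norm_div, norm_mul, norm_pow, norm_pow, Complex.norm_natCast, Complex.norm_real,
        Real.norm_eq_abs]
      have hk1 := (Finset.mem_Icc.mp hk).1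
      have : T ≤ ‖ρ - τ‖ ^ k :=
        hTρ.trans (le_self_pow₀ (hT.trans hTρ) (by omega))
      gcongr
    calc ‖∑ ρ ∈ (Zf T).filter (fun ρ => ¬ |ρ.im| ≤ T), t ρ‖
        ≤ ∑ ρ ∈ (Zf T).filter (fun ρ => ¬ |ρ.im| ≤ T), (zeroOrder f ρ : ℝ) * (M / T) :=
          (norm_sum_le _ _).trans (Finset.sum_le_sum hterm)
      _ ≤ ∑ ρ ∈ Z, (zeroOrder f ρ : ℝ) * (M / T) :=
          Finset.sum_le_sum_of_subset_of_nonneg hsub fun _ _ _ => by positivity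
      _ = ((∑ ρ ∈ Z, zeroOrder f ρ : ℕ) : ℝ) * (M / T) := by
          push_cast; rw [Finset.sum_mul]
      _ ≤ K' * logSize T * (M / T) := by gcongr
      _ = M * K' * logSize T ^ 1 / T := by ring
  have hfinal := hS.sub hdiff
  rw [sub_zero] at hfinal
  refine hfinal.congr' ?_
  filter_upwards [eventually_ge_atTop 1] with T hT
  have hset : {ρ : ℂ | f ρ = 0 ∧ |ρ.im| ≤ T} = ((Zf T).filter fun ρ => |ρ.im| ≤ T : Finset ℂ) := by
    ext ρ
    simp only [Set.mem_ofPred_eq, Finset.coe_filter, hZ]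
    refine ⟨fun hρ => ⟨⟨hρ.1, ?_⟩, hρ.2⟩, fun hρ => ⟨hρ.1.1, hρ.2⟩⟩
    have h1 := Complex.norm_le_abs_re_add_abs_im (ρ - σ / 2)
    have e1 : (ρ - σ / 2 : ℂ).re = ρ.re - σ / 2 := by simp
    have e2 : (ρ - σ / 2 : ℂ).im = ρ.im := by simp
    rw [e1, e2] at h1
    have h2 := h.zero_re hρ.1
    linarith [(hR T hT).1, hρ.2]
  rw [← Finset.sum_filter_add_sum_filter_not (Zf T) (fun ρ => |ρ.im| ≤ T), add_sub_cancel_right]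
  change _ = ∑' ρ : ({ρ : ℂ | f ρ = 0 ∧ |ρ.im| ≤ T} : Set ℂ), t ρ
  rw [hset, Finset.tsum_subtype']

end IsCompletedL

theorem digamma_ofReal {x : ℝ} (hx : 0 < x) :
    Complex.digamma x = (deriv (fun y => Real.log (Real.Gamma y)) x : ℝ) := by
  have hne : ∀ m : ℕ, x ≠ -m := fun m => by
    have : (0 : ℝ) ≤ m := m.cast_nonneg
    linarith
  have hne' : ∀ m : ℕ, (x : ℂ) ≠ -m := fun m h => hne m (by exact_mod_cast h)
  have h1 := (Complex.differentiableAt_Gamma x hne').hasDerivAt.comp_ofReal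
  have h2 := (Real.differentiableAt_Gamma hne).hasDerivAt
  have h3 := h2.ofReal_comp
  simp only [← Complex.Gamma_ofReal] at h3
  have h4 := h1.unique h3
  rw [(h2.log (Real.Gamma_pos_of_pos hx).ne').deriv, digamma_def, logDeriv_apply, h4,
    Complex.Gamma_ofReal]
  push_cast
  rfl

theorem deriv_log_Gamma_mem {x : ℝ} (hx : 1 < x) :
    deriv (fun y => Real.log (Real.Gamma y)) x ∈ Set.Icc (Real.log (x - 1)) (Real.log x) := by
  have hc := Real.convexOn_log_Gamma
  have hd : DifferentiableAt ℝ (fun y => Real.log (Real.Gamma y)) x := by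
    refine (Real.differentiableAt_Gamma fun m => ?_).log (Real.Gamma_pos_of_pos (by linarith)).ne'
    have : (0 : ℝ) ≤ m := m.cast_nonneg
    linarith
  have hs : ∀ y : ℝ, 0 < y →
      Real.log (Real.Gamma (y + 1)) - Real.log (Real.Gamma y) = Real.log y := fun y hy => by
    rw [Real.Gamma_add_one hy.ne', Real.log_mul hy.ne' (Real.Gamma_pos_of_pos hy).ne']
    ring
  constructor
  · have := hc.slope_le_deriv (x := x - 1) (y := x) (Set.mem_Ioi.2 (by linarith))
      (Set.mem_Ioi.2 (by linarith)) (by linarith) hd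
    rw [slope_def_field] at this
    have h := hs (x - 1) (by linarith)
    rw [sub_add_cancel] at h
    simp only [Function.comp, h] at this
    rw [show (fun y => Real.log (Real.Gamma y)) = Real.log ∘ Real.Gamma from rfl]
    simpa using this
  · have := hc.deriv_le_slope (x := x) (y := x + 1) (Set.mem_Ioi.2 (by linarith))
      (Set.mem_Ioi.2 (by linarith)) (by linarith) hd
    rw [slope_def_field] at this
    have h := hs x (by linarith)
    simp only [Function.comp, h] at this
    rw [show (fun y => Real.log (Real.Gamma y)) = Real.log ∘ Real.Gamma from rfl]
    simpa using this

/-- The increment of `log - digamma` under a unit shift. -/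
def digammaIncr (s : ℂ) : ℂ := Complex.log (s + 1) - Complex.log s - s⁻¹

theorem digamma_sub_log_sub {s : ℂ} (hs : 0 < s.re) :
    (Complex.digamma s - Complex.log s) - (Complex.digamma (s + 1) - Complex.log (s + 1)) =
      digammaIncr s := by
  rw [Complex.digamma_apply_add_one s, digammaIncr]
  · ring
  · rintro m rfl
    have : (0 : ℝ) ≤ m := m.cast_nonneg
    simp at hs
    linarith

theorem norm_digammaIncr_le {s : ℂ} (hs : 2 ≤ s.re) : ‖digammaIncr s‖ ≤ 1 / s.re ^ 2 := by
  have hs0 : s ≠ 0 := fun h => by simp [h] at hs; linarith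
  have hn : 2 ≤ ‖s‖ := hs.trans (re_le_norm s)
  have hinv : ‖s⁻¹‖ ≤ 1 / 2 := by
    rw [norm_inv, ← one_div]; exact one_div_le_one_div_of_le two_pos hn
  have h1 : 0 < (1 + s⁻¹).re := by
    have := (abs_le.1 ((abs_re_le_norm s⁻¹).trans hinv)).1
    simp only [add_re, one_re]
    linarith
  have hlog : Complex.log (s + 1) = Complex.log s + Complex.log (1 + s⁻¹) := by
    have h2 : s + 1 = s * (1 + s⁻¹) := by field_simp
    rw [h2]
    refine Complex.log_mul hs0 (fun h => by rw [h] at h1; simp at h1) ?_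
    have a1 := abs_lt.1 (abs_arg_lt_pi_div_two_iff.2 (Or.inl (by linarith : 0 < s.re)))
    have a2 := abs_lt.1 (abs_arg_lt_pi_div_two_iff.2 (Or.inl h1))
    constructor <;> linarith [a1.1, a1.2, a2.1, a2.2]
  have h3 := Complex.norm_log_one_add_sub_self_le (z := s⁻¹) (by linarith)
  have h4 : digammaIncr s = Complex.log (1 + s⁻¹) - s⁻¹ := by
    rw [digammaIncr, hlog]; ring
  rw [h4]
  refine h3.trans ?_
  have h5 : (1 - ‖s⁻¹‖)⁻¹ ≤ 2 := by
    rw [inv_le_comm₀ (by linarith) two_pos]; linarith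
  have h6 : ‖s⁻¹‖ ≤ 1 / s.re := by
    rw [norm_inv, ← one_div]
    exact one_div_le_one_div_of_le (by linarith) (re_le_norm s)
  have h7 : ‖s⁻¹‖ ^ 2 ≤ 1 / s.re ^ 2 := by
    rw [← one_div_pow]; exact pow_le_pow_left₀ (norm_nonneg _) h6 2
  have := sq_nonneg ‖s⁻¹‖
  nlinarith

theorem norm_sum_digammaIncr_le {s : ℂ} (hs : 2 ≤ s.re) (N : ℕ) :
    ‖∑ k ∈ Finset.range N, digammaIncr (s + k)‖ ≤ 1 / (s.re - 1) - 1 / (s.re + N - 1) := by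
  induction N with
  | zero => simp
  | succ N ih =>
    rw [Finset.sum_range_succ]
    have hN : (0 : ℝ) ≤ N := N.cast_nonneg
    have h := norm_digammaIncr_le (s := s + N) (by simp; linarith)
    simp only [add_re, natCast_re] at h
    have h2 : 1 / (s.re + N) ^ 2 ≤ 1 / (s.re + N - 1) - 1 / (s.re + N) := by
      rw [div_sub_div _ _ (by linarith) (by linarith), div_le_div_iff₀ (by nlinarith)
        (mul_pos (by linarith) (by linarith))]
      have : 0 < s.re + N := by linarith
      nlinarith
    refine (norm_add_le _ _).trans ?_
    push_cast
    rw [show s.re + (N + 1) - 1 = s.re + N by ring]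
    linarith

theorem digamma_sub_log_eq_sum {s : ℂ} (hs : 0 < s.re) (N : ℕ) :
    Complex.digamma s - Complex.log s =
      ∑ k ∈ Finset.range N, digammaIncr (s + k) +
        (Complex.digamma (s + N) - Complex.log (s + N)) := by
  induction N with
  | zero => simp
  | succ N ih =>
    have hN : (0 : ℝ) ≤ N := N.cast_nonneg
    rw [Finset.sum_range_succ, ih, ← digamma_sub_log_sub (s := s + N) (by simp; linarith)]
    push_cast
    rw [← add_assoc]
    ring

theorem tendsto_digamma_sub_log_nat {x : ℝ} (hx : 1 < x) :
    Tendsto (fun N : ℕ => Complex.digamma ((x : ℂ) + N) - Complex.log ((x : ℂ) + N)) atTop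
      (nhds 0) := by
  have h1 : Tendsto (fun N : ℕ => x + N - 1) atTop atTop := by
    have := tendsto_atTop_add_const_left atTop (x - 1) (tendsto_natCast_atTop_atTop (R := ℝ))
    refine this.congr fun N => by ring
  refine squeeze_zero_norm (a := fun N : ℕ => 1 / (x + N - 1)) (fun N => ?_)
    (by simpa [Pi.inv_def] using h1.inv_tendsto_atTop)
  have hN : (0 : ℝ) ≤ N := N.cast_nonneg
  have h2 := deriv_log_Gamma_mem (x := x + N) (by linarith)
  have h3 : (x : ℂ) + N = ((x + N : ℝ) : ℂ) := by push_cast; ring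
  rw [h3, digamma_ofReal (by linarith), ← Complex.ofReal_log (by linarith), ← ofReal_sub,
    norm_real, Real.norm_eq_abs, abs_le]
  have h4 : Real.log (x + N) - Real.log (x + N - 1) ≤ 1 / (x + N - 1) := by
    rw [← Real.log_div (by linarith) (by linarith)]
    refine (Real.log_le_sub_one_of_pos (div_pos (by linarith) (by linarith))).trans (le_of_eq ?_)
    rw [div_sub_one (by linarith)]
    ring
  have : 0 ≤ 1 / (x + N - 1) := by
    apply div_nonneg zero_le_one; linarith
  constructor <;> linarith [h2.1, h2.2]

theorem summable_inv_nat_add_two_sq : Summable (fun n : ℕ => 1 / ((n : ℝ) + 2) ^ 2) := by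
  have := (summable_nat_add_iff 2).2 (Real.summable_one_div_nat_pow.2 (one_lt_two))
  simpa using this

theorem norm_digammaIncr_add_le {s : ℂ} (hs : 2 < s.re) (n : ℕ) :
    ‖digammaIncr (s + n)‖ ≤ 1 / ((n : ℝ) + 2) ^ 2 := by
  have hN : (0 : ℝ) ≤ n := n.cast_nonneg
  refine (norm_digammaIncr_le (s := s + n) (by simp; linarith)).trans ?_
  simp only [add_re, natCast_re]
  gcongr 1 / ?_
  apply pow_le_pow_left₀ <;> linarith

theorem digamma_sub_log_eq_tsum {s : ℂ} (hs : 2 < s.re) :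
    Complex.digamma s - Complex.log s = ∑' n : ℕ, digammaIncr (s + n) := by
  set U : Set ℂ := {z | 2 < z.re} with hU
  have hUo : IsOpen U := isOpen_lt continuous_const continuous_re
  have hUc : IsPreconnected U := (convex_halfSpace_re_gt 2).isPreconnected
  have hslit : ∀ z : ℂ, 0 < z.re → z ∈ slitPlane := fun z hz => Or.inl hz
  have hdl : DifferentiableOn ℂ (fun s => Complex.digamma s - Complex.log s) U := by
    intro z hz
    have hz : 2 < z.re := hz
    have hza : ∀ m : ℕ, z ≠ -m := by
      rintro m rfl
      have : (0 : ℝ) ≤ m := m.cast_nonneg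
      simp at hz
      linarith
    have hV : IsOpen {z : ℂ | 0 < z.re} := isOpen_lt continuous_const continuous_re
    have hG : DifferentiableOn ℂ Complex.Gamma {z : ℂ | 0 < z.re} := fun w hw => by
      refine (Complex.differentiableAt_Gamma w ?_).differentiableWithinAt
      rintro m rfl
      have : (0 : ℝ) ≤ m := m.cast_nonneg
      have hw : 0 < (-(m : ℂ)).re := hw
      simp at hw
      linarith
    have hz0 : z ∈ {z : ℂ | 0 < z.re} := by
      change 0 < z.re
      linarith
    have ha := (hG.analyticOnNhd hV z hz0)
    have : DifferentiableAt ℂ Complex.digamma z :=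
      (ha.deriv.div ha (Complex.Gamma_ne_zero hza)).differentiableAt
    exact (this.sub (differentiableAt_id.clog (hslit z hz0))).differentiableWithinAt
  have hdt : DifferentiableOn ℂ (fun s => ∑' n : ℕ, digammaIncr (s + n)) U := by
    refine differentiableOn_tsum_of_summable_norm summable_inv_nat_add_two_sq (fun n z hz => ?_) hUo
      fun n z hz => norm_digammaIncr_add_le hz n
    have hz : 2 < z.re := hz
    have hN : (0 : ℝ) ≤ n := n.cast_nonneg
    have h0 : z + n ≠ 0 := fun h => by
      have := congrArg re h
      simp at this
      linarith
    unfold digammaIncr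
    refine DifferentiableAt.differentiableWithinAt ?_
    have hd : DifferentiableAt ℂ (fun s : ℂ => s + n) z := by fun_prop
    refine DifferentiableAt.sub (DifferentiableAt.sub ?_ ?_) (hd.inv h0)
    · exact (hd.add_const 1).clog (hslit _ (by simp; linarith))
    · exact hd.clog (hslit _ (by simp; linarith))
  refine (hdl.analyticOnNhd hUo).eqOn_of_preconnected_of_frequently_eq (hdt.analyticOnNhd hUo)
    hUc (z₀ := 3) (by simp [hU]; norm_num) ?_ hs
  have hreal : ∀ x : ℝ, 2 < x → Complex.digamma x - Complex.log x =
      ∑' n : ℕ, digammaIncr ((x : ℂ) + n) := by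
    intro x hx
    have hsum : Summable (fun n : ℕ => digammaIncr ((x : ℂ) + n)) :=
      Summable.of_norm_bounded summable_inv_nat_add_two_sq
        fun n => norm_digammaIncr_add_le (by simpa using hx) n
    have t1 := hsum.hasSum.tendsto_sum_nat.add (tendsto_digamma_sub_log_nat (x := x) (by linarith))
    rw [add_zero] at t1
    refine tendsto_nhds_unique ?_ t1
    exact tendsto_const_nhds.congr fun N =>
      digamma_sub_log_eq_sum (s := x) (by simp; linarith) N
  have ht : Tendsto (fun x : ℝ => (x : ℂ)) (nhdsWithin 3 {3}ᶜ) (nhdsWithin ((3 : ℝ) : ℂ) {((3 : ℝ) : ℂ)}ᶜ) := by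
    refine tendsto_nhdsWithin_of_tendsto_nhds_of_eventually_within _
      ((Complex.continuous_ofReal.tendsto 3).mono_left nhdsWithin_le_nhds) ?_
    filter_upwards [self_mem_nhdsWithin] with x hx h
    exact hx (Complex.ofReal_injective h)
  rw [show (3 : ℂ) = ((3 : ℝ) : ℂ) by norm_num]
  refine ht.frequently (Eventually.frequently ?_)
  filter_upwards [nhdsWithin_le_nhds (lt_mem_nhds (by norm_num : (2 : ℝ) < 3))] with x hx
  exact hreal x hx

/-- A weak form of Stirling's formula for the digamma function. -/
theorem norm_digamma_sub_log_le {s : ℂ} (hs : 2 < s.re) :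
    ‖Complex.digamma s - Complex.log s‖ ≤ 1 / (s.re - 1) := by
  rw [digamma_sub_log_eq_tsum hs]
  have hsum : Summable (fun n : ℕ => digammaIncr (s + n)) :=
    Summable.of_norm_bounded summable_inv_nat_add_two_sq fun n => norm_digammaIncr_add_le hs n
  refine le_of_tendsto hsum.hasSum.tendsto_sum_nat.norm (Eventually.of_forall fun N => ?_)
  refine (norm_sum_digammaIncr_le hs.le N).trans ?_
  have hN : (0 : ℝ) ≤ N := N.cast_nonneg
  have : 0 ≤ 1 / (s.re + N - 1) := by apply div_nonneg zero_le_one; linarith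
  linarith

theorem eventually_gamma_arg_ne {w : ℂ} (h : ∀ k : ℕ, w ≠ -(k : ℂ)) :
    ∀ᶠ z in nhds w, ∀ k : ℕ, z ≠ -(k : ℂ) := by
  have h1 : (Complex.Gamma w)⁻¹ ≠ 0 := inv_ne_zero (Complex.Gamma_ne_zero h)
  filter_upwards [Complex.differentiable_one_div_Gamma.continuous.continuousAt.eventually_ne h1]
    with z hz k hk
  exact hz (by rw [(Complex.Gamma_eq_zero_iff z).2 ⟨k, hk⟩, inv_zero])

theorem analyticAt_digamma {w : ℂ} (h : ∀ k : ℕ, w ≠ -(k : ℂ)) :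
    AnalyticAt ℂ Complex.digamma w := by
  have ha : AnalyticAt ℂ Complex.Gamma w := by
    rw [analyticAt_iff_eventually_differentiableAt]
    exact (eventually_gamma_arg_ne h).mono fun z hz => Complex.differentiableAt_Gamma z hz
  exact ha.deriv.div ha (Complex.Gamma_ne_zero h)

theorem logDeriv_mul_mul_mul_mul {f₁ f₂ f₃ f₄ f₅ : ℂ → ℂ} {s : ℂ} (h₁ : f₁ s ≠ 0) (h₂ : f₂ s ≠ 0)
    (h₃ : f₃ s ≠ 0) (h₄ : f₄ s ≠ 0) (h₅ : f₅ s ≠ 0) (d₁ : DifferentiableAt ℂ f₁ s)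
    (d₂ : DifferentiableAt ℂ f₂ s) (d₃ : DifferentiableAt ℂ f₃ s) (d₄ : DifferentiableAt ℂ f₄ s)
    (d₅ : DifferentiableAt ℂ f₅ s) :
    logDeriv (fun z => f₁ z * f₂ z * f₃ z * f₄ z * f₅ z) s =
      logDeriv f₁ s + logDeriv f₂ s + logDeriv f₃ s + logDeriv f₄ s + logDeriv f₅ s := by
  rw [logDeriv_mul s (f := fun z => f₁ z * f₂ z * f₃ z * f₄ z) (by simp [*]) h₅
      (((d₁.mul d₂).mul d₃).mul d₄) d₅,
    logDeriv_mul s (f := fun z => f₁ z * f₂ z * f₃ z) (by simp [*]) h₄ ((d₁.mul d₂).mul d₃) d₄,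
    logDeriv_mul s (f := fun z => f₁ z * f₂ z) (by simp [*]) h₃ (d₁.mul d₂) d₃,
    logDeriv_mul s h₁ h₂ d₁ d₂]

namespace SSF

variable {σ0 σ1 : ℝ} (S : SSF σ0 σ1)

/-- The points at which the defining formula for the completed function applies. -/
def Regular (s : ℂ) : Prop :=
  (∀ i, s ≠ S.pole i) ∧ ∀ (j : Fin S.r) (k : ℕ), (S.lam j : ℂ) * s + S.mu j ≠ -(k : ℂ)

/-- The logarithmic derivative of the completed function, apart from the terms coming from
`F'/F` and from the poles of `F`. -/
def archTerm (s : ℂ) : ℂ :=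
  (Real.log S.Q : ℂ) + (∑ j, (S.lam j : ℂ) * Complex.digamma ((S.lam j : ℂ) * s + S.mu j)) +
    ∑ i ∈ Finset.univ.filter (fun i : Fin S.N => 2 * S.M + S.dlt ≤ (i : ℕ)),
      (S.m i : ℂ) / (s - ((σ1 : ℂ) - (starRingEnd ℂ) (S.pole i)))

variable {S}

theorem eventually_gamma {s : ℂ}
    (hs : ∀ (j : Fin S.r) (k : ℕ), (S.lam j : ℂ) * s + S.mu j ≠ -(k : ℂ)) :
    ∀ᶠ z in nhds s, ∀ (j : Fin S.r) (k : ℕ), (S.lam j : ℂ) * z + S.mu j ≠ -(k : ℂ) := by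
  rw [eventually_all]
  intro j
  have hc : ContinuousAt (fun z : ℂ => (S.lam j : ℂ) * z + S.mu j) s := by fun_prop
  exact hc.tendsto.eventually (eventually_gamma_arg_ne (hs j))

theorem eventually_ne_pole {s : ℂ} (hs : ∀ i, s ≠ S.pole i) :
    ∀ᶠ z in nhds s, ∀ i, z ≠ S.pole i := by
  rw [eventually_all]
  exact fun i => eventually_ne_nhds (hs i)

theorem Regular.eventually {s : ℂ} (hs : S.Regular s) : ∀ᶠ z in nhds s, S.Regular z :=
  (eventually_ne_pole hs.1).and (eventually_gamma hs.2)

theorem analyticAt_F {s : ℂ} (hs : ∀ i, s ≠ S.pole i) : AnalyticAt ℂ S.F s := by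
  have h1 : AnalyticAt ℂ (fun z => S.G z / ∏ i, (z - S.pole i) ^ S.m i) s := by
    refine (S.hGdiff.analyticAt s).div ?_ ?_
    · exact Differentiable.analyticAt (by fun_prop) s
    · exact Finset.prod_ne_zero_iff.2 fun i _ => pow_ne_zero _ (sub_ne_zero.2 (hs i))
  refine h1.congr ?_
  filter_upwards [eventually_ne_pole hs] with z hz
  rw [S.hGF z hz, mul_div_cancel_left₀]
  exact Finset.prod_ne_zero_iff.2 fun i _ => pow_ne_zero _ (sub_ne_zero.2 (hz i))

/-- The logarithmic derivative of the completed function. -/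
theorem logDeriv_xi {s : ℂ} (hs : S.Regular s) (hx : S.xi s ≠ 0) :
    logDeriv S.xi s = deriv S.F s / S.F s + (∑ i, (S.m i : ℂ) / (s - S.pole i)) +
      S.archTerm s := by
  have heq : S.xi =ᶠ[nhds s] fun s => S.F s * (S.Q : ℂ) ^ s *
      (∏ j, Complex.Gamma ((S.lam j : ℂ) * s + S.mu j)) * (∏ i, (s - S.pole i) ^ S.m i) *
      ∏ i : Fin S.N, (if 2 * S.M + S.dlt ≤ (i : ℕ) then
        ((σ1 : ℂ) - s - (starRingEnd ℂ) (S.pole i)) ^ S.m i else 1) := by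
    filter_upwards [hs.eventually] with z hz
    exact S.hxiEq z hz.1 hz.2
  have hx2 := hx
  rw [heq.eq_of_nhds] at hx2
  obtain ⟨h1, h5⟩ := mul_ne_zero_iff.1 hx2
  obtain ⟨h1, h4⟩ := mul_ne_zero_iff.1 h1
  obtain ⟨h1, h3⟩ := mul_ne_zero_iff.1 h1
  obtain ⟨h1, h2⟩ := mul_ne_zero_iff.1 h1
  have hQ : (S.Q : ℂ) ≠ 0 := by exact_mod_cast S.hQ.ne'
  have d1 : DifferentiableAt ℂ S.F s := (analyticAt_F hs.1).differentiableAt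
  have d2' : HasDerivAt (fun z : ℂ => (S.Q : ℂ) ^ z) ((S.Q : ℂ) ^ s * Complex.log S.Q) s := by
    simpa using (hasDerivAt_id s).const_cpow (Or.inl hQ)
  have d2 := d2'.differentiableAt
  have dl : ∀ j : Fin S.r, DifferentiableAt ℂ (fun z : ℂ => (S.lam j : ℂ) * z + S.mu j) s :=
    fun j => by fun_prop
  have d3' : ∀ j ∈ (Finset.univ : Finset (Fin S.r)),
      DifferentiableAt ℂ (fun z => Complex.Gamma ((S.lam j : ℂ) * z + S.mu j)) s :=
    fun j _ => DifferentiableAt.comp (g := Complex.Gamma) s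
      (Complex.differentiableAt_Gamma _ (hs.2 j)) (dl j)
  have d3 := DifferentiableAt.fun_finsetProd d3'
  have d4' : ∀ i ∈ (Finset.univ : Finset (Fin S.N)),
      DifferentiableAt ℂ (fun z => (z - S.pole i) ^ S.m i) s := fun i _ => by fun_prop
  have d4 := DifferentiableAt.fun_finsetProd d4'
  have d5' : ∀ i ∈ (Finset.univ : Finset (Fin S.N)),
      DifferentiableAt ℂ (fun z => if 2 * S.M + S.dlt ≤ (i : ℕ) then
        ((σ1 : ℂ) - z - (starRingEnd ℂ) (S.pole i)) ^ S.m i else 1) s := fun i _ => by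
    split_ifs <;> fun_prop
  have d5 := DifferentiableAt.fun_finsetProd d5'
  rw [(logDeriv_congr_nhds heq).eq_of_nhds,
    logDeriv_mul_mul_mul_mul h1 h2 h3 h4 h5 d1 d2 d3 d4 d5,
    logDeriv_prod (fun j hj => Finset.prod_ne_zero_iff.1 h3 j hj) d3',
    logDeriv_prod (fun j hj => Finset.prod_ne_zero_iff.1 h4 j hj) d4',
    logDeriv_prod (f := fun (i : Fin S.N) (z : ℂ) => if 2 * S.M + S.dlt ≤ (i : ℕ) then
        ((σ1 : ℂ) - z - (starRingEnd ℂ) (S.pole i)) ^ S.m i else 1)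
      (fun j hj => Finset.prod_ne_zero_iff.1 h5 j hj) d5']
  have e2 : logDeriv (fun z : ℂ => (S.Q : ℂ) ^ z) s = (Real.log S.Q : ℂ) := by
    rw [logDeriv_apply, d2'.deriv, mul_div_cancel_left₀ _ h2, ← Complex.ofReal_log S.hQ.le]
  have e3 : ∀ j : Fin S.r, logDeriv (fun z => Complex.Gamma ((S.lam j : ℂ) * z + S.mu j)) s =
      (S.lam j : ℂ) * Complex.digamma ((S.lam j : ℂ) * s + S.mu j) := fun j => by
    have := logDeriv_comp (f := Complex.Gamma) (g := fun z : ℂ => (S.lam j : ℂ) * z + S.mu j)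
      (x := s) (Complex.differentiableAt_Gamma _ (hs.2 j)) (dl j)
    have hd : deriv (fun z : ℂ => (S.lam j : ℂ) * z + S.mu j) s = S.lam j := by
      simp
    rw [hd, mul_comm] at this
    exact this
  have e4 : ∀ i : Fin S.N, logDeriv (fun z => (z - S.pole i) ^ S.m i) s =
      (S.m i : ℂ) / (s - S.pole i) := fun i => by
    rw [logDeriv_fun_pow (by fun_prop), logDeriv_apply]
    simp [div_eq_mul_inv]
  have e5 : ∀ i : Fin S.N, logDeriv (fun z => if 2 * S.M + S.dlt ≤ (i : ℕ) then
        ((σ1 : ℂ) - z - (starRingEnd ℂ) (S.pole i)) ^ S.m i else 1) s =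
      if 2 * S.M + S.dlt ≤ (i : ℕ) then
        (S.m i : ℂ) / (s - ((σ1 : ℂ) - (starRingEnd ℂ) (S.pole i))) else 0 := fun i => by
    split_ifs with hi
    · rw [logDeriv_fun_pow (by fun_prop), logDeriv_apply]
      have : deriv (fun z : ℂ => (σ1 : ℂ) - z - (starRingEnd ℂ) (S.pole i)) s = -1 := by
        simp
      rw [this, show (σ1 : ℂ) - s - (starRingEnd ℂ) (S.pole i) =
        -(s - ((σ1 : ℂ) - (starRingEnd ℂ) (S.pole i))) by ring, neg_div_neg_eq, mul_one_div]
    · simp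
  simp only [e2, e3, e4, e5, archTerm, Finset.sum_filter]
  rw [logDeriv_apply]
  ring

end SSF

theorem AnalyticAt.ne_zero_of_logDeriv_bounded {f : ℂ → ℂ} {z₀ : ℂ} {B : ℝ} (hf : AnalyticAt ℂ f z₀)
    (h0 : ¬ ∀ᶠ z in nhds z₀, f z = 0) (hB : ∀ᶠ z in nhds z₀, ‖logDeriv f z‖ ≤ B) : f z₀ ≠ 0 := by
  obtain ⟨n, g, hg, hg0, hfg⟩ := hf.exists_eventuallyEq_pow_smul_nonzero_iff.2 h0
  rcases Nat.eq_zero_or_pos n with rfl | hn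
  · rw [hfg.self_of_nhds]
    simpa using hg0
  exfalso
  have hsub : Tendsto (fun z => z - z₀) (nhdsWithin z₀ {z₀}ᶜ) (nhds 0) := by
    have : ContinuousAt (fun z => z - z₀) z₀ := by fun_prop
    simpa using this.tendsto.mono_left nhdsWithin_le_nhds
  have h1 : Tendsto (fun z => (z - z₀) * logDeriv f z) (nhdsWithin z₀ {z₀}ᶜ) (nhds 0) := by
    have h2 := hsub.norm.mul_const B
    simp only [norm_zero, zero_mul] at h2
    refine squeeze_zero_norm' ?_ h2
    filter_upwards [nhdsWithin_le_nhds hB] with z hz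
    rw [norm_mul]
    exact mul_le_mul_of_nonneg_left hz (norm_nonneg _)
  have hgl : AnalyticAt ℂ (logDeriv g) z₀ := hg.deriv.div hg hg0
  have h3 : Tendsto (fun z => (n : ℂ) + (z - z₀) * logDeriv g z) (nhdsWithin z₀ {z₀}ᶜ) (nhds n) := by
    have := (hsub.mul (hgl.continuousAt.tendsto.mono_left nhdsWithin_le_nhds)).const_add (n : ℂ)
    simpa using this
  have h4 : (n : ℂ) = 0 := by
    refine tendsto_nhds_unique h3 (h1.congr' ?_)
    have hd : ∀ᶠ z in nhds z₀, DifferentiableAt ℂ g z :=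
      analyticAt_iff_eventually_differentiableAt.1 hg
    filter_upwards [nhdsWithin_le_nhds hfg.eventually_nhds,
      nhdsWithin_le_nhds (hg.continuousAt.eventually_ne hg0), nhdsWithin_le_nhds hd,
      self_mem_nhdsWithin] with z hz hgz hdz hne
    have hne : z - z₀ ≠ 0 := sub_ne_zero.2 hne
    have hz' : f =ᶠ[nhds z] fun z => (z - z₀) ^ n * g z := hz
    rw [(logDeriv_congr_nhds hz').eq_of_nhds, logDeriv_mul z (f := fun z => (z - z₀) ^ n) (pow_ne_zero n hne) hgz (by fun_prop)
      hdz, logDeriv_fun_pow (by fun_prop), logDeriv_apply]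
    simp
    field_simp
  exact hn.ne' (by exact_mod_cast h4)

namespace SSF

variable {σ0 σ1 : ℝ}

/-- The half-plane `A ≤ Re s` lies to the right of everything relevant. -/
structure IsRightBound (S : SSF σ0 σ1) (A : ℝ) : Prop where
  lt : σ0 < A
  half_le : σ1 / 2 + 1 ≤ A
  pole_le : ∀ i, (S.pole i).re + 1 ≤ A
  mirror_le : ∀ i, σ1 - (S.pole i).re + 1 ≤ A
  gamma_le : ∀ j, 3 ≤ S.lam j * A + (S.mu j).re

theorem exists_isRightBound (S : SSF σ0 σ1) : ∃ A, S.IsRightBound A := by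
  have h : ∀ᶠ A : ℝ in atTop, σ0 < A ∧ σ1 / 2 + 1 ≤ A ∧ (∀ i, (S.pole i).re + 1 ≤ A) ∧
      (∀ i, σ1 - (S.pole i).re + 1 ≤ A) ∧ ∀ j, 3 ≤ S.lam j * A + (S.mu j).re := by
    refine (eventually_gt_atTop _).and ((eventually_ge_atTop _).and
      ((eventually_all.2 fun i => eventually_ge_atTop _).and
      ((eventually_all.2 fun i => eventually_ge_atTop _).and (eventually_all.2 fun j => ?_))))
    exact (tendsto_atTop_add_const_right _ _
      (tendsto_id.const_mul_atTop (S.hlam j))).eventually_ge_atTop 3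
  obtain ⟨A, h1, h2, h3, h4, h5⟩ := h.exists
  exact ⟨A, h1, h2, h3, h4, h5⟩

theorem exists_norm_logDeriv_F_le (S : SSF σ0 σ1) {A : ℝ} (hA : σ0 < A) :
    ∃ B : ℝ, 0 ≤ B ∧ ∀ s : ℂ, A ≤ s.re →
      ‖deriv S.F s / S.F s‖ ≤ B * (2 : ℝ) ^ (-(s.re - A)) := by
  have hsum := S.hEulerAbs A (by simpa using hA)
  refine ⟨∑' n : ℕ, ‖S.c (n + 2) * ((n + 2 : ℕ) : ℂ) ^ (-(A : ℂ))‖,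
    tsum_nonneg fun n => norm_nonneg _, fun s hs => ?_⟩
  rw [← norm_neg]
  refine (S.hEuler s (hA.trans_le hs)).norm_le_of_bounded
    (hsum.hasSum.mul_right ((2 : ℝ) ^ (-(s.re - A)))) fun n => ?_
  have hn : (0 : ℝ) < ((n + 2 : ℕ) : ℝ) := by positivity
  have hn' : ((n + 2 : ℕ) : ℂ) = (((n + 2 : ℕ) : ℝ) : ℂ) := by push_cast; rfl
  rw [norm_mul, norm_mul, mul_assoc, hn', norm_cpow_eq_rpow_re_of_pos hn,
    norm_cpow_eq_rpow_re_of_pos hn]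
  refine mul_le_mul_of_nonneg_left ?_ (norm_nonneg _)
  have h1 : (-s).re = (-(A : ℂ)).re + -(s.re - A) := by simp; ring
  rw [h1, Real.rpow_add hn]
  refine mul_le_mul_of_nonneg_left ?_ (by positivity)
  refine Real.rpow_le_rpow_of_nonpos two_pos ?_ (by linarith)
  push_cast
  have : (0 : ℝ) ≤ n := n.cast_nonneg
  linarith

namespace IsRightBound

variable {S : SSF σ0 σ1} {A : ℝ}

theorem three_le_gamma_re (h : S.IsRightBound A) {s : ℂ} (hs : A ≤ s.re) (j : Fin S.r) :
    3 ≤ ((S.lam j : ℂ) * s + S.mu j).re := by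
  have h1 := h.gamma_le j
  have h2 := mul_le_mul_of_nonneg_left hs (S.hlam j).le
  simp only [add_re, re_ofReal_mul]
  linarith

theorem one_le_norm_sub_pole (h : S.IsRightBound A) {s : ℂ} (hs : A ≤ s.re) (i : Fin S.N) : 1 ≤ ‖s - S.pole i‖ := by
  refine le_trans ?_ (re_le_norm _)
  have := h.pole_le i
  simp only [sub_re]
  linarith

theorem one_le_norm_sub_mirror (h : S.IsRightBound A) {s : ℂ} (hs : A ≤ s.re) (i : Fin S.N) :
    1 ≤ ‖s - ((σ1 : ℂ) - (starRingEnd ℂ) (S.pole i))‖ := by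
  refine le_trans ?_ (re_le_norm _)
  have := h.mirror_le i
  simp only [sub_re, ofReal_re, conj_re]
  linarith

theorem regular (h : S.IsRightBound A) {s : ℂ} (hs : A ≤ s.re) : S.Regular s := by
  refine ⟨fun i hi => ?_, fun j k hk => ?_⟩
  · have := h.one_le_norm_sub_pole hs i
    rw [hi] at this
    norm_num at this
  · have := h.three_le_gamma_re hs j
    have hk0 : (0 : ℝ) ≤ k := k.cast_nonneg
    rw [hk] at this
    simp at this
    linarith

theorem F_ne_zero (h : S.IsRightBound A) (h0 : S.xi 0 ≠ 0) {s : ℂ} (hs : A ≤ s.re) : S.F s ≠ 0 := by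
  obtain ⟨B, hB, hb⟩ := S.exists_norm_logDeriv_F_le (A := (σ0 + A) / 2) (by linarith [h.lt])
  have hr := h.regular hs
  refine AnalyticAt.ne_zero_of_logDeriv_bounded (B := B) (analyticAt_F hr.1) (fun hF => ?_) ?_
  · have h1 : S.xi =ᶠ[nhds s] 0 := by
      filter_upwards [hF, hr.eventually] with z hz hzr
      rw [S.hxiEq z hzr.1 hzr.2, hz]
      simp
    have h2 : AnalyticOnNhd ℂ S.xi Set.univ := fun z _ => S.hxiDiff.analyticAt z
    exact h0 (h2.eqOn_zero_of_preconnected_of_eventuallyEq_zero isPreconnected_univ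
      (Set.mem_univ s) h1 (Set.mem_univ 0))
  · have hlt : (σ0 + A) / 2 < s.re := by linarith [h.lt]
    filter_upwards [continuous_re.continuousAt.eventually (lt_mem_nhds hlt)] with z hz
    refine (hb z hz.le).trans ?_
    have : (2 : ℝ) ^ (-(z.re - (σ0 + A) / 2)) ≤ 1 :=
      Real.rpow_le_one_of_one_le_of_nonpos one_le_two (by linarith)
    nlinarith

theorem xi_ne_zero (h : S.IsRightBound A) (h0 : S.xi 0 ≠ 0) {s : ℂ} (hs : A ≤ s.re) : S.xi s ≠ 0 := by
  have hr := h.regular hs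
  rw [S.hxiEq s hr.1 hr.2]
  have hQ : (S.Q : ℂ) ≠ 0 := by exact_mod_cast S.hQ.ne'
  refine mul_ne_zero (mul_ne_zero (mul_ne_zero (mul_ne_zero (h.F_ne_zero h0 hs) ?_) ?_) ?_) ?_
  · simp [cpow_eq_zero_iff, hQ]
  · exact Finset.prod_ne_zero_iff.2 fun j _ => Complex.Gamma_ne_zero (hr.2 j)
  · exact Finset.prod_ne_zero_iff.2 fun i _ => pow_ne_zero _ (sub_ne_zero.2 (hr.1 i))
  · refine Finset.prod_ne_zero_iff.2 fun i _ => ?_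
    split_ifs
    · refine pow_ne_zero _ fun hi => ?_
      have := h.one_le_norm_sub_mirror hs i
      rw [show s - ((σ1 : ℂ) - (starRingEnd ℂ) (S.pole i)) =
        -((σ1 : ℂ) - s - (starRingEnd ℂ) (S.pole i)) by ring, hi] at this
      norm_num at this
    · exact one_ne_zero

end IsRightBound

end SSF

theorem norm_digamma_sub_log_le_one {w : ℂ} (hw : 3 ≤ w.re) :
    ‖Complex.digamma w - Complex.log w‖ ≤ 1 := by
  refine (norm_digamma_sub_log_le (by linarith)).trans ?_
  rw [div_le_one (by linarith)]
  linarith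

theorem abs_im_digamma_le {w : ℂ} (hw : 3 ≤ w.re) :
    |(Complex.digamma w).im| ≤ Real.pi + 1 := by
  have h1 := (abs_im_le_norm _).trans (norm_digamma_sub_log_le_one hw)
  have h2 := abs_arg_le_pi w
  rw [sub_im, log_im] at h1
  rw [abs_le] at *
  constructor <;> linarith [h1.1, h1.2, h2.1, h2.2]

theorem norm_digamma_le {w : ℂ} (hw : 3 ≤ w.re) :
    ‖Complex.digamma w‖ ≤ Real.log ‖w‖ + Real.pi + 1 := by
  have h1 := norm_digamma_sub_log_le_one hw
  have h2 : ‖Complex.log w‖ ≤ Real.log ‖w‖ + Real.pi := by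
    refine (norm_le_abs_re_add_abs_im _).trans ?_
    rw [log_re, log_im, abs_of_nonneg (Real.log_nonneg (by linarith [re_le_norm w]))]
    gcongr
    exact abs_arg_le_pi w
  have h3 := norm_le_norm_add_norm_sub' (Complex.digamma w) (Complex.log w)
  linarith

theorem norm_digamma_affine_le {l : ℝ} (hl : 0 < l) (u s : ℂ) (hw : 3 ≤ ((l : ℂ) * s + u).re) :
    ‖Complex.digamma ((l : ℂ) * s + u)‖ ≤
      (|Real.log (l + ‖u‖)| + Real.pi + 1) * (1 + Real.log (1 + ‖s‖)) := by
  have hs := norm_nonneg s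
  have hu := norm_nonneg u
  have h1 : ‖(l : ℂ) * s + u‖ ≤ (l + ‖u‖) * (1 + ‖s‖) := by
    refine (norm_add_le _ _).trans ?_
    rw [norm_mul, norm_real, Real.norm_eq_abs, abs_of_pos hl]
    nlinarith [mul_nonneg hs hu]
  have h0 : 0 < ‖(l : ℂ) * s + u‖ := by linarith [re_le_norm ((l : ℂ) * s + u)]
  have h2 := Real.log_le_log h0 h1
  rw [Real.log_mul (by positivity) (by positivity)] at h2
  have h3 : 0 ≤ Real.log (1 + ‖s‖) := Real.log_nonneg (by linarith)
  have h4 := norm_digamma_le hw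
  have h5 := le_abs_self (Real.log (l + ‖u‖))
  have h6 := abs_nonneg (Real.log (l + ‖u‖))
  have := Real.pi_pos
  nlinarith [mul_nonneg h6 h3, mul_nonneg this.le h3]

theorem tendsto_circleMap_re (c : ℝ) {θ : ℝ} (hθ : |θ| < Real.pi / 2) :
    Tendsto (fun R : ℝ => (circleMap c R θ).re) atTop atTop := by
  have hcos : 0 < Real.cos θ := Real.cos_pos_of_mem_Ioo ⟨by linarith [(abs_lt.1 hθ).1],
    by linarith [(abs_lt.1 hθ).2]⟩
  have : ∀ R : ℝ, (circleMap c R θ).re = c + R * Real.cos θ := fun R => by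
    rw [circleMap, add_re, ofReal_re, re_ofReal_mul, exp_ofReal_mul_I_re]
  simp only [this]
  exact tendsto_atTop_add_const_left _ _ (tendsto_id.atTop_mul_const hcos)

theorem tendsto_im_digamma_circleMap {l : ℝ} (hl : 0 < l) (u : ℂ) (c : ℝ) {θ : ℝ}
    (hθ : |θ| < Real.pi / 2) :
    Tendsto (fun R : ℝ => (Complex.digamma ((l : ℂ) * circleMap c R θ + u)).im) atTop
      (nhds θ) := by
  have hre : Tendsto (fun R : ℝ => ((l : ℂ) * circleMap c R θ + u).re) atTop atTop := by
    simp only [add_re, re_ofReal_mul]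
    exact tendsto_atTop_add_const_right _ _
      ((tendsto_circleMap_re c hθ).const_mul_atTop hl)
  have h1 : Tendsto (fun R : ℝ => (Complex.digamma ((l : ℂ) * circleMap c R θ + u) -
      Complex.log ((l : ℂ) * circleMap c R θ + u)).im) atTop (nhds 0) := by
    refine squeeze_zero_norm' (a := fun R : ℝ => 1 / (((l : ℂ) * circleMap c R θ + u).re - 1)) ?_ ?_
    · filter_upwards [hre.eventually_gt_atTop 2] with R hR
      exact (abs_im_le_norm _).trans (norm_digamma_sub_log_le hR)
    · have := (tendsto_atTop_add_const_right _ (-1) hre).inv_tendsto_atTop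
      refine this.congr fun R => ?_
      simp [Pi.inv_apply, sub_eq_add_neg]
  have h2 : Tendsto (fun R : ℝ => (Complex.log ((l : ℂ) * circleMap c R θ + u)).im) atTop
      (nhds θ) := by
    have hpi := Real.pi_pos
    have harg : arg ((l : ℂ) * exp (θ * I)) = θ := by
      rw [arg_real_mul _ hl, arg_exp_mul_I, toIocMod_eq_self]
      constructor <;> linarith [(abs_lt.1 hθ).1, (abs_lt.1 hθ).2]
    have hslit : (l : ℂ) * exp (θ * I) ∈ slitPlane := by
      left
      rw [re_ofReal_mul, exp_ofReal_mul_I_re]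
      exact mul_pos hl (Real.cos_pos_of_mem_Ioo ⟨by linarith [(abs_lt.1 hθ).1],
        by linarith [(abs_lt.1 hθ).2]⟩)
    have hinv : Tendsto (fun R : ℝ => (R : ℂ)⁻¹) atTop (nhds 0) := by
      have := (Complex.continuous_ofReal.tendsto 0).comp (tendsto_inv_atTop_zero (𝕜 := ℝ))
      simpa [Function.comp_def] using this
    have hlim : Tendsto (fun R : ℝ => (l : ℂ) * exp (θ * I) + (l * c + u) * (R : ℂ)⁻¹) atTop
        (nhds ((l : ℂ) * exp (θ * I))) := by
      simpa using (hinv.const_mul (l * c + u)).const_add ((l : ℂ) * exp (θ * I))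
    have h3 := (continuousAt_arg hslit).tendsto.comp hlim
    rw [harg] at h3
    refine h3.congr' ?_
    filter_upwards [eventually_gt_atTop 0] with R hR
    have hR' : (R : ℂ) ≠ 0 := by exact_mod_cast hR.ne'
    rw [log_im, Function.comp_apply, ← arg_real_mul _ hR, circleMap]
    congr 1
    field_simp
    ring
  have := h1.add h2
  simpa using this

namespace SSF

variable {σ0 σ1 : ℝ}

/-- The part of the logarithmic derivative of the completed function that decays to the right. -/
def decayTerm (S : SSF σ0 σ1) (s : ℂ) : ℂ :=
  deriv S.F s / S.F s + (∑ i, (S.m i : ℂ) / (s - S.pole i)) +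
    ∑ i ∈ Finset.univ.filter (fun i : Fin S.N => 2 * S.M + S.dlt ≤ (i : ℕ)),
      (S.m i : ℂ) / (s - ((σ1 : ℂ) - (starRingEnd ℂ) (S.pole i)))

namespace IsRightBound

variable {S : SSF σ0 σ1} {A : ℝ}

theorem logDeriv_xi_eq (h : S.IsRightBound A) (h0 : S.xi 0 ≠ 0) {s : ℂ} (hs : A ≤ s.re) :
    logDeriv S.xi s = S.decayTerm s + (Real.log S.Q : ℂ) +
      ∑ j, (S.lam j : ℂ) * Complex.digamma ((S.lam j : ℂ) * s + S.mu j) := by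
  rw [logDeriv_xi (h.regular hs) (h.xi_ne_zero h0 hs), archTerm, decayTerm]
  ring

theorem exists_norm_decayTerm_le (h : S.IsRightBound A) : ∃ K : ℝ, 0 ≤ K ∧ ∀ s : ℂ, A ≤ s.re → ‖S.decayTerm s‖ ≤ K := by
  obtain ⟨B, hB, hb⟩ := S.exists_norm_logDeriv_F_le h.lt
  refine ⟨B + (∑ i, (S.m i : ℝ)) +
    ∑ i ∈ Finset.univ.filter (fun i : Fin S.N => 2 * S.M + S.dlt ≤ (i : ℕ)), (S.m i : ℝ),
    by positivity, fun s hs => ?_⟩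
  refine norm_add₃_le.trans ?_
  gcongr
  · refine (hb s hs).trans ?_
    have : (2 : ℝ) ^ (-(s.re - A)) ≤ 1 :=
      Real.rpow_le_one_of_one_le_of_nonpos one_le_two (by linarith)
    nlinarith
  · refine norm_sum_le_of_le _ fun i _ => ?_
    rw [norm_div, norm_natCast]
    exact div_le_self (Nat.cast_nonneg _) (h.one_le_norm_sub_pole hs i)
  · refine norm_sum_le_of_le _ fun i _ => ?_
    rw [norm_div, norm_natCast]
    exact div_le_self (Nat.cast_nonneg _) (h.one_le_norm_sub_mirror hs i)

theorem tendsto_decayTerm (h : S.IsRightBound A) {u : ℝ → ℂ} (hu : Tendsto (fun R => (u R).re) atTop atTop) :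
    Tendsto (fun R => S.decayTerm (u R)) atTop (nhds 0) := by
  obtain ⟨B, hB, hb⟩ := S.exists_norm_logDeriv_F_le h.lt
  have hnorm : ∀ p : ℂ, Tendsto (fun R => ‖u R - p‖) atTop atTop := fun p =>
    tendsto_atTop_mono (fun R => by simpa using re_le_norm (u R - p))
      (tendsto_atTop_add_const_right _ (-p.re) hu)
  have hinv : ∀ (a p : ℂ), Tendsto (fun R => a / (u R - p)) atTop (nhds 0) := fun a p => by
    have := (tendsto_inv₀_cobounded (α := ℂ)).comp (tendsto_norm_atTop_iff_cobounded.1 (hnorm p))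
    simpa [div_eq_mul_inv, Function.comp_def] using this.const_mul a
  have h1 : Tendsto (fun R => deriv S.F (u R) / S.F (u R)) atTop (nhds 0) := by
    have h2 : Tendsto (fun R => B * (2 : ℝ) ^ (-((u R).re - A))) atTop (nhds 0) := by
      have h3 := (tendsto_rpow_atBot_of_base_gt_one (2 : ℝ) one_lt_two).comp
        (tendsto_neg_atTop_atBot.comp (tendsto_atTop_add_const_right _ (-A) hu))
      simpa [Function.comp_def, sub_eq_add_neg] using h3.const_mul B
    refine squeeze_zero_norm' ?_ h2
    filter_upwards [hu.eventually_ge_atTop A] with R hR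
    exact hb _ hR
  have h4 := tendsto_finsetSum Finset.univ fun i (_ : i ∈ Finset.univ) =>
    hinv (S.m i : ℂ) (S.pole i)
  have h5 := tendsto_finsetSum
    (Finset.univ.filter (fun i : Fin S.N => 2 * S.M + S.dlt ≤ (i : ℕ)))
    fun i _ => hinv (S.m i : ℂ) ((σ1 : ℂ) - (starRingEnd ℂ) (S.pole i))
  simpa [decayTerm] using (h1.add h4).add h5

theorem exists_bounds (h : S.IsRightBound A) (h0 : S.xi 0 ≠ 0) : ∃ C : ℝ, 0 < C ∧
    (∀ s : ℂ, A ≤ s.re → ‖logDeriv S.xi s‖ ≤ C * (1 + Real.log (1 + ‖s‖))) ∧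
    ∀ s : ℂ, A ≤ s.re → |(logDeriv S.xi s).im| ≤ C := by
  obtain ⟨K, hK, hk⟩ := h.exists_norm_decayTerm_le
  have hlam := fun j => (S.hlam j).le
  set C₁ := ∑ j, S.lam j * (|Real.log (S.lam j + ‖S.mu j‖)| + Real.pi + 1) with hC₁
  set C₂ := ∑ j, S.lam j * (Real.pi + 1) with hC₂
  have hpi := Real.pi_pos
  have hC₁0 : 0 ≤ C₁ := Finset.sum_nonneg fun j _ => mul_nonneg (hlam j) (by positivity)
  have hC₂0 : 0 ≤ C₂ := Finset.sum_nonneg fun j _ => mul_nonneg (hlam j) (by positivity)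
  have hlq := abs_nonneg (Real.log S.Q)
  refine ⟨K + |Real.log S.Q| + C₁ + C₂ + 1, by positivity, fun s hs => ?_, fun s hs => ?_⟩
  · rw [h.logDeriv_xi_eq h0 hs]
    refine norm_add₃_le.trans ?_
    have hL : 0 ≤ Real.log (1 + ‖s‖) := Real.log_nonneg (by linarith [norm_nonneg s])
    have h1 : ‖∑ j, (S.lam j : ℂ) * Complex.digamma ((S.lam j : ℂ) * s + S.mu j)‖ ≤
        C₁ * (1 + Real.log (1 + ‖s‖)) := by
      rw [hC₁, Finset.sum_mul]
      refine norm_sum_le_of_le _ fun j _ => ?_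
      rw [norm_mul, norm_real, Real.norm_eq_abs, abs_of_pos (S.hlam j), mul_assoc]
      exact mul_le_mul_of_nonneg_left
        (norm_digamma_affine_le (S.hlam j) _ _ (h.three_le_gamma_re hs j)) (hlam j)
    have h2 := hk s hs
    rw [norm_real, Real.norm_eq_abs]
    nlinarith [mul_nonneg hK hL, mul_nonneg hlq hL, mul_nonneg hC₂0 hL]
  · rw [h.logDeriv_xi_eq h0 hs, add_im, add_im, ofReal_im, add_zero, im_sum]
    refine (abs_add_le _ _).trans ?_
    have h1 : |∑ j, ((S.lam j : ℂ) * Complex.digamma ((S.lam j : ℂ) * s + S.mu j)).im| ≤ C₂ := by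
      refine (Finset.abs_sum_le_sum_abs _ _).trans (Finset.sum_le_sum fun j _ => ?_)
      rw [im_ofReal_mul, abs_mul, abs_of_pos (S.hlam j)]
      exact mul_le_mul_of_nonneg_left (abs_im_digamma_le (h.three_le_gamma_re hs j)) (hlam j)
    have h2 := (abs_im_le_norm _).trans (hk s hs)
    linarith

theorem tendsto_im_logDeriv_xi (h : S.IsRightBound A) (h0 : S.xi 0 ≠ 0) {θ : ℝ} (hθ : |θ| < Real.pi / 2) :
    Tendsto (fun R : ℝ => (logDeriv S.xi (circleMap (σ1 / 2) R θ)).im) atTop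
      (nhds ((∑ j, S.lam j) * θ)) := by
  have hc : (σ1 / 2 : ℂ) = ((σ1 / 2 : ℝ) : ℂ) := by push_cast; rfl
  rw [hc]
  have hu := tendsto_circleMap_re (σ1 / 2) hθ
  have h1 : Tendsto (fun R : ℝ => (S.decayTerm (circleMap (σ1 / 2 : ℝ) R θ)).im) atTop (nhds 0) := by
    have := (continuous_im.tendsto 0).comp (h.tendsto_decayTerm hu)
    simpa [Function.comp_def] using this
  have h2 := tendsto_finsetSum Finset.univ fun j (_ : j ∈ Finset.univ) =>
    (tendsto_im_digamma_circleMap (S.hlam j) (S.mu j) (σ1 / 2) hθ).const_mul (S.lam j)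
  have h3 := h1.add h2
  rw [zero_add, ← Finset.sum_mul] at h3
  refine h3.congr' ?_
  filter_upwards [hu.eventually_ge_atTop A] with R hR
  rw [h.logDeriv_xi_eq h0 hR, add_im, add_im, ofReal_im, add_zero, im_sum]
  simp only [im_ofReal_mul]

end IsRightBound

end SSF

theorem norm_Gamma_le_Gamma_re {w : ℂ} (hw : 0 < w.re) : ‖Complex.Gamma w‖ ≤ Real.Gamma w.re := by
  rw [Complex.Gamma_eq_integral hw, Complex.GammaIntegral, Real.Gamma_eq_integral hw]
  refine (norm_integral_le_integral_norm _).trans (le_of_eq ?_)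
  refine setIntegral_congr_fun measurableSet_Ioi fun x hx => ?_
  have hx : 0 < x := hx
  simp only [norm_mul, norm_real, Real.norm_eq_abs, Real.abs_exp]
  rw [norm_cpow_eq_rpow_re_of_pos hx, sub_re, one_re]

theorem norm_Gamma_le_norm_Gamma_add_nat {w : ℂ} (hw : 1 ≤ |w.im|) (k : ℕ) :
    ‖Complex.Gamma w‖ ≤ ‖Complex.Gamma (w + k)‖ := by
  induction k with
  | zero => simp
  | succ k ih =>
    have him : (w + k).im = w.im := by simp
    have h1 : 1 ≤ ‖w + k‖ := by
      have := abs_im_le_norm (w + k)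
      rw [him] at this
      exact hw.trans this
    have h0 : w + k ≠ 0 := fun h => by rw [h] at h1; norm_num at h1
    push_cast
    rw [← add_assoc, Complex.Gamma_add_one _ h0, norm_mul]
    nlinarith [norm_nonneg (Complex.Gamma (w + k))]

theorem exists_norm_Gamma_le_of_strip (α β : ℝ) : ∃ C : ℝ, ∀ w : ℂ, α ≤ w.re → w.re ≤ β →
    1 ≤ |w.im| → ‖Complex.Gamma w‖ ≤ C := by
  obtain ⟨k, hk⟩ := exists_nat_ge (1 - α)
  have hc : ContinuousOn Real.Gamma (Set.Icc 1 (β + k)) := fun x hx => by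
    refine (Real.differentiableAt_Gamma fun m => ?_).continuousAt.continuousWithinAt
    have : (0 : ℝ) ≤ m := m.cast_nonneg
    linarith [hx.1]
  obtain ⟨C, hC⟩ := isCompact_Icc.exists_bound_of_continuousOn hc
  refine ⟨C, fun w h1 h2 h3 => ?_⟩
  have hre : (w + k).re = w.re + k := by simp
  refine (norm_Gamma_le_norm_Gamma_add_nat h3 k).trans ?_
  refine (norm_Gamma_le_Gamma_re (by rw [hre]; linarith)).trans ?_
  rw [hre]
  exact (le_abs_self _).trans (hC _ ⟨by linarith, by linarith⟩)

/-- Both ends of the vertical strip `a < Re z < b`. -/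
abbrev stripEnds (a b : ℝ) : Filter ℂ :=
  comap (_root_.abs ∘ im) atTop ⊓ Filter.principal (re ⁻¹' Set.Ioo a b)

theorem eventually_stripEnds_im (a b c : ℝ) : ∀ᶠ z in stripEnds a b, c ≤ |z.im| :=
  mem_inf_of_left ((eventually_ge_atTop c).comap (_root_.abs ∘ im))

theorem eventually_stripEnds_re (a b : ℝ) : ∀ᶠ z in stripEnds a b, z.re ∈ Set.Ioo a b :=
  mem_inf_of_right (mem_principal_self _)

theorem eventually_stripEnds_norm_le (a b : ℝ) : ∀ᶠ z in stripEnds a b, ‖z‖ ≤ 2 * |z.im| := by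
  filter_upwards [eventually_stripEnds_im a b (|a| + |b|), eventually_stripEnds_re a b]
    with z hz hr
  have h1 := norm_le_abs_re_add_abs_im z
  have h2 : |z.re| ≤ |a| + |b| := by
    rw [abs_le]
    constructor <;> linarith [neg_abs_le a, le_abs_self b, abs_nonneg a, abs_nonneg b, hr.1, hr.2]
  linarith

/-- Functions of finite order at the ends of the vertical strip `a < Re z < b`. -/
def FiniteOrderInStrip (a b : ℝ) (f : ℂ → ℂ) : Prop :=
  ∃ (K : ℝ) (p : ℕ), 0 ≤ K ∧ ∀ᶠ z in stripEnds a b, ‖f z‖ ≤ Real.exp (K * |z.im| ^ p)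

namespace FiniteOrderInStrip

variable {a b : ℝ} {f g : ℂ → ℂ}

theorem of_bound (C : ℝ) (hC : ∀ᶠ z in stripEnds a b, ‖f z‖ ≤ C) : FiniteOrderInStrip a b f := by
  refine ⟨|C|, 0, abs_nonneg _, hC.mono fun z hz => ?_⟩
  have := Real.add_one_le_exp |C|
  have := le_abs_self C
  rw [pow_zero, mul_one]
  linarith

theorem congr (hf : FiniteOrderInStrip a b f) (h : ∀ᶠ z in stripEnds a b, g z = f z) :
    FiniteOrderInStrip a b g := by
  obtain ⟨K, p, hK, hp⟩ := hf
  refine ⟨K, p, hK, ?_⟩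
  filter_upwards [hp, h] with z h1 h2
  rwa [h2]

theorem mul (hf : FiniteOrderInStrip a b f) (hg : FiniteOrderInStrip a b g) :
    FiniteOrderInStrip a b fun z => f z * g z := by
  obtain ⟨K, p, hK, hp⟩ := hf
  obtain ⟨L, q, hL, hq⟩ := hg
  refine ⟨K + L, p + q, by positivity, ?_⟩
  filter_upwards [hp, hq, eventually_stripEnds_im a b 1] with z h1 h2 h3
  rw [norm_mul]
  refine (mul_le_mul h1 h2 (norm_nonneg _) (Real.exp_pos _).le).trans ?_
  rw [← Real.exp_add, Real.exp_le_exp, add_mul]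
  gcongr
  · omega
  · omega

theorem prod {ι : Type*} (s : Finset ι) {f : ι → ℂ → ℂ}
    (hf : ∀ i ∈ s, FiniteOrderInStrip a b (f i)) : FiniteOrderInStrip a b fun z => ∏ i ∈ s, f i z := by
  classical
  induction s using Finset.induction_on with
  | empty => exact of_bound 1 (by simp)
  | insert i s hi ih =>
    have := (hf i (Finset.mem_insert_self i s)).mul
      (ih fun j hj => hf j (Finset.mem_insert_of_mem hj))
    simpa only [Finset.prod_insert hi] using this

theorem pow (hf : FiniteOrderInStrip a b f) (k : ℕ) : FiniteOrderInStrip a b fun z => f z ^ k := by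
  simpa using prod (Finset.range k) fun _ _ => hf

theorem const_sub_sub (c d : ℂ) : FiniteOrderInStrip a b fun z => c - z - d := by
  refine ⟨2 + ‖c‖ + ‖d‖, 1, by positivity, ?_⟩
  filter_upwards [eventually_stripEnds_norm_le a b, eventually_stripEnds_im a b 1] with z h1 h2
  have h3 := Real.add_one_le_exp ((2 + ‖c‖ + ‖d‖) * |z.im| ^ 1)
  have h4 : ‖c - z - d‖ ≤ ‖c‖ + ‖z‖ + ‖d‖ :=
    (norm_sub_le _ _).trans (by gcongr; exact norm_sub_le _ _)
  rw [pow_one] at *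
  nlinarith [norm_nonneg c, norm_nonneg d]

theorem const_cpow {Q : ℝ} (hQ : 0 < Q) : FiniteOrderInStrip a b fun z => (Q : ℂ) ^ z := by
  refine ⟨|Real.log Q| * 2, 1, by positivity, ?_⟩
  filter_upwards [eventually_stripEnds_norm_le a b] with z h1
  rw [norm_cpow_eq_rpow_re_of_pos hQ, Real.rpow_def_of_pos hQ, Real.exp_le_exp, pow_one, mul_assoc]
  refine (le_abs_self _).trans ?_
  rw [abs_mul]
  exact mul_le_mul_of_nonneg_left ((abs_re_le_norm z).trans h1) (abs_nonneg _)

theorem Gamma_affine {l : ℝ} (hl : 0 < l) (u : ℂ) :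
    FiniteOrderInStrip a b fun z => Complex.Gamma ((l : ℂ) * z + u) := by
  obtain ⟨C, hC⟩ := exists_norm_Gamma_le_of_strip (l * a + u.re) (l * b + u.re)
  refine of_bound C ?_
  filter_upwards [eventually_stripEnds_re a b, eventually_stripEnds_im a b ((1 + |u.im|) / l)]
    with z h1 h2
  refine hC _ ?_ ?_ ?_
  · simp only [add_re, re_ofReal_mul]
    nlinarith [h1.1]
  · simp only [add_re, re_ofReal_mul]
    nlinarith [h1.2]
  · rw [div_le_iff₀ hl] at h2
    have h3 := abs_sub_abs_le_abs_sub (l * z.im) (-u.im)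
    rw [abs_neg, abs_mul, abs_of_pos hl, sub_neg_eq_add] at h3
    simp only [add_im, im_ofReal_mul]
    linarith

theorem of_entire {c B : ℝ} (hf : ∀ s : ℂ, ‖f s‖ ≤ c * Real.exp (‖s‖ ^ B)) :
    FiniteOrderInStrip a b f := by
  obtain ⟨p, hp⟩ := exists_nat_ge B
  refine ⟨|c| + 2 ^ p, p, by positivity, ?_⟩
  filter_upwards [eventually_stripEnds_norm_le a b, eventually_stripEnds_im a b 1] with z h1 h2
  have hz : 1 ≤ ‖z‖ := h2.trans (abs_im_le_norm z)
  have h3 : ‖z‖ ^ B ≤ 2 ^ p * |z.im| ^ p := by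
    refine (Real.rpow_le_rpow_of_exponent_le hz hp).trans ?_
    rw [Real.rpow_natCast, ← mul_pow]
    exact pow_le_pow_left₀ (norm_nonneg _) h1 p
  have h4 : c ≤ Real.exp (|c| * |z.im| ^ p) := by
    have h5 : 1 ≤ |z.im| ^ p := one_le_pow₀ h2
    have := Real.add_one_le_exp (|c| * |z.im| ^ p)
    nlinarith [le_abs_self c, abs_nonneg c]
  rw [add_mul, Real.exp_add]
  refine (hf z).trans ?_
  gcongr

theorem isBigO (hf : FiniteOrderInStrip a b f) {c : ℝ} (hc : 0 < c) :
    f =O[stripEnds a b] fun z => Real.exp (1 * Real.exp (c * |z.im|)) := by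
  obtain ⟨K, p, hK, hp⟩ := hf
  refine Asymptotics.IsBigO.of_bound 1 ?_
  have h1 : ∀ᶠ x : ℝ in atTop, K * x ^ p ≤ Real.exp (c * x) := by
    have h2 := (isLittleO_pow_exp_pos_mul_atTop p hc).bound
      (c := (K + 1)⁻¹) (by positivity)
    filter_upwards [h2, eventually_ge_atTop 0] with x hx hx0
    rw [Real.norm_eq_abs, Real.norm_eq_abs, Real.abs_exp, abs_of_nonneg (by positivity),
      inv_mul_eq_div, le_div_iff₀ (by positivity)] at hx
    have : 0 ≤ x ^ p := by positivity
    linarith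
  have h3 : ∀ᶠ z in stripEnds a b, K * |z.im| ^ p ≤ Real.exp (c * |z.im|) :=
    mem_inf_of_left (h1.comap (_root_.abs ∘ im))
  filter_upwards [hp, h3] with z h4 h5
  rw [one_mul, one_mul, Real.norm_eq_abs, Real.abs_exp]
  exact h4.trans (Real.exp_le_exp.2 h5)

end FiniteOrderInStrip

namespace SSF

variable {σ0 σ1 : ℝ}

theorem eventually_regular (S : SSF σ0 σ1) (a b : ℝ) : ∀ᶠ z in stripEnds a b, S.Regular z := by
  have h1 : ∀ i, ∀ᶠ z in stripEnds a b, z ≠ S.pole i := fun i => by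
    filter_upwards [eventually_stripEnds_im a b (|(S.pole i).im| + 1)] with z hz h
    rw [h] at hz
    linarith
  have h2 : ∀ j, ∀ᶠ z in stripEnds a b, ∀ k : ℕ, (S.lam j : ℂ) * z + S.mu j ≠ -(k : ℂ) := fun j => by
    filter_upwards [eventually_stripEnds_im a b ((1 + |(S.mu j).im|) / S.lam j)] with z hz k h
    rw [div_le_iff₀ (S.hlam j)] at hz
    have h3 := abs_sub_abs_le_abs_sub (S.lam j * z.im) (-(S.mu j).im)
    rw [abs_neg, abs_mul, abs_of_pos (S.hlam j), sub_neg_eq_add] at h3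
    have h4 := congrArg im h
    simp only [add_im, im_ofReal_mul, neg_im, natCast_im, neg_zero] at h4
    rw [h4, abs_zero] at h3
    linarith
  exact (eventually_all.2 h1).and (eventually_all.2 h2)

theorem finiteOrderInStrip_xi (S : SSF σ0 σ1) (a b : ℝ) : FiniteOrderInStrip a b S.xi := by
  obtain ⟨c, B, hG⟩ := S.hGord
  have h := (((FiniteOrderInStrip.of_entire (a := a) (b := b) hG).mul
    (FiniteOrderInStrip.const_cpow S.hQ)).mul
    (FiniteOrderInStrip.prod Finset.univ fun j _ =>
      FiniteOrderInStrip.Gamma_affine (S.hlam j) (S.mu j))).mul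
    (FiniteOrderInStrip.prod (Finset.univ.filter (fun i : Fin S.N => 2 * S.M + S.dlt ≤ (i : ℕ)))
      fun i _ => (FiniteOrderInStrip.const_sub_sub (σ1 : ℂ)
        ((starRingEnd ℂ) (S.pole i))).pow (S.m i))
  refine h.congr ?_
  filter_upwards [S.eventually_regular a b] with z hz
  rw [S.hxiEq z hz.1 hz.2, S.hGF z hz.1, Finset.prod_filter]
  ring

/-- The completed function satisfies the hypotheses needed for the summation over its zeros. -/
theorem exists_isCompletedL (S : SSF σ0 σ1) (h0 : S.xi 0 ≠ 0) :
    ∃ A d C : ℝ, IsCompletedL S.xi σ1 A d C := by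
  obtain ⟨A, hA⟩ := S.exists_isRightBound
  obtain ⟨C, hC, h1, h2⟩ := hA.exists_bounds h0
  refine ⟨A, ∑ j, S.lam j, C, S.hxiDiff, S.hσ1pos, hA.half_le, hC, ⟨S.ω, S.hω, S.hFE⟩,
    fun s hs => hA.xi_ne_zero h0 hs, h1, h2, fun θ hθ => ?_, fun a b hab => ?_⟩
  · have := hA.tendsto_im_logDeriv_xi h0 hθ
    exact this
  · have hp : 0 < Real.pi / (b - a) := div_pos Real.pi_pos (sub_pos.2 hab)
    exact ⟨Real.pi / (b - a) / 2, half_lt_self hp, 1,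
      (S.finiteOrderInStrip_xi a b).isBigO (half_pos hp)⟩

end SSF

theorem AnalyticAt.iteratedDeriv_comp_affine {f : ℂ → ℂ} {l u : ℂ} (k : ℕ) {z : ℂ}
    (hf : AnalyticAt ℂ f (l * z + u)) :
    iteratedDeriv k (fun z => f (l * z + u)) z = l ^ k * iteratedDeriv k f (l * z + u) := by
  induction k generalizing z with
  | zero => simp
  | succ k ih =>
    have hc : ContinuousAt (fun z => l * z + u) z := by fun_prop
    have h1 : iteratedDeriv k (fun z => f (l * z + u)) =ᶠ[nhds z]
        fun z => l ^ k * iteratedDeriv k f (l * z + u) :=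
      (hc.tendsto.eventually hf.eventually_analyticAt).mono fun w hw => ih hw
    have h2 : HasDerivAt (fun z => l * z + u) l z := by
      simpa using ((hasDerivAt_id z).const_mul l).add_const u
    have hk : AnalyticAt ℂ (iteratedDeriv k f) (l * z + u) := by
      rw [iteratedDeriv_eq_iterate]
      exact hf.iterated_deriv k
    have h3 := (hk.differentiableAt.hasDerivAt.comp z h2).const_mul (l ^ k)
    rw [iteratedDeriv_succ, h1.deriv_eq, iteratedDeriv_succ]
    refine h3.deriv.trans ?_
    ring

theorem liFunctional_mul_comp_affine {f : ℂ → ℂ} {l u τ : ℂ} (n : ℕ)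
    (hf : AnalyticAt ℂ f (l * τ + u)) :
    liFunctional n τ (fun z => l * f (l * z + u)) = ∑ k ∈ Finset.Icc 1 n, (n.choose k : ℂ) *
      (τ ^ k / ((k - 1).factorial : ℂ)) * (l ^ k * iteratedDeriv (k - 1) f (l * τ + u)) := by
  refine Finset.sum_congr rfl fun k hk => ?_
  have hk1 : k - 1 + 1 = k := Nat.sub_add_cancel (Finset.mem_Icc.1 hk).1
  have h1 : iteratedDeriv (k - 1) (fun z => l * f (l * z + u)) τ =
      l ^ k * iteratedDeriv (k - 1) f (l * τ + u) := by
    rw [iteratedDeriv_const_mul_field, hf.iteratedDeriv_comp_affine, ← mul_assoc, ← pow_succ', hk1]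
  rw [h1]
  ring

theorem eq_and_eventuallyEq_of_simple_pole {a τ : ℂ} {L R : ℂ → ℂ} (hL : AnalyticAt ℂ L τ)
    (hR : AnalyticAt ℂ R τ) (h : ∀ᶠ z in nhdsWithin τ {τ}ᶜ, L z = a / (z - τ) + R z) :
    a = 0 ∧ L =ᶠ[nhds τ] R := by
  have hsub : Tendsto (fun z => (z - τ) * (L z - R z)) (nhdsWithin τ {τ}ᶜ) (nhds 0) := by
    have hc : ContinuousAt (fun z => (z - τ) * (L z - R z)) τ :=
      ContinuousAt.mul (by fun_prop) (hL.continuousAt.sub hR.continuousAt)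
    simpa using hc.tendsto.mono_left nhdsWithin_le_nhds
  have ha : a = 0 := by
    refine tendsto_nhds_unique (tendsto_const_nhds.congr' ?_) hsub
    filter_upwards [h, self_mem_nhdsWithin] with z hz hne
    have hne : z - τ ≠ 0 := sub_ne_zero.2 hne
    rw [hz, add_sub_cancel_right, mul_div_cancel₀ _ hne]
  refine ⟨ha, (hL.frequently_eq_iff_eventually_eq hR).1 (Eventually.frequently ?_)⟩
  filter_upwards [h] with z hz
  rw [hz, ha, zero_div, zero_add]

namespace SSF

variable {σ0 σ1 : ℝ}

theorem analyticAt_archTerm {S : SSF σ0 σ1} {τ : ℂ}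
    (hτpole : ∀ i : Fin S.N, 2 * S.M + S.dlt ≤ (i : ℕ) →
      τ ≠ (σ1 : ℂ) - (starRingEnd ℂ) (S.pole i))
    (hτΓ : ∀ (j : Fin S.r) (k : ℕ), (S.lam j : ℂ) * τ + S.mu j ≠ -(k : ℂ)) :
    AnalyticAt ℂ S.archTerm τ ∧ ∀ n : ℕ, 0 < n → liFunctional n τ S.archTerm =
      (n : ℂ) * τ * (Real.log S.Q : ℂ) +
      (∑ k ∈ Finset.Icc 1 n, (n.choose k : ℂ) * (τ ^ k / ((k - 1).factorial : ℂ)) *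
        ∑ j, ((S.lam j : ℂ)) ^ k *
          iteratedDeriv (k - 1) (fun z : ℂ => deriv Complex.Gamma z / Complex.Gamma z)
            ((S.lam j : ℂ) * τ + S.mu j)) +
      ∑ i ∈ Finset.univ.filter (fun i : Fin S.N => 2 * S.M + S.dlt ≤ (i : ℕ)),
        (S.m i : ℂ) * (1 - (((σ1 : ℂ) - (starRingEnd ℂ) (S.pole i)) /
          ((σ1 : ℂ) - τ - (starRingEnd ℂ) (S.pole i))) ^ n) := by
  have hc : AnalyticAt ℂ (fun _ : ℂ => (Real.log S.Q : ℂ)) τ := analyticAt_const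
  have hψ : ∀ j ∈ (Finset.univ : Finset (Fin S.r)), AnalyticAt ℂ
      (fun z => (S.lam j : ℂ) * Complex.digamma ((S.lam j : ℂ) * z + S.mu j)) τ := fun j _ =>
    analyticAt_const.mul (AnalyticAt.fun_comp (g := Complex.digamma)
      (analyticAt_digamma (hτΓ j)) (by fun_prop))
  have hψs := Finset.analyticAt_fun_sum Finset.univ hψ
  have hp : ∀ i ∈ Finset.univ.filter (fun i : Fin S.N => 2 * S.M + S.dlt ≤ (i : ℕ)), AnalyticAt ℂ
      (fun z => (S.m i : ℂ) / (z - ((σ1 : ℂ) - (starRingEnd ℂ) (S.pole i)))) τ := fun i hi =>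
    analyticAt_const_div_sub (hτpole i (Finset.mem_filter.1 hi).2) _
  have hps := Finset.analyticAt_fun_sum _ hp
  refine ⟨(hc.add hψs).add hps, fun n hn => ?_⟩
  unfold archTerm
  rw [liFunctional_add (hc.fun_add hψs) hps, liFunctional_add hc hψs, liFunctional_const hn,
    liFunctional_sum hψ, liFunctional_sum hp]
  congr 1
  · congr 1
    simp only [liFunctional_mul_comp_affine n (analyticAt_digamma (hτΓ _))]
    rw [Finset.sum_comm]
    refine Finset.sum_congr rfl fun k _ => ?_
    rw [Finset.mul_sum]
    rfl
  · refine Finset.sum_congr rfl fun i hi => ?_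
    rw [liFunctional_const_div_sub (hτpole i (Finset.mem_filter.1 hi).2).symm, sub_right_comm]

theorem liFunctional_logDeriv_xi {S : SSF σ0 σ1} {τ : ℂ} (hτZ : S.xi τ ≠ 0)
    (hτpole : ∀ i : Fin S.N, 2 * S.M + S.dlt ≤ (i : ℕ) →
      τ ≠ (σ1 : ℂ) - (starRingEnd ℂ) (S.pole i))
    (hτΓ : ∀ (j : Fin S.r) (k : ℕ), (S.lam j : ℂ) * τ + S.mu j ≠ -(k : ℂ))
    {mₚ : ℂ} {g : ℂ → ℂ} (hg : AnalyticAt ℂ g τ)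
    (hLaurent : ∀ᶠ s in nhdsWithin τ {τ}ᶜ, deriv S.F s / S.F s = -mₚ / (s - τ) + g s) (n : ℕ) :
    liFunctional n τ (logDeriv S.xi) = liFunctional n τ g +
      (∑ i ∈ Finset.univ.filter (fun i : Fin S.N => S.pole i ≠ τ),
        (S.m i : ℂ) * (1 - (S.pole i / (S.pole i - τ)) ^ n)) + liFunctional n τ S.archTerm := by
  have harch := (analyticAt_archTerm hτpole hτΓ).1
  have hL : AnalyticAt ℂ (logDeriv S.xi) τ :=
    (S.hxiDiff.analyticAt τ).deriv.div (S.hxiDiff.analyticAt τ) hτZ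
  have hp : ∀ i ∈ Finset.univ.filter (fun i : Fin S.N => S.pole i ≠ τ), AnalyticAt ℂ
      (fun z => (S.m i : ℂ) / (z - S.pole i)) τ := fun i hi =>
    analyticAt_const_div_sub (Finset.mem_filter.1 hi).2.symm _
  have hps := Finset.analyticAt_fun_sum _ hp
  have hne : ∀ᶠ z in nhdsWithin τ {τ}ᶜ, ∀ i, z ≠ S.pole i := by
    rw [eventually_all]
    intro i
    rcases eq_or_ne τ (S.pole i) with h | h
    · rw [← h]
      exact self_mem_nhdsWithin
    · exact nhdsWithin_le_nhds (eventually_ne_nhds h)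
  have key := eq_and_eventuallyEq_of_simple_pole
    (a := (∑ i ∈ Finset.univ.filter (fun i : Fin S.N => ¬ S.pole i ≠ τ), (S.m i : ℂ)) - mₚ)
    hL ((hg.fun_add hps).fun_add harch) (by
    filter_upwards [hLaurent, hne, nhdsWithin_le_nhds (eventually_gamma hτΓ),
      nhdsWithin_le_nhds (S.hxiDiff.continuous.continuousAt.eventually_ne hτZ)] with z h1 h2 h3 h4
    rw [logDeriv_xi ⟨h2, h3⟩ h4, h1,
      ← Finset.sum_filter_add_sum_filter_not Finset.univ (fun i : Fin S.N => S.pole i ≠ τ)]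
    have h5 : ∑ i ∈ Finset.univ.filter (fun i : Fin S.N => ¬ S.pole i ≠ τ),
        (S.m i : ℂ) / (z - S.pole i) =
        (∑ i ∈ Finset.univ.filter (fun i : Fin S.N => ¬ S.pole i ≠ τ), (S.m i : ℂ)) / (z - τ) := by
      rw [Finset.sum_div]
      refine Finset.sum_congr rfl fun i hi => ?_
      rw [not_not.1 (Finset.mem_filter.1 hi).2]
    rw [h5, sub_div, neg_div]
    ring)
  rw [liFunctional_congr key.2, liFunctional_add (hg.fun_add hps) harch, liFunctional_add hg hps,
    liFunctional_sum hp]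
  congr 2
  exact Finset.sum_congr rfl fun i hi => liFunctional_const_div_sub (Finset.mem_filter.1 hi).2 _

end SSF

/-- **arithmetic formula, second form.** For `F ∈ S^♯♭(σ₀,σ₁)` with
`0, τ ∉ Z(F)`, `τ ∈ [σ₁, 2σ₀]` avoiding the points `σ₁ − conj(sᵢ)` (`i > 2M+δ(σ₁)`) and the
poles of the gamma factors, if `F′/F(s) = −m/(s−τ) + ∑_{ℓ≥0} b_ℓ (s−τ)^ℓ` is the Laurent
expansion of `F′/F` at `τ` (`m` the order of the pole of `F` at `τ`, `m = 0` if none), then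
the `τ`-Li coefficients are given by an arithmetic formula involving the `b_ℓ` and derivatives
of the digamma function. -/
theorem tauLi_arithmetic_formula' (σ0 σ1 : ℝ) (S : SSF σ0 σ1)
    (h0 : S.xi 0 ≠ 0) (τ : ℝ) (hτZ : S.xi (τ : ℂ) ≠ 0)
    (hτ1 : σ1 ≤ τ) (hτ2 : τ ≤ 2 * σ0)
    (hτpole : ∀ i : Fin S.N, 2 * S.M + S.dlt ≤ (i : ℕ) →
      (τ : ℂ) ≠ (σ1 : ℂ) - (starRingEnd ℂ) (S.pole i))
    (hτΓ : ∀ (j : Fin S.r) (k : ℕ), (S.lam j : ℂ) * τ + S.mu j ≠ -(k : ℂ))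
    (mₚ : ℕ) (b : ℕ → ℂ) (g : ℂ → ℂ) (hg : AnalyticAt ℂ g (τ : ℂ))
    (hLaurent : ∀ᶠ s in nhdsWithin (τ : ℂ) {(τ : ℂ)}ᶜ,
      deriv S.F s / S.F s = -(mₚ : ℂ) / (s - τ) + g s)
    (hb : ∀ ℓ : ℕ, b ℓ = iteratedDeriv ℓ g (τ : ℂ) / (ℓ.factorial : ℂ))
    (n : ℕ) (hn : 0 < n) :
    Filter.Tendsto (fun T : ℝ =>
        ∑' ρ : {ρ : ℂ // S.xi ρ = 0 ∧ |ρ.im| ≤ T},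
          (zeroOrder S.xi ρ : ℂ) * (1 - ((ρ : ℂ) / ((ρ : ℂ) - τ)) ^ n))
      Filter.atTop
      (nhds (
        (∑ i ∈ Finset.univ.filter (fun i : Fin S.N => S.pole i ≠ (τ : ℂ)),
          (S.m i : ℂ) * (1 - (S.pole i / (S.pole i - τ)) ^ n))
        + (∑ i ∈ Finset.univ.filter (fun i : Fin S.N => 2 * S.M + S.dlt ≤ (i : ℕ)),
          (S.m i : ℂ) * (1 - (((σ1 : ℂ) - (starRingEnd ℂ) (S.pole i)) /
            ((σ1 : ℂ) - τ - (starRingEnd ℂ) (S.pole i))) ^ n))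
        + (n : ℂ) * (τ : ℂ) * (Real.log S.Q : ℂ)
        + (∑ k ∈ Finset.Icc 1 n, (n.choose k : ℂ) * (τ : ℂ) ^ k * b (k - 1))
        + (∑ k ∈ Finset.Icc 1 n, (n.choose k : ℂ) *
            ((τ : ℂ) ^ k / ((k - 1).factorial : ℂ)) *
            ∑ j, ((S.lam j : ℂ)) ^ k *
              iteratedDeriv (k - 1) (fun z : ℂ => deriv Complex.Gamma z / Complex.Gamma z)
                ((S.lam j : ℂ) * τ + S.mu j)))) := by
  obtain ⟨A, d, C, hS⟩ := S.exists_isCompletedL h0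
  convert! hS.tendsto_tsum_zeros hτZ n using 2
  rw [SSF.liFunctional_logDeriv_xi hτZ hτpole hτΓ hg hLaurent,
    (SSF.analyticAt_archTerm hτpole hτΓ).2 n hn]
  simp only [hb, liFunctional]
  ring

end
end

section
/- Let K ≥ 1, let α_1,…,α_K > 0 be real numbers, and let Z(F) be the multiset of all numbers ρ + α_i and ρ − α_i, where ρ ranges over the non-trivial zeros of ζ (with multiplicity) and i = 1,…,K. Let τ ≥ 1 be real, n a positive integer, and T ≥ 319. Assume the Riemann–von Mangoldt estimate |N(t) − ((t/(2π))·log(t/(2π)) − t/(2π))| ≤ 8.9·log t for all t ≥ 2, and let A ≥ 0 satisfy |Re ρ + α_i − τ| ≤ A and |Re ρ − α_i − τ| ≤ A for every non-trivial zero ρ of ζ and every i. Then the limit λ_F(n,τ) = lim_{U→∞} ∑_{z ∈ Z(F), |Im z| ≤ U} (1 − (z/(z−τ))^n) exists, and writing λ*_F(n,τ,T) = ∑_{z ∈ Z(F), |Im z| ≤ T} (1 − (z/(z−τ))^n) and E(n,τ,T) = λ_F(n,τ) − λ*_F(n,τ,T), one has |E(n,τ,T)| < (K T/π)·(4 log T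 + 8 log 2)·((1+τ/T)^n − 1) − (K n τ/π)·(4 log T + 8 log 2) + (15/2)·K·n·τ·A·(log T)/T. -/
open Complex Filter Finset

noncomputable section

/-- `ρ` is a non-trivial zero of the Riemann zeta function. -/
def IsNontrivialZero (ρ : ℂ) : Prop :=
  riemannZeta ρ = 0 ∧ 0 < ρ.re ∧ ρ.re < 1

/-- The multiplicity of `ρ` as a zero of `ζ`. -/
noncomputable def zetaMult (ρ : ℂ) : ℕ :=
  sInf {k : ℕ | iteratedDeriv k riemannZeta ρ ≠ 0}

/-- The zero-counting function `N(t)`: the number of non-trivial zeros `ρ` of `ζ` with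
`0 < Im ρ ≤ t`, counted with multiplicity. -/
noncomputable def zetaN (t : ℝ) : ℝ :=
  ∑' ρ : {ρ : ℂ // IsNontrivialZero ρ ∧ 0 < ρ.im ∧ ρ.im ≤ t}, (zetaMult ρ : ℝ)

/-- The truncated `τ`-Li sum for `F(s) = ∏_{i=1}^{K} ζ(s−α_i)ζ(s+α_i)`: the sum of
`1 − (z/(z−τ))^n` over the zeros `z = ρ ± α_i` of `F` with `|Im z| ≤ U`, counted with
multiplicity. -/
noncomputable def shiftedLiSum (K : ℕ) (α : Fin K → ℝ) (τ : ℝ) (n : ℕ) (U : ℝ) : ℂ :=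
  ∑' ρ : {ρ : ℂ // IsNontrivialZero ρ ∧ |ρ.im| ≤ U},
    (zetaMult ρ : ℂ) * ∑ i,
      ((1 - (((ρ : ℂ) + (α i : ℂ)) / ((ρ : ℂ) + (α i : ℂ) - (τ : ℂ))) ^ n) +
       (1 - (((ρ : ℂ) - (α i : ℂ)) / ((ρ : ℂ) - (α i : ℂ) - (τ : ℂ))) ^ n))

/-! ### Real estimates -/

/-- The remainder of the first-order binomial expansion of `(1 + r) ^ n`. -/
def binomRem (n : ℕ) (r : ℝ) : ℝ := (1 + r) ^ n - 1 - n * r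

lemma binomRem_succ (n : ℕ) (r : ℝ) :
    binomRem (n + 1) r = (1 + r) * binomRem n r + n * r ^ 2 := by
  simp only [binomRem]; push_cast; ring

lemma binomRem_nonneg (n : ℕ) {r : ℝ} (hr : 0 ≤ r) : 0 ≤ binomRem n r := by
  induction n with
  | zero => simp [binomRem]
  | succ n ih => rw [binomRem_succ]; positivity

lemma sq_mul_binomRem_le (n : ℕ) {r s : ℝ} (hr : 0 ≤ r) (hrs : r ≤ s) :
    s ^ 2 * binomRem n r ≤ r ^ 2 * binomRem n s := by
  induction n with
  | zero => simp [binomRem]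
  | succ n ih =>
    have h : (1 + r) * (s ^ 2 * binomRem n r) ≤ (1 + s) * (r ^ 2 * binomRem n s) := by
      have := binomRem_nonneg n hr
      have : 0 ≤ 1 + s := by linarith
      gcongr
    rw [binomRem_succ, binomRem_succ]
    linarith

lemma norm_one_add_pow_sub_le (n : ℕ) (u : ℂ) :
    ‖(1 + u) ^ n - 1 - n * u‖ ≤ binomRem n ‖u‖ := by
  induction n with
  | zero => simp [binomRem]
  | succ n ih =>
    have h : (1 + u) ^ (n + 1) - 1 - ((n + 1 : ℕ) : ℂ) * u =
        (1 + u) * ((1 + u) ^ n - 1 - n * u) + n * u ^ 2 := by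
      push_cast; ring
    have h1 : ‖1 + u‖ ≤ 1 + ‖u‖ := (norm_add_le _ _).trans (by simp)
    rw [h, binomRem_succ]
    refine (norm_add_le _ _).trans ?_
    rw [norm_mul, norm_mul, norm_pow, Complex.norm_natCast]
    gcongr

/-- The real part of a single term of the Li sum, bounded in terms of its height. -/
lemma abs_re_one_sub_pow_le (n : ℕ) {z : ℂ} {τ T A : ℝ} (hτ : 0 < τ) (hT : 0 < T)
    (hTz : T < |z.im|) (hA : |z.re - τ| ≤ A) :
    |(1 - (z / (z - τ)) ^ n).re| ≤ (n * τ * A + T ^ 2 * binomRem n (τ / T)) / z.im ^ 2 := by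
  set w : ℂ := z - τ with hw
  have hwim : w.im = z.im := by simp [hw]
  have hwre : w.re = z.re - τ := by simp [hw]
  have hy : 0 < |z.im| := hT.trans hTz
  have hA0 : 0 ≤ A := (abs_nonneg _).trans hA
  have hw0 : w ≠ 0 := by
    intro h
    rw [← hwim, h] at hy
    simp at hy
  have hn0 : 0 < ‖w‖ := norm_pos_iff.mpr hw0
  have hyw : |z.im| ≤ ‖w‖ := hwim ▸ Complex.abs_im_le_norm w
  have hy2 : 0 < z.im ^ 2 := by rw [← sq_abs]; positivity
  have hyw2 : z.im ^ 2 ≤ ‖w‖ ^ 2 := by rw [← sq_abs]; gcongr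
  set u : ℂ := τ / w with hu
  have hzw : z / w = 1 + u := by
    rw [hu, eq_comm, ← div_self hw0, ← add_div, hw]; congr 1; ring
  have hun : ‖u‖ = τ / ‖w‖ := by
    rw [hu, norm_div, Complex.norm_real, Real.norm_of_nonneg hτ.le]
  have hure : u.re = τ * w.re / ‖w‖ ^ 2 := by
    rw [hu, Complex.div_re, Complex.normSq_eq_norm_sq]; simp
  have hdecomp : (1 - (z / w) ^ n).re = -(n * u.re) - ((1 + u) ^ n - 1 - n * u).re := by
    rw [hzw]; simp; ring
  have hlin : |(n : ℝ) * u.re| ≤ n * τ * A / z.im ^ 2 := by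
    rw [hure, abs_mul, abs_div, abs_mul, Nat.abs_cast, abs_of_pos hτ,
      abs_of_pos (by positivity : 0 < ‖w‖ ^ 2), hwre, mul_div_assoc, mul_div_assoc, mul_assoc]
    have : |z.re - τ| / ‖w‖ ^ 2 ≤ A / z.im ^ 2 := by gcongr
    gcongr
  have hrem : |((1 + u) ^ n - 1 - n * u).re| ≤ T ^ 2 * binomRem n (τ / T) / z.im ^ 2 := by
    refine (Complex.abs_re_le_norm _).trans ((norm_one_add_pow_sub_le n u).trans ?_)
    rw [hun]
    have h1 := sq_mul_binomRem_le n (r := τ / ‖w‖) (s := τ / T) (by positivity)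
      (by gcongr; exact hTz.le.trans hyw)
    have h2 : binomRem n (τ / ‖w‖) ≤ T ^ 2 * binomRem n (τ / T) / ‖w‖ ^ 2 := by
      rw [div_pow, div_pow, div_mul_eq_mul_div, div_mul_eq_mul_div,
        div_le_div_iff₀ (by positivity) (by positivity)] at h1
      rw [le_div_iff₀ (by positivity)]
      have h3 : τ ^ 2 * (binomRem n (τ / ‖w‖) * ‖w‖ ^ 2) ≤
          τ ^ 2 * (T ^ 2 * binomRem n (τ / T)) := by linarith
      exact le_of_mul_le_mul_left h3 (by positivity)
    refine h2.trans ?_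
    have := binomRem_nonneg n (r := τ / T) (by positivity)
    gcongr
  rw [hdecomp, add_div]
  calc _ ≤ |-(n * u.re)| + |((1 + u) ^ n - 1 - n * u).re| := abs_sub _ _
    _ ≤ _ := by rw [abs_neg]; exact add_le_add hlin hrem

/-- The main term of the Riemann–von Mangoldt formula. -/
def vonMangoldtMain (t : ℝ) : ℝ :=
  t / (2 * Real.pi) * Real.log (t / (2 * Real.pi)) - t / (2 * Real.pi)

/-- The bound for `∑_{γ > x} γ⁻²`. -/
def tailBound (x : ℝ) : ℝ := (Real.log x + 2 * Real.log 2) / (Real.pi * x)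

lemma tailBound_nonneg {x : ℝ} (hx : 1 ≤ x) : 0 ≤ tailBound x := by
  have := Real.log_nonneg hx
  have := Real.log_nonneg one_le_two
  rw [tailBound]
  positivity

lemma log_319_le : Real.log 319 ≤ 173 / 30 := by
  rw [Real.log_le_iff_le_exp (by norm_num)]
  have h : (319 : ℝ) ^ 30 ≤ Real.exp (173 / 30) ^ 30 := by
    rw [← Real.exp_nat_mul, show ((30 : ℕ) : ℝ) * (173 / 30) = (173 : ℕ) * 1 by norm_num,
      Real.exp_nat_mul]
    calc (319 : ℝ) ^ 30 ≤ 2.71828 ^ 173 := by norm_num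
      _ ≤ _ := by gcongr; linarith [Real.exp_one_gt_d9]
  exact le_of_pow_le_pow_left₀ (by norm_num) (Real.exp_pos _).le h

lemma le_log_pi : 95 / 83 ≤ Real.log Real.pi := by
  rw [Real.le_log_iff_exp_le Real.pi_pos]
  have h : Real.exp (95 / 83) ^ 83 ≤ Real.pi ^ 83 := by
    rw [← Real.exp_nat_mul, show ((83 : ℕ) : ℝ) * (95 / 83) = (95 : ℕ) * 1 by norm_num,
      Real.exp_nat_mul]
    calc Real.exp 1 ^ 95 ≤ 2.7182819 ^ 95 := by gcongr; linarith [Real.exp_one_lt_d9]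
      _ ≤ 3.141592 ^ 83 := by norm_num
      _ ≤ _ := by gcongr; exact Real.pi_gt_d6.le
  exact le_of_pow_le_pow_left₀ (by norm_num) Real.pi_pos.le h

/-- On a dyadic block the Riemann–von Mangoldt bound is dominated by the increment of
`tailBound`. -/
lemma vonMangoldt_dyadic_le {x : ℝ} (hx : 319 ≤ x) :
    (vonMangoldtMain (2 * x) - vonMangoldtMain x +
      8.9 * (Real.log (2 * x) + Real.log x)) / x ^ 2 ≤ tailBound x - tailBound (2 * x) := by
  have hx0 : 0 < x := by linarith
  have hpi := Real.pi_pos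
  have hlogpi := le_log_pi
  have hlog2 : Real.log (2 * x) = Real.log 2 + Real.log x := Real.log_mul (by norm_num) hx0.ne'
  have hlog2pi : Real.log (2 * Real.pi) = Real.log 2 + Real.log Real.pi :=
    Real.log_mul (by norm_num) hpi.ne'
  have hlogx : Real.log x ≤ Real.log 319 + x / 319 - 1 := by
    have h1 := Real.log_le_sub_one_of_pos (x := x / 319) (by positivity)
    rw [Real.log_div hx0.ne' (by norm_num)] at h1
    linarith
  have herr : 8.9 * (2 * Real.pi) * (2 * Real.log x + Real.log 2) ≤
      x * (Real.log Real.pi + 1) := by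
    have h1 : 2 * Real.log x + Real.log 2 ≤ x * (12.22649 / 319) := by
      linarith [log_319_le, Real.log_two_lt_d9]
    have h0 : 0 ≤ x * (12.22649 / 319) := by positivity
    calc 8.9 * (2 * Real.pi) * (2 * Real.log x + Real.log 2)
        ≤ 8.9 * (2 * Real.pi) * (x * (12.22649 / 319)) := by gcongr
      _ ≤ 8.9 * (2 * 3.141593) * (x * (12.22649 / 319)) := by
          gcongr; exact Real.pi_lt_d6.le
      _ ≤ x * (95 / 83 + 1) := by linarith
      _ ≤ x * (Real.log Real.pi + 1) := by gcongr
  have hR : tailBound x - tailBound (2 * x) =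
      (x * (Real.log x + Real.log 2)) / (2 * Real.pi) / x ^ 2 := by
    rw [tailBound, tailBound, hlog2]; field_simp; ring
  have hL : vonMangoldtMain (2 * x) - vonMangoldtMain x =
      x * (Real.log x + Real.log 2 - Real.log Real.pi - 1) / (2 * Real.pi) := by
    rw [vonMangoldtMain, vonMangoldtMain, Real.log_div (by positivity) (by positivity),
      Real.log_div (by positivity) (by positivity), hlog2, hlog2pi]
    field_simp; ring
  rw [hR, hL, hlog2]
  gcongr
  rw [le_div_iff₀ (by positivity), add_mul, div_mul_cancel₀ _ (by positivity)]
  linarith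

/-! ### Finite sums over zeros -/

/-- The type of non-trivial zeros of `ζ`. -/
abbrev NontrivialZero : Type := {ρ : ℂ // IsNontrivialZero ρ}

lemma finite_setOf_abs_im_le (U : ℝ) : {ρ : NontrivialZero | |ρ.1.im| ≤ U}.Finite := by
  have hK : IsCompact (Set.Icc (0 : ℝ) 1 ×ℂ Set.Icc (-U) U) := isCompact_Icc.reProdIm isCompact_Icc
  refine Set.Finite.of_finite_image (f := Subtype.val)
    (hK.inter_riemannZetaZeros_finite.subset ?_) Subtype.val_injective.injOn
  rintro _ ⟨ρ, hρ, rfl⟩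
  exact ⟨⟨⟨ρ.2.2.1.le, ρ.2.2.2.le⟩, abs_le.mp hρ⟩, ρ.2.1⟩

/-- The non-trivial zeros of height at most `U`. -/
def zerosUpTo (U : ℝ) : Finset NontrivialZero := (finite_setOf_abs_im_le U).toFinset

@[simp] lemma mem_zerosUpTo {U : ℝ} {ρ : NontrivialZero} : ρ ∈ zerosUpTo U ↔ |ρ.1.im| ≤ U := by
  simp [zerosUpTo]

lemma zerosUpTo_mono : Monotone zerosUpTo := fun _ _ h _ hρ =>
  mem_zerosUpTo.mpr ((mem_zerosUpTo.mp hρ).trans h)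

lemma tendsto_zerosUpTo : Tendsto zerosUpTo atTop atTop :=
  tendsto_atTop_finset_of_monotone zerosUpTo_mono fun ρ => ⟨|ρ.1.im|, by simp⟩

/-- The non-trivial zeros with imaginary part in `(a, b]`. -/
def zerosBetween (a b : ℝ) : Finset NontrivialZero := {ρ ∈ zerosUpTo b | a < ρ.1.im}

lemma mem_zerosBetween {a b : ℝ} (ha : 0 ≤ a) {ρ : NontrivialZero} :
    ρ ∈ zerosBetween a b ↔ a < ρ.1.im ∧ ρ.1.im ≤ b := by
  rw [zerosBetween, mem_filter, mem_zerosUpTo, and_comm]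
  exact and_congr_right fun h => by rw [abs_of_pos (ha.trans_lt h)]

lemma sum_zerosBetween_add {a b c : ℝ} (ha : 0 ≤ a) (hab : a ≤ b) (hbc : b ≤ c)
    (f : NontrivialZero → ℝ) :
    ∑ ρ ∈ zerosBetween a b, f ρ + ∑ ρ ∈ zerosBetween b c, f ρ = ∑ ρ ∈ zerosBetween a c, f ρ := by
  have hb : 0 ≤ b := ha.trans hab
  rw [← sum_filter_add_sum_filter_not (zerosBetween a c) (fun ρ => ρ.1.im ≤ b)]
  congr 1
  · refine sum_congr (Finset.ext fun ρ => ?_) fun _ _ => rfl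
    rw [mem_filter, mem_zerosBetween ha, mem_zerosBetween ha]
    exact ⟨fun h => ⟨⟨h.1, h.2.trans hbc⟩, h.2⟩, fun h => ⟨h.1.1, h.2⟩⟩
  · refine sum_congr (Finset.ext fun ρ => ?_) fun _ _ => rfl
    rw [mem_filter, mem_zerosBetween ha, mem_zerosBetween hb, not_le]
    exact ⟨fun h => ⟨⟨hab.trans_lt h.1, h.2⟩, h.1⟩, fun h => ⟨h.2, h.1.2⟩⟩

lemma tsum_zeros_eq_sum {E : Type*} [AddCommMonoid E] [TopologicalSpace E]
    {s : Finset NontrivialZero} {Q : ℂ → Prop} (hs : ∀ ρ, ρ ∈ s ↔ Q ρ.1) (f : ℂ → E) :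
    ∑' ρ : {ρ : ℂ // IsNontrivialZero ρ ∧ Q ρ}, f ρ = ∑ ρ ∈ s, f ρ := by
  let e : {ρ : NontrivialZero // ρ ∈ s} ≃ {ρ : ℂ // IsNontrivialZero ρ ∧ Q ρ} :=
    (Equiv.subtypeEquivRight hs).trans (Equiv.subtypeSubtypeEquivSubtypeInter IsNontrivialZero Q)
  rw [← e.tsum_eq, ← Finset.tsum_subtype s fun ρ => f ρ]
  rfl

lemma zetaN_eq_sum (t : ℝ) : zetaN t = ∑ ρ ∈ zerosBetween 0 t, (zetaMult ρ.1 : ℝ) :=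
  tsum_zeros_eq_sum (Q := fun ρ => 0 < ρ.im ∧ ρ.im ≤ t) (fun _ => mem_zerosBetween le_rfl)
    fun ρ => (zetaMult ρ : ℝ)

/-! ### Conjugation symmetry -/

lemma zetaMult_conj (ρ : ℂ) : zetaMult (starRingEnd ℂ ρ) = zetaMult ρ := by
  have hζ : starRingEnd ℂ ∘ riemannZeta ∘ starRingEnd ℂ = riemannZeta :=
    funext fun s => by simp
  have h (k : ℕ) : ∀ s, iteratedDeriv k riemannZeta (starRingEnd ℂ s) =
      starRingEnd ℂ (iteratedDeriv k riemannZeta s) := by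
    induction k with
    | zero => simp
    | succ k ih =>
      intro s
      have hk : starRingEnd ℂ ∘ iteratedDeriv k riemannZeta ∘ starRingEnd ℂ =
          iteratedDeriv k riemannZeta := funext fun s => by simp [ih]
      rw [iteratedDeriv_succ]
      nth_rewrite 1 [← hk]
      rw [deriv_conj_conj]
      simp
  simp [zetaMult, h]

/-- Complex conjugation as a permutation of the non-trivial zeros. -/
def conjZero : NontrivialZero ≃ NontrivialZero :=
  Function.Involutive.toPerm
    (fun ρ => ⟨starRingEnd ℂ ρ.1, by
      obtain ⟨h0, h1, h2⟩ := ρ.2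
      exact ⟨by simp [h0], by simpa using h1, by simpa using h2⟩⟩)
    fun ρ => Subtype.ext (Complex.conj_conj ρ.1)

@[simp] lemma coe_conjZero (ρ : NontrivialZero) : (conjZero ρ : ℂ) = starRingEnd ℂ ρ.1 := rfl

lemma sum_zerosUpTo_conj {E : Type*} [AddCommMonoid E] (U : ℝ) (f : NontrivialZero → E) :
    ∑ ρ ∈ zerosUpTo U, f (conjZero ρ) = ∑ ρ ∈ zerosUpTo U, f ρ :=
  sum_equiv conjZero (by simp) fun _ _ => rfl

/-- Summing a conjugation-equivariant function over the zeros of bounded height gives the sum of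
its real parts. -/
lemma sum_zerosUpTo_eq_sum_re (U : ℝ) {g : ℂ → ℂ}
    (hg : ∀ s, g (starRingEnd ℂ s) = starRingEnd ℂ (g s)) :
    ∑ ρ ∈ zerosUpTo U, g ρ.1 = ((∑ ρ ∈ zerosUpTo U, (g ρ.1).re : ℝ) : ℂ) := by
  have h : starRingEnd ℂ (∑ ρ ∈ zerosUpTo U, g ρ.1) = ∑ ρ ∈ zerosUpTo U, g ρ.1 := by
    rw [map_sum, ← sum_zerosUpTo_conj]
    simp [hg]
  rw [← Complex.re_sum]
  exact (Complex.conj_eq_iff_re.mp h).symm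

/-! ### The Riemann–von Mangoldt estimate -/

/-- The Riemann–von Mangoldt estimate with error term `8.9 log t`. -/
def RiemannVonMangoldt : Prop :=
  ∀ t : ℝ, 2 ≤ t → |zetaN t - vonMangoldtMain t| ≤ 8.9 * Real.log t

namespace RiemannVonMangoldt

lemma nonempty_nontrivialZero (h : RiemannVonMangoldt) : Nonempty NontrivialZero := by
  by_contra hne
  rw [not_nonempty_iff] at hne
  have hpi := Real.pi_gt_three
  have hpi' := Real.pi_lt_four
  have he := Real.exp_one_gt_d9
  have he4 : (53 : ℝ) ≤ Real.exp 4 := by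
    rw [show (4 : ℝ) = (4 : ℕ) * 1 by norm_num, Real.exp_nat_mul]
    calc (53 : ℝ) ≤ 2.7 ^ 4 := by norm_num
      _ ≤ _ := by gcongr; linarith
  have hlog : Real.log (2 * Real.pi) ≤ 2 := by
    rw [Real.log_le_iff_le_exp (by positivity), show (2 : ℝ) = (2 : ℕ) * 1 by norm_num,
      Real.exp_nat_mul]
    calc ((2 : ℕ) * 1 : ℝ) * Real.pi ≤ 2.7 ^ 2 := by norm_num; linarith [Real.pi_lt_d2]
      _ ≤ _ := by gcongr; linarith
  have h1 := h (2 * Real.pi * Real.exp 4) (by nlinarith)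
  have hN : zetaN (2 * Real.pi * Real.exp 4) = 0 := by
    rw [zetaN_eq_sum, Finset.eq_empty_of_isEmpty (zerosBetween _ _), sum_empty]
  rw [hN, vonMangoldtMain, mul_div_cancel_left₀ _ (by positivity), Real.log_exp,
    Real.log_mul (by positivity) (by positivity), Real.log_exp, zero_sub, abs_neg] at h1
  linarith [le_abs_self (Real.exp 4 * 4 - Real.exp 4)]

lemma sum_dyadic_le (h : RiemannVonMangoldt) {x : ℝ} (hx : 319 ≤ x) :
    ∑ ρ ∈ zerosBetween x (2 * x), (zetaMult ρ.1 : ℝ) / ρ.1.im ^ 2 ≤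
      tailBound x - tailBound (2 * x) := by
  have hx0 : 0 < x := by linarith
  refine le_trans ?_ (vonMangoldt_dyadic_le hx)
  have hcount : ∑ ρ ∈ zerosBetween x (2 * x), (zetaMult ρ.1 : ℝ) = zetaN (2 * x) - zetaN x := by
    rw [zetaN_eq_sum, zetaN_eq_sum,
      ← sum_zerosBetween_add le_rfl hx0.le (by linarith : x ≤ 2 * x)]
    ring
  calc _ ≤ ∑ ρ ∈ zerosBetween x (2 * x), (zetaMult ρ.1 : ℝ) / x ^ 2 := by
        refine sum_le_sum fun ρ hρ => ?_
        have := ((mem_zerosBetween hx0.le).mp hρ).1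
        gcongr
    _ = (zetaN (2 * x) - zetaN x) / x ^ 2 := by rw [← sum_div, hcount]
    _ ≤ _ := by
        have h1 := (abs_le.mp (h x (by linarith))).1
        have h2 := (abs_le.mp (h (2 * x) (by linarith))).2
        gcongr
        linarith

lemma sum_zerosBetween_le (h : RiemannVonMangoldt) {T : ℝ} (hT : 319 ≤ T) (U : ℝ) :
    ∑ ρ ∈ zerosBetween T U, (zetaMult ρ.1 : ℝ) / ρ.1.im ^ 2 ≤ tailBound T := by
  have hT0 : 0 < T := by linarith
  have hscale (J : ℕ) : T ≤ 2 ^ J * T := le_mul_of_one_le_left hT0.le (one_le_pow₀ one_le_two)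
  have hJ (J : ℕ) : ∑ ρ ∈ zerosBetween T (2 ^ J * T), (zetaMult ρ.1 : ℝ) / ρ.1.im ^ 2 ≤
      tailBound T - tailBound (2 ^ J * T) := by
    induction J with
    | zero =>
      have hempty : zerosBetween T T = ∅ := eq_empty_of_forall_notMem fun ρ hρ =>
        absurd ((mem_zerosBetween hT0.le).mp hρ) (by rintro ⟨h1, h2⟩; linarith)
      simp [hempty]
    | succ J ih =>
      have h1 := h.sum_dyadic_le (hT.trans (hscale J))
      rw [pow_succ', mul_assoc, ← sum_zerosBetween_add hT0.le (hscale J) (by linarith [hscale J])]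
      linarith
  obtain ⟨J, hUJ⟩ := pow_unbounded_of_one_lt U (one_lt_two (α := ℝ))
  have hU : U ≤ 2 ^ J * T :=
    hUJ.le.trans (le_mul_of_one_le_right (by positivity) (by linarith))
  have hsub : zerosBetween T U ⊆ zerosBetween T (2 ^ J * T) :=
    filter_subset_filter _ (zerosUpTo_mono hU)
  calc _ ≤ ∑ ρ ∈ zerosBetween T (2 ^ J * T), (zetaMult ρ.1 : ℝ) / ρ.1.im ^ 2 :=
        sum_le_sum_of_subset_of_nonneg hsub fun _ _ _ => by positivity
    _ ≤ _ := by linarith [hJ J, tailBound_nonneg (by linarith [hscale J] : 1 ≤ 2 ^ J * T)]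

lemma sum_filter_lt_abs_im_le (h : RiemannVonMangoldt) {T : ℝ} (hT : 319 ≤ T) (U : ℝ) :
    ∑ ρ ∈ zerosUpTo U with T < |ρ.1.im|, (zetaMult ρ.1 : ℝ) / ρ.1.im ^ 2 ≤ 2 * tailBound T := by
  have hT0 : 0 < T := by linarith
  have hneg : ∑ ρ ∈ zerosUpTo U with T < -ρ.1.im, (zetaMult ρ.1 : ℝ) / ρ.1.im ^ 2 =
      ∑ ρ ∈ zerosBetween T U, (zetaMult ρ.1 : ℝ) / ρ.1.im ^ 2 :=
    sum_equiv conjZero (by simp [zerosBetween]) (by simp [zetaMult_conj])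
  have hsplit : ∑ ρ ∈ zerosUpTo U with T < |ρ.1.im|, (zetaMult ρ.1 : ℝ) / ρ.1.im ^ 2 =
      ∑ ρ ∈ zerosBetween T U, (zetaMult ρ.1 : ℝ) / ρ.1.im ^ 2 +
      ∑ ρ ∈ zerosUpTo U with T < -ρ.1.im, (zetaMult ρ.1 : ℝ) / ρ.1.im ^ 2 := by
    simp_rw [lt_abs, filter_or]
    refine sum_union (disjoint_filter.mpr fun ρ _ h1 h2 => ?_)
    linarith
  rw [hsplit, hneg]
  linarith [h.sum_zerosBetween_le hT U]

end RiemannVonMangoldt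

/-! ### The Li sum -/

lemma RiemannVonMangoldt.exists_tendsto_sum (h : RiemannVonMangoldt) {T : ℝ} (hT : 319 ≤ T)
    {f : NontrivialZero → ℝ} {C : ℝ} (hC : 0 ≤ C)
    (hf : ∀ ρ, T < |ρ.1.im| → |f ρ| ≤ C * (zetaMult ρ.1 / ρ.1.im ^ 2)) :
    ∃ L : ℝ, Tendsto (fun U => ∑ ρ ∈ zerosUpTo U, f ρ) atTop (nhds L) ∧
      |L - ∑ ρ ∈ zerosUpTo T, f ρ| ≤ C * (2 * tailBound T) := by
  have htail (U : ℝ) : ∑ ρ ∈ zerosUpTo U with T < |ρ.1.im|, |f ρ| ≤ C * (2 * tailBound T) :=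
    calc _ ≤ ∑ ρ ∈ zerosUpTo U with T < |ρ.1.im|, C * (zetaMult ρ.1 / ρ.1.im ^ 2) :=
          sum_le_sum fun ρ hρ => hf ρ (mem_filter.mp hρ).2
      _ ≤ _ := by
          rw [← mul_sum]
          exact mul_le_mul_of_nonneg_left (h.sum_filter_lt_abs_im_le hT U) hC
  have hhead {U : ℝ} (hU : T ≤ U) : {ρ ∈ zerosUpTo U | ¬ T < |ρ.1.im|} = zerosUpTo T := by
    ext ρ
    simp only [mem_filter, mem_zerosUpTo, not_lt, and_iff_right_iff_imp]
    exact fun hρ => hρ.trans hU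
  have hsum : Summable f := by
    refine Summable.of_abs (summable_of_sum_le (fun ρ => abs_nonneg (f ρ))
      (c := C * (2 * tailBound T) + ∑ ρ ∈ zerosUpTo T, |f ρ|) fun s => ?_)
    obtain ⟨U, hsU, hTU⟩ :=
      ((tendsto_zerosUpTo.eventually_ge_atTop s).and (eventually_ge_atTop T)).exists
    refine (sum_le_sum_of_subset_of_nonneg hsU fun _ _ _ => abs_nonneg _).trans ?_
    rw [← sum_filter_add_sum_filter_not (zerosUpTo U) (fun ρ => T < |ρ.1.im|), hhead hTU]
    gcongr
    exact htail U
  have hlim : Tendsto (fun U => ∑ ρ ∈ zerosUpTo U, f ρ) atTop (nhds (∑' ρ, f ρ)) :=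
    hsum.hasSum.comp tendsto_zerosUpTo
  refine ⟨_, hlim, le_of_tendsto (hlim.sub_const _).abs ?_⟩
  filter_upwards [eventually_ge_atTop T] with U hTU
  rw [← sum_filter_add_sum_filter_not (zerosUpTo U) (fun ρ => T < |ρ.1.im|), hhead hTU,
    add_sub_cancel_right]
  exact (abs_sum_le_sum_abs _ _).trans (htail U)

/-- The contribution of the zero `ρ` of `ζ`, without its multiplicity, to `shiftedLiSum`. -/
def shiftedLiTerm {K : ℕ} (α : Fin K → ℝ) (τ : ℝ) (n : ℕ) (ρ : ℂ) : ℂ :=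
  ∑ i, ((1 - ((ρ + (α i : ℂ)) / (ρ + (α i : ℂ) - (τ : ℂ))) ^ n) +
    (1 - ((ρ - (α i : ℂ)) / (ρ - (α i : ℂ) - (τ : ℂ))) ^ n))

lemma shiftedLiSum_eq_ofReal {K : ℕ} (α : Fin K → ℝ) (τ : ℝ) (n : ℕ) (U : ℝ) :
    shiftedLiSum K α τ n U =
      ((∑ ρ ∈ zerosUpTo U, (zetaMult ρ.1 * shiftedLiTerm α τ n ρ.1 : ℂ).re : ℝ) : ℂ) := by
  rw [← sum_zerosUpTo_eq_sum_re U (g := fun ρ => zetaMult ρ * shiftedLiTerm α τ n ρ) fun s => by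
    simp [shiftedLiTerm, zetaMult_conj]]
  exact tsum_zeros_eq_sum (Q := fun ρ => |ρ.im| ≤ U) (fun _ => mem_zerosUpTo)
    fun ρ => (zetaMult ρ * shiftedLiTerm α τ n ρ : ℂ)

lemma abs_re_shiftedLiTerm_le {K : ℕ} (α : Fin K → ℝ) (n : ℕ) {ρ : ℂ} {τ T A : ℝ} (hτ : 0 < τ)
    (hT : 0 < T) (hρ : T < |ρ.im|)
    (hA : ∀ i, |ρ.re + α i - τ| ≤ A ∧ |ρ.re - α i - τ| ≤ A) :
    |(shiftedLiTerm α τ n ρ).re| ≤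
      2 * K * (n * τ * A + T ^ 2 * binomRem n (τ / T)) / ρ.im ^ 2 := by
  rw [shiftedLiTerm, Complex.re_sum]
  refine (abs_sum_le_sum_abs _ _).trans ?_
  calc _ ≤ ∑ _i : Fin K, 2 * ((n * τ * A + T ^ 2 * binomRem n (τ / T)) / ρ.im ^ 2) := by
        refine sum_le_sum fun i _ => ?_
        have h1 := abs_re_one_sub_pow_le n (z := ρ + α i) hτ hT (by simpa using hρ)
          (by simpa using (hA i).1)
        have h2 := abs_re_one_sub_pow_le n (z := ρ - α i) hτ hT (by simpa using hρ)
          (by simpa using (hA i).2)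
        rw [show (ρ + α i).im = ρ.im by simp] at h1
        rw [show (ρ - α i).im = ρ.im by simp] at h2
        rw [Complex.add_re, two_mul]
        exact (abs_add_le _ _).trans (add_le_add h1 h2)
    _ = _ := by rw [sum_const, card_univ, Fintype.card_fin, nsmul_eq_mul]; ring

/-- For `F(s) = ∏_{i=1}^{K} ζ(s−α_i)ζ(s+α_i)` with `α_i > 0`, `τ ≥ 1`,
`n ≥ 1` and `T ≥ 319`, assuming the Riemann–von Mangoldt estimate, the `τ`-Li coefficient
`λ_F(n,τ)` exists as a symmetric limit and the truncation error `E(n,τ,T)` at height `T`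
satisfies the explicit bound. -/
theorem truncation_error_estimate (K : ℕ) (hK : 1 ≤ K) (α : Fin K → ℝ)
    (hα : ∀ i, 0 < α i) (τ : ℝ) (hτ : 1 ≤ τ) (n : ℕ) (hn : 0 < n) (T : ℝ) (hT : 319 ≤ T)
    (hRvM : ∀ t : ℝ, 2 ≤ t →
      |zetaN t - (t / (2 * Real.pi) * Real.log (t / (2 * Real.pi)) - t / (2 * Real.pi))| ≤
        8.9 * Real.log t)
    (A : ℝ) (hA : 0 ≤ A)
    (hAbd : ∀ ρ : ℂ, IsNontrivialZero ρ → ∀ i,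
      |ρ.re + α i - τ| ≤ A ∧ |ρ.re - α i - τ| ≤ A) :
    ∃ L : ℂ,
      Filter.Tendsto (fun U : ℝ => shiftedLiSum K α τ n U) Filter.atTop (nhds L) ∧
      ‖L - shiftedLiSum K α τ n T‖ <
        (K * T / Real.pi) * (4 * Real.log T + 8 * Real.log 2) * ((1 + τ / T) ^ n - 1) -
        (K * n * τ / Real.pi) * (4 * Real.log T + 8 * Real.log 2) +
        (15 / 2) * K * n * τ * A * Real.log T / T := by
  have hT0 : 0 < T := by linarith
  have hτ0 : 0 < τ := by linarith
  have hK0 : (0 : ℝ) < K := by exact_mod_cast hK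
  have hn0 : (0 : ℝ) < n := by exact_mod_cast hn
  have hR : RiemannVonMangoldt := hRvM
  have hApos : 0 < A := by
    obtain ⟨ρ⟩ := hR.nonempty_nontrivialZero
    obtain ⟨h1, h2⟩ := hAbd ρ.1 ρ.2 ⟨0, hK⟩
    linarith [hα ⟨0, hK⟩, (abs_le.mp h1).2, (abs_le.mp h2).1]
  have hB := binomRem_nonneg n (r := τ / T) (by positivity)
  obtain ⟨L, hL, hLT⟩ := hR.exists_tendsto_sum hT
    (f := fun ρ => (zetaMult ρ.1 * shiftedLiTerm α τ n ρ.1 : ℂ).re)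
    (C := 2 * K * (n * τ * A + T ^ 2 * binomRem n (τ / T))) (by positivity) fun ρ hρ => by
      rw [← Complex.ofReal_natCast, Complex.re_ofReal_mul, abs_mul, Nat.abs_cast]
      have := abs_re_shiftedLiTerm_le α n hτ0 hT0 hρ fun i => hAbd ρ.1 ρ.2 i
      calc _ ≤ _ := mul_le_mul_of_nonneg_left this (Nat.cast_nonneg _)
        _ = _ := by ring
  refine ⟨L, ?_, ?_⟩
  · simp_rw [shiftedLiSum_eq_ofReal]
    exact (Complex.continuous_ofReal.tendsto L).comp hL
  · rw [shiftedLiSum_eq_ofReal, ← Complex.ofReal_sub, Complex.norm_real, Real.norm_eq_abs]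
    refine hLT.trans_lt ?_
    have hlogT : 1 < Real.log T := by
      rw [Real.lt_log_iff_exp_lt hT0]
      linarith [Real.exp_one_lt_d9]
    have htail : tailBound T < 15 / 8 * Real.log T / T := by
      rw [tailBound, div_lt_div_iff₀ (by positivity) hT0]
      have : Real.log T + 2 * Real.log 2 < 15 / 8 * Real.log T * Real.pi := by
        nlinarith [Real.pi_gt_three, Real.log_two_lt_d9]
      nlinarith
    have hlin : 4 * K * n * τ * A * tailBound T < 4 * K * n * τ * A * (15 / 8 * Real.log T / T) := by
      gcongr
    have hmain : 4 * K * T ^ 2 * binomRem n (τ / T) * tailBound T =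
        (K * T / Real.pi) * (4 * Real.log T + 8 * Real.log 2) * ((1 + τ / T) ^ n - 1) -
        (K * n * τ / Real.pi) * (4 * Real.log T + 8 * Real.log 2) := by
      have hpi := Real.pi_pos
      rw [tailBound, binomRem]
      generalize (1 + τ / T) ^ n = P
      field_simp
      ring
    calc _ = 4 * K * T ^ 2 * binomRem n (τ / T) * tailBound T +
          4 * K * n * τ * A * tailBound T := by ring
      _ < _ := add_lt_add_of_le_of_lt hmain.le (hlin.trans_eq (by ring))

end
end
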